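/- arXiv:1010.0321 — 5 statements merged into one kernel-verified Lean document; each statement's English description precedes it below -/
import Mathlib

section
/- (Dehornoy) The braid group B_n is left-orderable for every n ≥ 1: there exists a linear (total) order < on B_n such that for all a, b, c ∈ B_n, a < b implies ca < cb. -/
/-- The set of Artin braid relations in the free group on `n - 1` generators:
`σᵢσⱼ = σⱼσᵢ` for `|i - j| > 1` and `σᵢσⱼσᵢ = σⱼσᵢσⱼ` for `|i - j| = 1`. -/
def braidRels (n : ℕ) : Set (FreeGroup (Fin (n - 1))) :=
  { r | (∃ i j : Fin (n - 1), (i : ℕ) + 1 < (j : ℕ) ∧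
          r = FreeGroup.of i * FreeGroup.of j * (FreeGroup.of j * FreeGroup.of i)⁻¹) ∨
        (∃ i j : Fin (n - 1), (j : ℕ) = (i : ℕ) + 1 ∧
          r = FreeGroup.of i * FreeGroup.of j * FreeGroup.of i *
              (FreeGroup.of j * FreeGroup.of i * FreeGroup.of j)⁻¹) }

/-- The braid group on `n` strands, via the Artin presentation. -/
abbrev BraidGroup (n : ℕ) : Type := PresentedGroup (braidRels n)

/-- The standard Artin generator `σᵢ` (`0`-indexed: `i = 0, …, n - 2`). -/
def braidGen (n : ℕ) (i : Fin (n - 1)) : BraidGroup n := PresentedGroup.of i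

namespace BraidLO

/-- signed letter -/
def el (b : Bool) (k : ℕ) : FreeGroup ℕ := if b then FreeGroup.of k else (FreeGroup.of k)⁻¹

/-- alternating products `e_{k₁} e_{k₂}⁻¹ e_{k₃} ⋯` -/
def alt : Bool → List ℕ → FreeGroup ℕ
  | _, [] => 1
  | b, k :: L => el b k * alt (!b) L

def altWord : Bool → List ℕ → List (ℕ × Bool)
  | _, [] => []
  | b, k :: L => (k, b) :: altWord (!b) L

def sgn (a b : ℕ) : ℤ := if a < b then 1 else if b < a then -1 else 0

def ta : ℤ → List ℕ → ℤ
  | _, [] => 0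
  | _, [_] => 0
  | s, a :: b :: L => s * sgn a b + ta (-s) (b :: L)

@[simp] lemma ta_nil (s : ℤ) : ta s [] = 0 := rfl
@[simp] lemma ta_one (s : ℤ) (a : ℕ) : ta s [a] = 0 := rfl
@[simp] lemma ta_cons (s : ℤ) (a b : ℕ) (L : List ℕ) :
    ta s (a :: b :: L) = s * sgn a b + ta (-s) (b :: L) := rfl

noncomputable def tau (g : FreeGroup ℕ) : ℤ := ta 1 (g.toWord.map Prod.fst)

lemma mk_altWord (b : Bool) (L : List ℕ) : FreeGroup.mk (altWord b L) = alt b L := by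
  induction L generalizing b with
  | nil => rfl
  | cons k L ih =>
    rw [altWord, alt, ← ih, ← List.singleton_append, ← FreeGroup.mul_mk]
    congr 1
    cases b <;> simp [el, FreeGroup.of, FreeGroup.invRev]

lemma map_altWord (b : Bool) (L : List ℕ) : (altWord b L).map Prod.fst = L := by
  induction L generalizing b with
  | nil => rfl
  | cons k L ih => simp [altWord, ih]

lemma isReduced_altWord (b : Bool) (L : List ℕ) (h : L.IsChain (· ≠ ·)) :
    FreeGroup.IsReduced (altWord b L) := by
  induction L generalizing b with
  | nil => simp [altWord]
  | cons k L ih =>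
    cases L with
    | nil => simp [altWord]
    | cons k' L =>
      have h' := List.isChain_cons_cons.1 h
      have := ih (!b) h'.2
      simp only [altWord] at this ⊢
      rw [FreeGroup.isReduced_cons_cons]
      exact ⟨fun e => absurd e h'.1, this⟩

lemma tau_alt (b : Bool) (L : List ℕ) (h : L.IsChain (· ≠ ·)) : tau (alt b L) = ta 1 L := by
  rw [tau, ← mk_altWord, FreeGroup.toWord_mk, (isReduced_altWord b L h).reduce_eq, map_altWord]

/-- even alternating elements -/
def Ev (g : FreeGroup ℕ) : Prop :=
  ∃ L : List ℕ, L.IsChain (· ≠ ·) ∧ Even L.length ∧ g = alt true L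

/-- `e_c ↦ e_p e_c⁻¹ e_q` -/
def sg (p c q : ℕ) : FreeGroup ℕ →* FreeGroup ℕ :=
  FreeGroup.lift fun j => if j = c then FreeGroup.of p * (FreeGroup.of c)⁻¹ * FreeGroup.of q
    else FreeGroup.of j

lemma sg_of (p c q j : ℕ) : sg p c q (FreeGroup.of j) =
    if j = c then FreeGroup.of p * (FreeGroup.of c)⁻¹ * FreeGroup.of q
    else FreeGroup.of j := by simp [sg]

lemma sg_el_ne (p c q j : ℕ) (b : Bool) (h : j ≠ c) : sg p c q (el b j) = el b j := by
  cases b <;> simp [el, sg_of, h]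

lemma sg_el_t (p c q : ℕ) : sg p c q (el true c) = el true p * el false c * el true q := by
  simp [el, sg_of]
lemma sg_el_f (p c q : ℕ) : sg p c q (el false c) = el false q * el true c * el false p := by
  simp [el, sg_of, mul_assoc]

lemma sg_el_gen (p c q p' q' : ℕ) (b : Bool)
    (h : (b = true ∧ p' = p ∧ q' = q) ∨ (b = false ∧ p' = q ∧ q' = p)) :
    sg p c q (el b c) = el b p' * el (!b) c * el b q' := by
  rcases h with ⟨rfl, rfl, rfl⟩ | ⟨rfl, rfl, rfl⟩
  · exact sg_el_t _ _ _
  · exact sg_el_f _ _ _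

lemma el_cancel (b : Bool) (k : ℕ) (x : FreeGroup ℕ) : el b k * (el (!b) k * x) = x := by
  cases b <;> simp [el]
lemma el_cancel' (b : Bool) (k : ℕ) (x : FreeGroup ℕ) : el (!b) k * (el b k * x) = x := by
  cases b <;> simp [el]

/-- control on the head of the image word -/
def Hd (p c q : ℕ) : List ℕ → List ℕ → Prop
  | [], L' => L' = []
  | k :: _, L' => (k = c ∧ ∃ R, L' = p :: c :: R) ∨
      (k ≠ c ∧ ((∃ R, L' = k :: R ∧ (k = p → ∀ R', R ≠ c :: R')) ∨ (k = q ∧ ∃ R, L' = c :: R)))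

lemma sgn_eq_left {a b c : ℕ} (h : a = b + 1 ∨ b = a + 1) (h1 : c ≠ a) (h2 : c ≠ b) :
    sgn a c = sgn b c := by
  unfold sgn; split_ifs <;> omega
lemma sgn_eq_right {a b c : ℕ} (h : a = b + 1 ∨ b = a + 1) (h1 : c ≠ a) (h2 : c ≠ b) :
    sgn c a = sgn c b := by
  unfold sgn; split_ifs <;> omega
lemma sgn_mid {p c q : ℕ} (hc : (p = c + 1 ∧ c = q + 1) ∨ (c = p + 1 ∧ q = c + 1)) :
    sgn p c = sgn c q := by
  unfold sgn; split_ifs <;> omega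
lemma sgn_symm (a b : ℕ) : sgn a b = - sgn b a := by
  unfold sgn; split_ifs <;> omega

lemma sg_alt (p₀ c q₀ : ℕ) (hc₀ : (p₀ = c + 1 ∧ c = q₀ + 1) ∨ (c = p₀ + 1 ∧ q₀ = c + 1))
    (L : List ℕ) : ∀ (b : Bool) (p q : ℕ), L.IsChain (· ≠ ·) →
    ((b = true ∧ p = p₀ ∧ q = q₀) ∨ (b = false ∧ p = q₀ ∧ q = p₀)) →
    ∃ L' : List ℕ, L'.IsChain (· ≠ ·) ∧ sg p₀ c q₀ (alt b L) = alt b L' ∧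
      (∀ s, ta s L' = ta s L) ∧ (Even L'.length ↔ Even L.length) ∧ Hd p c q L L' := by
  induction L with
  | nil => intro b p q _ _; exact ⟨[], by simp, by simp [alt], by simp, by simp, rfl⟩
  | cons a L ih =>
    intro b p q hL hb
    have hc : (p = c + 1 ∧ c = q + 1) ∨ (c = p + 1 ∧ q = c + 1) := by omega
    have hb' : ((!b) = true ∧ q = p₀ ∧ p = q₀) ∨ ((!b) = false ∧ q = q₀ ∧ p = p₀) := by
      rcases hb with ⟨rfl, h⟩ | ⟨rfl, h⟩ <;> simp [h]
    obtain ⟨L', hch, halt, hta, hev, hhd⟩ := ih (!b) q p hL.tail hb'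
    have hmul : sg p₀ c q₀ (alt b (a :: L)) = sg p₀ c q₀ (el b a) * alt (!b) L' := by
      rw [alt, map_mul, halt]
    have hpc : p ≠ c := by omega
    have hqc : q ≠ c := by omega
    have hm := sgn_mid hc
    by_cases hac : a = c
    · subst hac
      rw [sg_el_gen p₀ a q₀ p q b hb] at hmul
      cases L with
      | nil =>
        simp only [Hd] at hhd
        subst hhd
        refine ⟨[p, a, q], by simp; omega, ?_, ?_, by simp; decide, ?_⟩
        · rw [hmul]; simp [alt, mul_assoc]
        · intro s; simp [hm]
        · left; simp
      | cons k L =>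
        have hak : a ≠ k := (List.isChain_cons_cons.1 hL).1
        rcases hhd with ⟨h, _⟩ | ⟨_, ⟨R, rfl, hR⟩ | ⟨rfl, R, rfl⟩⟩
        · exact absurd h.symm hak
        · by_cases hkq : k = q
          · subst hkq
            refine ⟨p :: a :: R, ?_, ?_, ?_, ?_, ?_⟩
            · cases R with
              | nil => simpa using hpc
              | cons r R =>
                have := hR rfl
                simp only [List.isChain_cons_cons] at hch ⊢
                refine ⟨hpc, ?_, hch.2⟩
                rintro rfl
                exact this R rfl
            · rw [hmul]; simp [alt, mul_assoc, el_cancel]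
            · intro s
              rw [ta_cons, ta_cons, ← hta]
              rw [hm]
              cases R with
              | nil => simp
              | cons r R =>
                have := hR rfl
                simp only [List.isChain_cons_cons] at hch
                simp only [ta_cons]
                rw [sgn_eq_left (a := a) (b := k) (c := r) (by omega) _ hch.1.symm]
                rintro rfl
                exact this R rfl
            · simp only [List.length_cons] at hev ⊢
              grind
            · left; simp
          · refine ⟨p :: a :: q :: k :: R, ?_, ?_, ?_, ?_, ?_⟩
            · simp only [List.isChain_cons_cons]
              exact ⟨hpc, hqc.symm, fun h => hkq h.symm, hch⟩
            · rw [hmul]; simp [alt, mul_assoc]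
            · intro s
              have h1 := hta (-s)
              simp only [ta_cons, neg_neg] at h1 ⊢
              rw [h1, hm, sgn_eq_left (a := q) (b := a) (c := k) (by omega) hkq hak.symm]
              ring
            · simp only [List.length_cons] at hev ⊢
              grind
            · left; simp
        · refine ⟨k :: a :: q :: a :: R, ?_, ?_, ?_, ?_, ?_⟩
          · simp only [List.isChain_cons_cons]
            exact ⟨hpc, hqc.symm, hqc, hch⟩
          · rw [hmul]; simp [alt, mul_assoc]
          · intro s
            have h1 := hta (-s)
            simp only [ta_cons, neg_neg] at h1 ⊢
            rw [h1, hm, sgn_symm q a, sgn_symm a k, hm]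
            ring
          · simp only [List.length_cons] at hev ⊢
            grind
          · left; simp
    · rw [sg_el_ne _ _ _ _ _ hac] at hmul
      cases L with
      | nil =>
        simp only [Hd] at hhd
        subst hhd
        refine ⟨[a], by simp, by rw [hmul]; simp [alt], by simp, by simp, ?_⟩
        right; refine ⟨hac, Or.inl ⟨[], rfl, by simp⟩⟩
      | cons k L =>
        have hak : a ≠ k := (List.isChain_cons_cons.1 hL).1
        rcases hhd with ⟨rfl, R, rfl⟩ | ⟨hkc, ⟨R, rfl, hR⟩ | ⟨rfl, R, rfl⟩⟩
        · by_cases haq : a = q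
          · subst haq
            refine ⟨k :: R, hch.tail, ?_, ?_, ?_, ?_⟩
            · rw [hmul]; simp [alt, el_cancel]
            · intro s
              have h1 := hta (-s)
              simp only [ta_cons, neg_neg] at h1 ⊢
              rw [← h1]; ring
            · simp only [List.length_cons] at hev ⊢
              grind
            · right; exact ⟨hac, Or.inr ⟨rfl, R, rfl⟩⟩
          · refine ⟨a :: q :: k :: R, ?_, ?_, ?_, ?_, ?_⟩
            · simp only [List.isChain_cons_cons] at hch ⊢
              exact ⟨haq, hch⟩
            · rw [hmul]; simp [alt]
            · intro s
              rw [ta_cons, hta, ta_cons, sgn_eq_right (a := q) (b := k) (by omega) haq hac]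
            · simp only [List.length_cons] at hev ⊢
              grind
            · right; refine ⟨hac, Or.inl ⟨_, rfl, ?_⟩⟩
              rintro - R' h
              simp at h; omega
        · refine ⟨a :: k :: R, ?_, ?_, ?_, ?_, ?_⟩
          · simp only [List.isChain_cons_cons]
            exact ⟨hak, hch⟩
          · rw [hmul]; simp [alt]
          · intro s
            rw [ta_cons, hta, ta_cons]
          · simp only [List.length_cons] at hev ⊢
            grind
          · right; refine ⟨hac, Or.inl ⟨_, rfl, ?_⟩⟩
            rintro - R' h
            simp at h; omega
        · refine ⟨a :: c :: R, ?_, ?_, ?_, ?_, ?_⟩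
          · simp only [List.isChain_cons_cons]
            exact ⟨hac, hch⟩
          · rw [hmul]; simp [alt]
          · intro s
            rw [ta_cons, hta, ta_cons, sgn_eq_right (a := c) (b := k) (by omega) hac hak]
          · simp only [List.length_cons] at hev ⊢
            grind
          · right; refine ⟨hac, Or.inl ⟨_, rfl, ?_⟩⟩
            intro h
            exact absurd h hak

lemma Ev_sg {p c q : ℕ} (hc : (p = c + 1 ∧ c = q + 1) ∨ (c = p + 1 ∧ q = c + 1))
    {g : FreeGroup ℕ} (hg : Ev g) : Ev (sg p c q g) ∧ tau (sg p c q g) = tau g := by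
  obtain ⟨L, hL, he, rfl⟩ := hg
  obtain ⟨L', h1, h2, h3, h4, -⟩ := sg_alt p c q hc L true p q hL (by simp)
  exact ⟨⟨L', h1, h4.2 he, h2⟩, by rw [h2, tau_alt _ _ h1, tau_alt _ _ hL, h3]⟩

/-! ### quasimorphism property -/

lemma ta_neg (s : ℤ) (L : List ℕ) : ta (-s) L = - ta s L := by
  induction L generalizing s with
  | nil => simp
  | cons a L ih =>
    cases L with
    | nil => simp
    | cons b L => simp only [ta_cons, ih]; ring

/-- reversed prefix glued to a word -/
lemma ta_glue (A : List ℕ) : ∀ (B : List ℕ) (s : ℤ) (a b : ℕ),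
    ta (s * (-1) ^ A.length) ((a :: A).reverse ++ b :: B)
      = - ta (-s) (a :: A) + s * sgn a b + ta (-s) (b :: B) := by
  induction A with
  | nil => intro B s a b; simp
  | cons a' A ih =>
    intro B s a b
    have h := ih (b :: B) (-s) a' a
    simp only [List.reverse_cons, List.append_assoc, List.cons_append, List.nil_append,
      List.length_cons, pow_succ, ta_cons, neg_neg] at h ⊢
    rw [show s * ((-1) ^ A.length * -1) = -s * (-1) ^ A.length by ring, h, sgn_symm a' a]
    ring

lemma ta_rev (A : List ℕ) (s : ℤ) (a : ℕ) :
    ta (s * (-1) ^ A.length) ((a :: A).reverse) = - ta (-s) (a :: A) := by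
  cases A with
  | nil => simp
  | cons a' A =>
    have h := ta_glue A [] (-s) a' a
    simp only [List.reverse_cons, List.append_assoc, List.cons_append, List.nil_append,
      List.length_cons, pow_succ, ta_cons, neg_neg] at h ⊢
    rw [show s * ((-1) ^ A.length * -1) = -s * (-1) ^ A.length by ring, h, sgn_symm a' a]
    simp

def fl : Bool → ℕ → Bool
  | b, 0 => b
  | b, n + 1 => fl (!b) n

lemma fl_two (b : Bool) (n : ℕ) : fl b (n + n) = b := by
  induction n with
  | zero => rfl
  | succ n ih =>
    rw [show n + 1 + (n + 1) = (n + n) + 1 + 1 by ring]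
    simp [fl, ih]

lemma el_inv (b : Bool) (k : ℕ) : (el b k)⁻¹ = el (!b) k := by cases b <;> simp [el]

lemma alt_glue (A : List ℕ) : ∀ (B : List ℕ) (b : Bool),
    (alt b A)⁻¹ * alt b B = alt (fl b A.length) (A.reverse ++ B) := by
  induction A with
  | nil => intro B b; simp [alt, fl]
  | cons a A ih =>
    intro B b
    simp only [List.reverse_cons, List.append_assoc, List.cons_append, List.nil_append,
      List.length_cons, fl]
    rw [← ih]
    simp [alt, mul_assoc, el_inv]

lemma chain_glue {A B : List ℕ} {a k : ℕ} (hA : (a :: A).IsChain (· ≠ ·))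
    (hB : (k :: B).IsChain (· ≠ ·)) (h : a ≠ k) :
    ((a :: A).reverse ++ k :: B).IsChain (· ≠ ·) := by
  rw [List.isChain_append]
  refine ⟨?_, hB, by simpa using h⟩
  rw [List.isChain_reverse]
  exact hA.imp fun _ _ h => Ne.symm h

lemma chain_rev {A : List ℕ} (hA : A.IsChain (· ≠ ·)) : A.reverse.IsChain (· ≠ ·) := by
  rw [List.isChain_reverse]
  exact hA.imp fun _ _ h => Ne.symm h

lemma sgn_bd (a k p : ℕ) : |sgn a k + sgn p a - sgn p k| ≤ 1 := by
  rw [abs_le]; unfold sgn; split_ifs <;> omega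
lemma sgn_bd1 (a k : ℕ) : |sgn a k| ≤ 1 := by
  rw [abs_le]; unfold sgn; split_ifs <;> omega
lemma abs_sign_mul {s x : ℤ} (hs : s = 1 ∨ s = -1) : |s * x| = |x| := by
  rcases hs with rfl | rfl <;> simp

lemma strip (A : List ℕ) : ∀ (B : List ℕ) (b : Bool) (s : ℤ) (p : ℕ), (s = 1 ∨ s = -1) →
    (p :: A).IsChain (· ≠ ·) → (p :: B).IsChain (· ≠ ·) →
    ∃ C : List ℕ, C.IsChain (· ≠ ·) ∧ (alt b A)⁻¹ * alt b B = alt (fl b A.length) C ∧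
      (Even C.length ↔ Even (A.length + B.length)) ∧
      |ta (s * (-1) ^ (A.length + 1)) C + ta s (p :: A) - ta s (p :: B)| ≤ 1 := by
  induction A with
  | nil =>
    intro B b s p hs hA hB
    refine ⟨B, hB.tail, by simp [alt, fl], by simp, ?_⟩
    cases B with
    | nil => simp
    | cons k B =>
      have : ta (s * (-1) ^ ([].length (α := ℕ) + 1)) (k :: B) + ta s [p] - ta s (p :: k :: B)
        = s * (- sgn p k) := by
        simp
      rw [this, abs_sign_mul hs, abs_neg]
      exact sgn_bd1 _ _
  | cons a A ih =>
    intro B b s p hs hA hB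
    have hpow : s * (-1) ^ ((a :: A).length + 1) = s * (-1) ^ A.length := by
      simp [pow_succ]
    cases B with
    | nil =>
      refine ⟨(a :: A).reverse, chain_rev hA.tail, ?_, ?_, ?_⟩
      · rw [alt_glue]; simp
      · simp
      · rw [hpow, ta_rev, ta_cons, ta_one]
        rw [show -ta (-s) (a :: A) + (s * sgn p a + ta (-s) (a :: A)) - 0 = s * sgn p a by ring,
          abs_sign_mul hs]
        exact sgn_bd1 _ _
    | cons k B =>
      by_cases hak : a = k
      · subst hak
        obtain ⟨C, h1, h2, h3, h4⟩ := ih B (!b) (-s) a (by omega) hA.tail hB.tail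
        refine ⟨C, h1, ?_, ?_, ?_⟩
        · rw [List.length_cons, fl, ← h2]; simp [alt, mul_assoc]
        · rw [h3]; simp only [List.length_cons]; grind
        · rw [hpow, ta_cons, ta_cons]
          rw [show -s * (-1) ^ (A.length + 1) = s * (-1) ^ A.length by ring] at h4
          convert h4 using 2
          ring
      · refine ⟨(a :: A).reverse ++ k :: B, chain_glue hA.tail hB.tail hak, ?_, ?_, ?_⟩
        · rw [alt_glue]
        · rw [List.length_append, List.length_reverse]
        · rw [hpow, ta_glue, ta_cons, ta_cons]
          rw [show -ta (-s) (a :: A) + s * sgn a k + ta (-s) (k :: B)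
            + (s * sgn p a + ta (-s) (a :: A)) - (s * sgn p k + ta (-s) (k :: B))
            = s * (sgn a k + sgn p a - sgn p k) by ring, abs_sign_mul hs]
          exact sgn_bd _ _ _

lemma Ev_quasi {g h : FreeGroup ℕ} (hg : Ev g) (hh : Ev h) :
    Ev (g⁻¹ * h) ∧ |tau (g⁻¹ * h) + tau g - tau h| ≤ 1 := by
  obtain ⟨A, hA, hAe, rfl⟩ := hg
  obtain ⟨B, hB, hBe, rfl⟩ := hh
  have hfl : fl true A.length = true := by
    obtain ⟨n, hn⟩ := hAe
    rw [hn, fl_two]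
  suffices H : ∃ C : List ℕ, C.IsChain (· ≠ ·) ∧
      (alt true A)⁻¹ * alt true B = alt true C ∧
      (Even C.length) ∧ |ta 1 C + ta 1 A - ta 1 B| ≤ 1 by
    obtain ⟨C, h1, h2, h3, h4⟩ := H
    refine ⟨⟨C, h1, h3, h2⟩, ?_⟩
    rwa [h2, tau_alt _ _ h1, tau_alt _ _ hA, tau_alt _ _ hB]
  cases A with
  | nil => exact ⟨B, hB, by simp [alt], hBe, by simp⟩
  | cons a A =>
    have hpow : (-1 : ℤ) * (-1) ^ A.length = 1 := by
      have := hAe.neg_one_pow (α := ℤ)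
      simpa [pow_succ] using this
    cases B with
    | nil =>
      refine ⟨(a :: A).reverse, chain_rev hA, ?_, by simpa using hAe, ?_⟩
      · conv_rhs => rw [← hfl]
        rw [alt_glue]; simp
      · have := ta_rev A (-1) a
        rw [hpow] at this
        rw [this]; simp
    | cons k B =>
      by_cases hak : a = k
      · subst hak
        obtain ⟨C, h1, h2, h3, h4⟩ := strip A B false 1 a (by simp) hA hB
        refine ⟨C, h1, ?_, ?_, ?_⟩
        · conv_rhs => rw [← hfl]
          rw [List.length_cons, fl, Bool.not_true, ← h2]; simp [alt, mul_assoc]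
        · rw [h3]; simp only [List.length_cons] at hAe hBe; grind
        · rwa [show (1 : ℤ) * (-1) ^ (A.length + 1) = -1 * (-1) ^ A.length by ring, hpow] at h4
      · refine ⟨(a :: A).reverse ++ k :: B, chain_glue hA hB hak, ?_, ?_, ?_⟩
        · conv_rhs => rw [← hfl]
          rw [alt_glue]
        · rw [List.length_append, List.length_reverse]; exact hAe.add hBe
        · have := ta_glue A B (-1) a k
          rw [hpow] at this
          rw [this]
          rw [show -ta (- -1) (a :: A) + -1 * sgn a k + ta (- -1) (k :: B) + ta 1 (a :: A)
            - ta 1 (k :: B) = - sgn a k by rw [neg_neg]; ring, abs_neg]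
          exact sgn_bd1 _ _

lemma ta_parity (L : List ℕ) : ∀ (s : ℤ) (a : ℕ), (s = 1 ∨ s = -1) →
    (a :: L).IsChain (· ≠ ·) → (ta s (a :: L)) % 2 = L.length % 2 := by
  induction L with
  | nil => simp
  | cons b L ih =>
    intro s a hs h
    have h1 := ih (-s) b (by omega) h.tail
    have hab : a ≠ b := (List.isChain_cons_cons.1 h).1
    have : s * sgn a b = 1 ∨ s * sgn a b = -1 := by
      unfold sgn
      rcases hs with rfl | rfl <;> split_ifs <;> omega
    rw [ta_cons, List.length_cons]
    push_cast
    omega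

lemma Ev_odd {g : FreeGroup ℕ} (hg : Ev g) (h1 : g ≠ 1) : tau g % 2 = 1 := by
  obtain ⟨L, hL, he, rfl⟩ := hg
  rw [tau_alt _ _ hL]
  cases L with
  | nil => exact absurd rfl h1
  | cons a L =>
    rw [ta_parity L 1 a (by simp) hL]
    simp only [List.length_cons] at he
    obtain ⟨n, hn⟩ := he
    omega

lemma Ev_one : Ev 1 := ⟨[], by simp, by simp, rfl⟩

lemma tau_one : tau 1 = 0 := by simp [tau]

lemma Ev_inv {g : FreeGroup ℕ} (hg : Ev g) : Ev g⁻¹ ∧ tau g⁻¹ = - tau g := by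
  have h := Ev_quasi hg Ev_one
  rw [mul_one, tau_one] at h
  refine ⟨h.1, ?_⟩
  by_cases h1 : g = 1
  · simp [h1, tau_one]
  · have := Ev_odd hg h1
    have := Ev_odd h.1 (by simpa using h1)
    have := abs_le.1 h.2
    omega

lemma Ev_mul {g h : FreeGroup ℕ} (hg : Ev g) (hh : Ev h) :
    Ev (g * h) ∧ tau g + tau h - 1 ≤ tau (g * h) := by
  have h1 := Ev_quasi (Ev_inv hg).1 hh
  rw [inv_inv, (Ev_inv hg).2] at h1
  have := abs_le.1 h1.2
  exact ⟨h1.1, by omega⟩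

lemma Ev_eq_one {g : FreeGroup ℕ} (hg : Ev g) (h : tau g = 0) : g = 1 := by
  by_contra h1
  have := Ev_odd hg h1
  omega

/-- loop around strand `j` -/
def X (j : ℕ) : FreeGroup ℕ := FreeGroup.of j * (FreeGroup.of (j + 1))⁻¹

lemma Ev_X (j : ℕ) : Ev (X j) := ⟨[j, j + 1], by simp, by simp, by simp [X, alt, el]⟩

/-! ### Artin action -/

lemma sg_sg (p c q : ℕ) (hp : p ≠ c) (hq : q ≠ c) : (sg q c p).comp (sg p c q) = MonoidHom.id _ := by
  apply FreeGroup.ext_hom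
  intro j
  by_cases h : j = c
  · subst h; simp [sg_of, hp, hq, mul_assoc]
  · simp [sg_of, h]

def sigma (i : ℕ) : MulAut (FreeGroup ℕ) :=
  MonoidHom.toMulEquiv (sg (i + 2) (i + 1) i) (sg i (i + 1) (i + 2))
    (sg_sg _ _ _ (by omega) (by omega)) (sg_sg _ _ _ (by omega) (by omega))

lemma sigma_apply (i : ℕ) (g : FreeGroup ℕ) : sigma i g = sg (i + 2) (i + 1) i g := rfl
lemma sigma_inv_apply (i : ℕ) (g : FreeGroup ℕ) : (sigma i)⁻¹ g = sg i (i + 1) (i + 2) g := rfl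

lemma aut_ext {f g : MulAut (FreeGroup ℕ)} (h : ∀ j, f (FreeGroup.of j) = g (FreeGroup.of j)) :
    f = g := by
  have : f.toMonoidHom = g.toMonoidHom := FreeGroup.ext_hom _ _ h
  ext x
  exact DFunLike.congr_fun this x

lemma sigma_comm (i j : ℕ) (h : i + 1 < j) : sigma i * sigma j = sigma j * sigma i := by
  apply aut_ext
  intro k
  simp only [MulAut.mul_apply, sigma_apply, sg_of]
  by_cases h1 : k = i + 1
  · subst h1
    simp [sg_of, show i + 2 ≠ j + 1 by omega, show i ≠ j + 1 by omega,
      show i ≠ j by omega]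
  · by_cases h2 : k = j + 1
    · subst h2
      simp [sg_of, show j ≠ i by omega, show j + 1 ≠ i by omega, show j ≠ i + 1 by omega]
    · simp [sg_of, h1, h2]

lemma sigma_braid (i : ℕ) :
    sigma i * sigma (i + 1) * sigma i = sigma (i + 1) * sigma i * sigma (i + 1) := by
  apply aut_ext
  intro k
  simp only [MulAut.mul_apply, sigma_apply, sg_of]
  by_cases h1 : k = i + 1
  · subst h1; simp [sg_of, mul_assoc, show i ≠ i + 1 + 1 by omega]
  · by_cases h2 : k = i + 2
    · subst h2
      simp [sg_of, mul_assoc, show i ≠ i + 1 + 1 by omega]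
    · simp [sg_of, h1, h2]

lemma sigma_X_self (i : ℕ) : sigma i (X i) = X (i + 1) := by
  simp [X, sigma_apply, sg_of, mul_assoc]
lemma sigma_X_succ (i : ℕ) : sigma i (X (i + 1)) = (X (i + 1))⁻¹ * X i * X (i + 1) := by
  simp [X, sigma_apply, sg_of, mul_assoc]
lemma sigma_X_ne (i j : ℕ) (h1 : j ≠ i) (h2 : j ≠ i + 1) : sigma i (X j) = X j := by
  simp [X, sigma_apply, sg_of, h1, h2]

/-- forget strand `m` -/
def forget (m : ℕ) : FreeGroup ℕ →* FreeGroup ℕ :=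
  FreeGroup.lift fun j => if j ≤ m then FreeGroup.of j else FreeGroup.of (j - 1)

lemma forget_of (m j : ℕ) : forget m (FreeGroup.of j) =
    if j ≤ m then FreeGroup.of j else FreeGroup.of (j - 1) := by simp [forget]

lemma forget_sq (m : ℕ) (g : FreeGroup ℕ) : forget m (sigma m (sigma m g)) = forget m g := by
  have : ((forget m).comp (sigma m).toMonoidHom).comp (sigma m).toMonoidHom = forget m := by
    apply FreeGroup.ext_hom
    intro j
    by_cases h : j = m + 1
    · subst h; simp [sigma_apply, sg_of, forget_of]
    · simp [sigma_apply, sg_of, forget_of, h]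
  exact DFunLike.congr_fun this g

lemma forget_sigma (m j : ℕ) (h : m ≤ j) (g : FreeGroup ℕ) :
    forget m (sigma (j + 1) g) = sigma j (forget m g) := by
  have : (forget m).comp (sigma (j + 1)).toMonoidHom = (sigma j).toMonoidHom.comp (forget m) := by
    apply FreeGroup.ext_hom
    intro k
    by_cases hk : k = j + 2
    · subst hk
      simp only [MonoidHom.comp_apply, MulEquiv.toMonoidHom_eq_coe, MonoidHom.coe_coe,
        sigma_apply, sg_of, forget_of]
      rw [if_pos trivial, if_neg (by omega)]
      simp only [map_mul, map_inv, forget_of, sg_of, show j + 2 - 1 = j + 1 by omega, if_true]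
      rw [if_neg (by omega), if_neg (by omega)]
      by_cases h' : j + 1 ≤ m
      · omega
      · simp [h']
    · simp only [MonoidHom.comp_apply, MulEquiv.toMonoidHom_eq_coe, MonoidHom.coe_coe,
        sigma_apply, sg_of, forget_of]
      rw [if_neg (by omega), forget_of]
      split_ifs with h'
      · rw [sg_of, if_neg (by omega)]
      · rw [sg_of, if_neg (by omega)]
  exact DFunLike.congr_fun this g

lemma forget_X_self (m : ℕ) : forget m (X m) = 1 := by
  simp [X, forget_of]
lemma forget_X_gt (m d : ℕ) : forget m (X (m + 1 + d)) = X (m + d) := by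
  simp only [X, map_mul, map_inv, forget_of]
  rw [if_neg (by omega), if_neg (by omega)]
  rw [show m + 1 + d - 1 = m + d by omega, show m + 1 + d + 1 - 1 = m + d + 1 by omega]

end BraidLO

namespace BraidLO

/-! ### braid combinatorics -/

structure Br {G : Type*} [Group G] (s : ℕ → G) (N : ℕ) : Prop where
  comm : ∀ i j, i + 1 < j → j < N → Commute (s i) (s j)
  braid : ∀ i, i + 1 < N → s i * s (i + 1) * s i = s (i + 1) * s i * s (i + 1)

section
variable {G : Type*} [Group G]

lemma b3a {a b : G} (h : a * b * a = b * a * b) : b * (a * a) * b⁻¹ = a⁻¹ * (b * b) * a := by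
  have h1 : a * (b * (a * a)) = (b * b) * a * b := by
    calc a * (b * (a * a)) = (a * b * a) * a := by group
      _ = (b * a * b) * a := by rw [h]
      _ = b * (a * b * a) := by group
      _ = _ := by rw [h]; group
  rw [mul_inv_eq_iff_eq_mul, mul_assoc, mul_assoc, eq_inv_mul_iff_mul_eq, h1]
  group

lemma b3b {a b : G} (h : a * b * a = b * a * b) : Commute b (a * (b * b) * a) := by
  unfold Commute SemiconjBy
  calc b * (a * (b * b) * a) = (b * a * b) * (b * a) := by group
    _ = a * b * (a * b * a) := by rw [← h]; group
    _ = _ := by rw [h]; group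

def tt (s : ℕ → G) (m : ℕ) : ℕ → G
  | 0 => 1
  | d + 1 => s (m + d) * tt s m d

def cc (s : ℕ → G) (m : ℕ) : ℕ → G
  | 0 => 1
  | d + 1 => s (m + d + 1) * cc s m d

def AA (s : ℕ → G) (m d : ℕ) : G := cc s m d * (s m * s m) * (cc s m d)⁻¹

def HH (s : ℕ → G) (N m : ℕ) : Subgroup G :=
  Subgroup.closure {g | ∃ i, m ≤ i ∧ i < N ∧ g = s i}

def KK (s : ℕ → G) (N m : ℕ) : Subgroup G :=
  Subgroup.closure {g | ∃ d, m + d < N ∧ g = AA s m d}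

variable {s : ℕ → G} {N : ℕ}

lemma s_mem_HH {m i : ℕ} (h1 : m ≤ i) (h2 : i < N) : s i ∈ HH s N m :=
  Subgroup.subset_closure ⟨i, h1, h2, rfl⟩

lemma AA_mem_KK {m d : ℕ} (h : m + d < N) : AA s m d ∈ KK s N m :=
  Subgroup.subset_closure ⟨d, h, rfl⟩

lemma AA_succ (m d : ℕ) : AA s m (d + 1) = s (m + d + 1) * AA s m d * (s (m + d + 1))⁻¹ := by
  simp only [AA, cc]; group

lemma Br.comm_tt (hb : Br s N) (m d j : ℕ) (h : m + d < j) (hj : j < N) :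
    Commute (s j) (tt s m d) := by
  induction d with
  | zero => exact Commute.one_right _
  | succ d ih => exact (hb.comm _ _ (by omega) hj).symm.mul_right (ih (by omega))

lemma Br.AA_eq (hb : Br s N) (m d : ℕ) (h : m + d < N) :
    AA s m d = (tt s m d)⁻¹ * (s (m + d) * s (m + d)) * tt s m d := by
  induction d with
  | zero => simp [AA, cc, tt]
  | succ d ih =>
    have hc := (hb.comm_tt m d (m + d + 1) (by omega) (by omega))
    have hc' : (s (m + d + 1))⁻¹ * tt s m d = tt s m d * (s (m + d + 1))⁻¹ := hc.inv_left.eq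
    have hc'' : s (m + d + 1) * (tt s m d)⁻¹ = (tt s m d)⁻¹ * s (m + d + 1) := hc.inv_right.eq
    have h3 := b3a (hb.braid (m + d) (by omega))
    rw [AA_succ, ih (by omega), tt]
    calc s (m + d + 1) * ((tt s m d)⁻¹ * (s (m + d) * s (m + d)) * tt s m d) * (s (m + d + 1))⁻¹
        = (s (m + d + 1) * (tt s m d)⁻¹) * (s (m + d) * s (m + d))
            * (tt s m d * (s (m + d + 1))⁻¹) := by group
      _ = (tt s m d)⁻¹ * (s (m + d + 1) * (s (m + d) * s (m + d)) * (s (m + d + 1))⁻¹)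
            * tt s m d := by rw [hc'', ← hc']; group
      _ = _ := by rw [h3, ← add_assoc]; group

lemma Br.shift_tt (hb : Br s N) (m d j : ℕ) (hm : m ≤ j) (h : j + 1 < m + d) (hN : m + d ≤ N) :
    s j * tt s m d = tt s m d * s (j + 1) := by
  induction d with
  | zero => omega
  | succ d ih =>
    by_cases h1 : j + 1 = m + d
    · obtain ⟨d, rfl⟩ : ∃ d', d = d' + 1 := ⟨d - 1, by omega⟩
      obtain rfl : j = m + d := by omega
      have hc := hb.comm_tt m d (m + d + 1) (by omega) (by omega)
      have hbr := hb.braid (m + d) (by omega)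
      simp only [tt, ← add_assoc]
      calc s (m + d) * (s (m + d + 1) * (s (m + d) * tt s m d))
          = (s (m + d) * s (m + d + 1) * s (m + d)) * tt s m d := by group
        _ = s (m + d + 1) * s (m + d) * (s (m + d + 1) * tt s m d) := by rw [hbr]; group
        _ = _ := by rw [hc.eq]; group
    · have hc := hb.comm j (m + d) (by omega) (by omega)
      rw [tt, ← mul_assoc, hc.eq, mul_assoc, ih (by omega) (by omega), mul_assoc]

lemma Br.comm_AA_gt (hb : Br s N) (m d j : ℕ) (h : m + d + 1 < j) (hj : j < N) :
    Commute (s j) (AA s m d) := by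
  rw [hb.AA_eq m d (by omega)]
  have h1 := hb.comm_tt m d j (by omega) hj
  have h2 := (hb.comm (m + d) j (by omega) hj).symm
  exact (h1.inv_right.mul_right (h2.mul_right h2)).mul_right h1

lemma Br.comm_AA_lt (hb : Br s N) (m d j : ℕ) (hm : m ≤ j) (h : j + 1 < m + d) (hj : m + d < N) :
    Commute (s (j + 1)) (AA s m d) := by
  rw [hb.AA_eq m d (by omega)]
  have h1 := hb.shift_tt m d j hm h (by omega)
  have h2 := (hb.comm j (m + d) (by omega) hj)
  have h3 : s (j + 1) = (tt s m d)⁻¹ * s j * tt s m d := by rw [mul_assoc, h1]; group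
  have h4 : Commute (s j) (s (m + d) * s (m + d)) := h2.mul_right h2
  rw [h3]
  unfold Commute SemiconjBy
  calc _ = (tt s m d)⁻¹ * (s j * (s (m + d) * s (m + d))) * tt s m d := by group
    _ = _ := by rw [h4.eq]; group

lemma Br.comm_AA_AA (hb : Br s N) (m d : ℕ) (h : m + d + 1 < N) :
    Commute (s (m + d + 1)) (AA s m d * AA s m (d + 1)) := by
  have h1 := hb.comm_tt m d (m + d + 1) (by omega) (by omega)
  have h2 := b3b (hb.braid (m + d) (by omega))
  have h3 : AA s m d * AA s m (d + 1) =
      (tt s m d)⁻¹ * (s (m + d) * (s (m + d + 1) * s (m + d + 1)) * s (m + d)) * tt s m d := by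
    rw [hb.AA_eq m d (by omega), hb.AA_eq m (d + 1) (by omega), tt, ← add_assoc]
    group
  rw [h3]
  exact (h1.inv_right.mul_right h2).mul_right h1

lemma Br.conj_AA (hb : Br s N) (m d j : ℕ) (hm : m < j) (hj : j < N) (hd : m + d < N) :
    s j * AA s m d * (s j)⁻¹ ∈ KK s N m ∧ (s j)⁻¹ * AA s m d * s j ∈ KK s N m := by
  have key : Commute (s j) (AA s m d) →
      s j * AA s m d * (s j)⁻¹ ∈ KK s N m ∧ (s j)⁻¹ * AA s m d * s j ∈ KK s N m := by
    intro hc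
    have e1 : s j * AA s m d * (s j)⁻¹ = AA s m d := by rw [hc.eq]; group
    have e2 : (s j)⁻¹ * AA s m d * s j = AA s m d := by rw [mul_assoc, ← hc.eq]; group
    rw [e1, e2]
    exact ⟨AA_mem_KK hd, AA_mem_KK hd⟩
  rcases lt_trichotomy j (m + d) with h | h | h
  · obtain ⟨j, rfl⟩ : ∃ j', j = j' + 1 := ⟨j - 1, by omega⟩
    exact key (hb.comm_AA_lt m d j (by omega) h hd)
  · subst h
    obtain ⟨d, rfl⟩ : ∃ d', d = d' + 1 := ⟨d - 1, by omega⟩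
    have h1 := hb.comm_AA_AA m d hd
    have h2 := AA_succ (s := s) m d
    have hA : AA s m d ∈ KK s N m := AA_mem_KK (by omega)
    have hA' : AA s m (d + 1) ∈ KK s N m := AA_mem_KK (by omega)
    rw [← add_assoc]
    constructor
    · have : s (m + d + 1) * AA s m (d + 1) * (s (m + d + 1))⁻¹ =
          (AA s m (d + 1))⁻¹ * AA s m d * AA s m (d + 1) := by
        have h3 : s (m + d + 1) * (AA s m d * AA s m (d + 1)) * (s (m + d + 1))⁻¹
          = AA s m d * AA s m (d + 1) := by rw [h1.eq]; group
        rw [mul_assoc _ (AA s m d), ← h3]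
        nth_rewrite 2 [h2]
        group
      rw [this]
      exact mul_mem (mul_mem (inv_mem hA') hA) hA'
    · rw [h2]
      convert hA using 1
      group
  · by_cases h' : j = m + d + 1
    · subst h'
      have h1 := hb.comm_AA_AA m d hj
      have h2 := AA_succ (s := s) m d
      have hA' : AA s m (d + 1) ∈ KK s N m := AA_mem_KK (by omega)
      have hA : AA s m d ∈ KK s N m := AA_mem_KK (by omega)
      refine ⟨h2 ▸ hA', ?_⟩
      have : (s (m + d + 1))⁻¹ * AA s m d * s (m + d + 1) =
          AA s m d * AA s m (d + 1) * (AA s m d)⁻¹ := by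
        have h3 : (s (m + d + 1))⁻¹ * (AA s m d * AA s m (d + 1)) * s (m + d + 1)
          = AA s m d * AA s m (d + 1) := by rw [mul_assoc, ← h1.eq]; group
        rw [← h3]
        rw [h2]
        group
      rw [this]
      exact mul_mem (mul_mem hA hA') (inv_mem hA)
    · exact key (hb.comm_AA_gt m d j (by omega) hj)

lemma Br.conj_KK (hb : Br s N) (m j : ℕ) (hm : m < j) (hj : j < N) {κ : G} (hκ : κ ∈ KK s N m) :
    s j * κ * (s j)⁻¹ ∈ KK s N m ∧ (s j)⁻¹ * κ * s j ∈ KK s N m := by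
  unfold KK at hκ
  induction hκ using Subgroup.closure_induction with
  | mem x hx =>
    obtain ⟨d, hd, rfl⟩ := hx
    exact hb.conj_AA m d j hm hj hd
  | one => simp [one_mem]
  | mul x y _ _ hx hy =>
    constructor
    · convert mul_mem hx.1 hy.1 using 1; group
    · convert mul_mem hx.2 hy.2 using 1; group
  | inv x _ hx =>
    constructor
    · convert inv_mem hx.1 using 1; group
    · convert inv_mem hx.2 using 1; group

lemma Br.conj_HH (hb : Br s N) (m : ℕ) {h κ : G} (hh : h ∈ HH s N (m + 1)) (hκ : κ ∈ KK s N m) :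
    h * κ * h⁻¹ ∈ KK s N m := by
  unfold HH at hh
  induction hh using Subgroup.closure_induction_left generalizing κ with
  | one => simpa using hκ
  | mul_left x hx y hy ih =>
    obtain ⟨i, hi, hi', rfl⟩ := hx
    convert (hb.conj_KK m i (by omega) hi' (ih hκ)).1 using 1; group
  | inv_mul_cancel x hx y hy ih =>
    obtain ⟨i, hi, hi', rfl⟩ := hx
    convert (hb.conj_KK m i (by omega) hi' (ih hκ)).2 using 1; group

/-- `x` is a product of an element of `KK` and one of `HH (m+1)`, up to a transversal. -/
def Dec (s : ℕ → G) (N m : ℕ) (g : G) : Prop :=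
  ∃ d κ h, m + d ≤ N ∧ κ ∈ KK s N m ∧ h ∈ HH s N (m + 1) ∧ g = tt s m d * κ * h

lemma Br.swap (hb : Br s N) (m d i : ℕ) (hd : m + d ≤ N) (hm : m ≤ i) (hi : i < N) :
    Dec s N m (s i * tt s m d) ∧ Dec s N m ((s i)⁻¹ * tt s m d) := by
  rcases lt_trichotomy i (m + d) with h | h | h
  · by_cases h1 : i + 1 = m + d
    · obtain ⟨d, rfl⟩ : ∃ d', d = d' + 1 := ⟨d - 1, by omega⟩
      obtain rfl : i = m + d := by omega
      refine ⟨⟨d, AA s m d, 1, by omega, AA_mem_KK hi, one_mem _, ?_⟩,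
        ⟨d, 1, 1, by omega, one_mem _, one_mem _, ?_⟩⟩
      · rw [hb.AA_eq m d hi, tt]; group
      · rw [tt]; group
    · have h2 := hb.shift_tt m d i hm (by omega) hd
      have h3 : s (i + 1) ∈ HH s N (m + 1) := s_mem_HH (by omega) (by omega)
      refine ⟨⟨d, 1, s (i + 1), hd, one_mem _, h3, ?_⟩,
        ⟨d, 1, (s (i + 1))⁻¹, hd, one_mem _, inv_mem h3, ?_⟩⟩
      · rw [h2]; group
      · rw [mul_one, eq_mul_inv_iff_mul_eq, mul_assoc, ← h2]; group
  · subst h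
    refine ⟨⟨d + 1, 1, 1, by omega, one_mem _, one_mem _, ?_⟩,
      ⟨d + 1, (AA s m d)⁻¹, 1, by omega, inv_mem (AA_mem_KK hi), one_mem _, ?_⟩⟩
    · rw [tt]; group
    · rw [hb.AA_eq m d hi, tt]; group
  · have h2 := hb.comm_tt m d i h hi
    have h3 : s i ∈ HH s N (m + 1) := s_mem_HH (by omega) (by omega)
    refine ⟨⟨d, 1, s i, hd, one_mem _, h3, ?_⟩,
      ⟨d, 1, (s i)⁻¹, hd, one_mem _, inv_mem h3, ?_⟩⟩
    · rw [h2.eq]; group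
    · rw [h2.inv_left.eq]; group

lemma Br.dec_mul (hb : Br s N) (m : ℕ) {g κ h : G} (hg : Dec s N m g) (hκ : κ ∈ KK s N m)
    (hh : h ∈ HH s N (m + 1)) : Dec s N m (g * κ * h) := by
  obtain ⟨d, κ', h', hd, hκ', hh', rfl⟩ := hg
  refine ⟨d, κ' * (h' * κ * h'⁻¹), h' * h, hd, mul_mem hκ' (hb.conj_HH m hh' hκ),
    mul_mem hh' hh, ?_⟩
  group

lemma Br.decomp (hb : Br s N) (m : ℕ) (hm : m ≤ N) {g : G} (hg : g ∈ HH s N m) : Dec s N m g := by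
  unfold HH at hg
  induction hg using Subgroup.closure_induction_left with
  | one => exact ⟨0, 1, 1, hm, one_mem _, one_mem _, by simp [tt]⟩
  | mul_left x hx y hy ih =>
    obtain ⟨i, hi, hi', rfl⟩ := hx
    obtain ⟨d, κ, h, hd, hκ, hh, rfl⟩ := ih
    have := hb.dec_mul m (hb.swap m d i hd hi hi').1 hκ hh
    simpa only [mul_assoc] using this
  | inv_mul_cancel x hx y hy ih =>
    obtain ⟨i, hi, hi', rfl⟩ := hx
    obtain ⟨d, κ, h, hd, hκ, hh, rfl⟩ := ih
    have := hb.dec_mul m (hb.swap m d i hd hi hi').2 hκ hh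
    simpa only [mul_assoc] using this

/-! ### the stabilizer of `X m` -/

lemma exists_hom (y : ℕ → G) : ∃ Φ : FreeGroup ℕ →* G, ∀ j, Φ (X j) = y j := by
  let f : ℕ → G := fun n => Nat.rec 1 (fun j r => (y j)⁻¹ * r) n
  refine ⟨FreeGroup.lift f, fun j => ?_⟩
  have : f (j + 1) = (y j)⁻¹ * f j := rfl
  simp [X, this]

open Classical in
noncomputable def bump (G : Type*) [Group G] : Equiv.Perm (G × ℤ) where
  toFun p := (p.1, p.2 + if p.1 = 1 then 1 else 0)
  invFun p := (p.1, p.2 - if p.1 = 1 then 1 else 0)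
  left_inv p := by simp
  right_inv p := by simp

def lm (g : G) : Equiv.Perm (G × ℤ) := (Equiv.mulLeft g).prodCongr (Equiv.refl ℤ)

lemma centralizer_X (m : ℕ) (Φ : FreeGroup ℕ →* G) (w : FreeGroup ℕ)
    (hw : w * X m * w⁻¹ = X m) : Φ (forget m w) = 1 := by
  let Θ : FreeGroup ℕ →* Equiv.Perm (G × ℤ) := FreeGroup.lift fun j =>
    if j = m + 1 then (bump G)⁻¹ * lm (Φ (forget m (FreeGroup.of m)))
      else lm (Φ (forget m (FreeGroup.of j)))
  have hX : Θ (X m) = bump G := by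
    simp [Θ, X]
  have hfst : ∀ (w : FreeGroup ℕ) (p : G × ℤ), (Θ w p).1 = Φ (forget m w) * p.1 := by
    intro w
    have hof : ∀ (j : ℕ) (p : G × ℤ),
        (Θ (FreeGroup.of j) p).1 = Φ (forget m (FreeGroup.of j)) * p.1 := by
      intro j p
      by_cases h : j = m + 1
      · subst h
        have h1 : ∀ p, ((bump G).symm p).1 = p.1 := fun p => rfl
        simp [Θ, h1, lm, forget_of]
      · simp [Θ, h, lm]
    induction w using FreeGroup.induction_on with
    | C1 => simp
    | of j => exact hof j
    | inv_of j _ =>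
      intro p
      have := hof j ((Θ (FreeGroup.of j))⁻¹ p)
      have e : Θ (FreeGroup.of j) ((Θ (FreeGroup.of j))⁻¹ p) = p :=
        Equiv.apply_symm_apply _ _
      rw [e] at this
      rw [map_inv, map_inv, map_inv, this, inv_mul_cancel_left]
    | mul x y hx hy => intro p; simp [hx, hy, mul_assoc]
  by_contra hne
  have h1 : w * X m = X m * w := by rw [← mul_inv_eq_iff_eq_mul]; exact hw
  have h2 : Θ w (Θ (X m) (1, 0)) = Θ (X m) (Θ w (1, 0)) := by
    rw [← Equiv.Perm.mul_apply, ← Equiv.Perm.mul_apply, ← map_mul, ← map_mul, h1]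
  rw [hX] at h2
  have h3 : bump G (Θ w (1, 0)) = Θ w (1, 0) := by
    have := hfst w (1, 0)
    rw [mul_one] at this
    rw [← this] at hne
    simp [bump, hne]
  rw [h3] at h2
  have h4 := (Θ w).injective h2
  simp [bump] at h4

variable {ρ : G →* MulAut (FreeGroup ℕ)}

lemma HH_fix (hρ : ∀ i < N, ρ (s i) = sigma i) (m : ℕ) {h : G} (hh : h ∈ HH s N (m + 1)) :
    ρ h (X m) = X m := by
  unfold HH at hh
  induction hh using Subgroup.closure_induction with
  | mem x hx =>
    obtain ⟨i, hi, hi', rfl⟩ := hx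
    rw [hρ i hi', sigma_X_ne _ _ (by omega) (by omega)]
  | one => simp
  | mul x y _ _ hx hy => rw [map_mul, MulAut.mul_apply, hy, hx]
  | inv x _ hx =>
    rw [map_inv]
    nth_rewrite 1 [← hx]
    exact MulAut.inv_apply_self _ _ _

lemma tt_X (hρ : ∀ i < N, ρ (s i) = sigma i) (m d : ℕ) (hd : m + d ≤ N) :
    ρ (tt s m d) (X m) = X (m + d) := by
  induction d with
  | zero => simp [tt]
  | succ d ih =>
    rw [tt, map_mul, MulAut.mul_apply, ih (by omega), hρ _ (by omega), sigma_X_self, add_assoc]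

lemma cc_X (hρ : ∀ i < N, ρ (s i) = sigma i) (m d : ℕ) (hd : m + d < N) :
    ρ (cc s m d) (X (m + 1)) = X (m + 1 + d) := by
  induction d with
  | zero => simp [cc]
  | succ d ih =>
    rw [cc, map_mul, MulAut.mul_apply, ih (by omega), hρ _ (by omega),
      show m + 1 + d = m + d + 1 by omega, sigma_X_self]
    congr 1; omega

lemma cc_mem (m d : ℕ) (hd : m + d < N) : cc s m d ∈ HH s N (m + 1) := by
  induction d with
  | zero => exact one_mem _
  | succ d ih => exact mul_mem (s_mem_HH (by omega) (by omega)) (ih (by omega))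

lemma AA_X (hρ : ∀ i < N, ρ (s i) = sigma i) (m d : ℕ) (hd : m + d < N) :
    ρ (AA s m d) (X m) = (X (m + 1 + d))⁻¹ * X m * X (m + 1 + d) := by
  have h1 := HH_fix hρ m (cc_mem (s := s) m d hd)
  have h2 := HH_fix hρ m (inv_mem (cc_mem (s := s) m d hd))
  rw [AA, map_mul, map_mul, map_mul, MulAut.mul_apply, MulAut.mul_apply, MulAut.mul_apply, h2,
    hρ m (by omega), sigma_X_self, sigma_X_succ, map_mul, map_mul, map_inv, h1, cc_X hρ m d hd]

lemma forget_HH (hρ : ∀ i < N, ρ (s i) = sigma i) (m : ℕ) {h : G} (hh : h ∈ HH s N (m + 1)) :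
    ∃ α : MulAut (FreeGroup ℕ), ∀ g, forget m (ρ h g) = α (forget m g) := by
  unfold HH at hh
  induction hh using Subgroup.closure_induction with
  | mem x hx =>
    obtain ⟨i, hi, hi', rfl⟩ := hx
    obtain ⟨i, rfl⟩ : ∃ i', i = i' + 1 := ⟨i - 1, by omega⟩
    exact ⟨sigma i, fun g => by rw [hρ _ hi', forget_sigma _ _ (by omega)]⟩
  | one => exact ⟨1, by simp⟩
  | mul x y _ _ hx hy =>
    obtain ⟨a, ha⟩ := hx
    obtain ⟨b, hb⟩ := hy
    exact ⟨a * b, fun g => by rw [map_mul, MulAut.mul_apply, ha, hb, MulAut.mul_apply]⟩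
  | inv x _ hx =>
    obtain ⟨a, ha⟩ := hx
    refine ⟨a⁻¹, fun g => ?_⟩
    have := ha ((ρ x)⁻¹ g)
    rw [MulAut.apply_inv_self] at this
    rw [this, MulAut.inv_apply_self, map_inv]

lemma forget_AA (hρ : ∀ i < N, ρ (s i) = sigma i) (m d : ℕ) (hd : m + d < N) (g : FreeGroup ℕ) :
    forget m (ρ (AA s m d) g) = forget m g := by
  obtain ⟨α, hα⟩ := forget_HH hρ m (cc_mem (s := s) m d hd)
  rw [AA, map_mul, map_mul, map_mul, MulAut.mul_apply, MulAut.mul_apply, MulAut.mul_apply, hα,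
    hρ m (by omega), forget_sq, ← hα, map_inv, MulAut.apply_inv_self]

lemma KK_X (hρ : ∀ i < N, ρ (s i) = sigma i) (m : ℕ) (Φ : FreeGroup ℕ →* G)
    (hΦ : ∀ d, Φ (X (m + d)) = AA s m d) {κ : G} (hκ : κ ∈ KK s N m) :
    ∃ w, ρ κ (X m) = w * X m * w⁻¹ ∧ Φ (forget m w) = κ⁻¹ := by
  unfold KK at hκ
  induction hκ using Subgroup.closure_induction_left with
  | one => exact ⟨1, by simp, by simp⟩
  | mul_left x hx y hy ih =>
    obtain ⟨d, hd, rfl⟩ := hx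
    obtain ⟨w, hw, hw'⟩ := ih
    refine ⟨ρ (AA s m d) w * (X (m + 1 + d))⁻¹, ?_, ?_⟩
    · rw [map_mul, MulAut.mul_apply, hw, map_mul, map_mul, AA_X hρ m d hd, map_inv]
      group
    · rw [map_mul, map_mul, forget_AA hρ m d hd, hw', map_inv, map_inv, forget_X_gt, hΦ,
        mul_inv_rev]
  | inv_mul_cancel x hx y hy ih =>
    obtain ⟨d, hd, rfl⟩ := hx
    obtain ⟨w, hw, hw'⟩ := ih
    have hf : ∀ g, forget m (ρ (AA s m d)⁻¹ g) = forget m g := by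
      intro g
      rw [← forget_AA hρ m d hd (ρ (AA s m d)⁻¹ g), map_inv, MulAut.apply_inv_self]
    have hXm : ρ (AA s m d)⁻¹ (X m) = ρ (AA s m d)⁻¹ (X (m + 1 + d)) * X m *
        (ρ (AA s m d)⁻¹ (X (m + 1 + d)))⁻¹ := by
      have : X m = X (m + 1 + d) * ρ (AA s m d) (X m) * (X (m + 1 + d))⁻¹ := by
        rw [AA_X hρ m d hd]; group
      nth_rewrite 1 [this]
      rw [map_mul, map_mul, map_inv ρ, MulAut.inv_apply_self, map_inv]
    refine ⟨ρ (AA s m d)⁻¹ w * ρ (AA s m d)⁻¹ (X (m + 1 + d)), ?_, ?_⟩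
    · rw [map_mul ρ, MulAut.mul_apply, hw, map_mul (ρ _), map_mul (ρ _), hXm,
        map_inv (ρ (AA s m d)⁻¹) w]
      group
    · rw [map_mul, map_mul, hf, hf, hw', forget_X_gt, hΦ, mul_inv_rev, inv_inv]

lemma Br.stab (hb : Br s N) (hρ : ∀ i < N, ρ (s i) = sigma i) (m : ℕ) (hm : m ≤ N) {g : G}
    (hg : g ∈ HH s N m) (hfix : ρ g (X m) = X m) : g ∈ HH s N (m + 1) := by
  obtain ⟨d, κ, h, hd, hκ, hh, rfl⟩ := hb.decomp m hm hg
  obtain ⟨Φ, hΦ⟩ := exists_hom (fun j => AA s m (j - m))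
  have hΦ' : ∀ d, Φ (X (m + d)) = AA s m d := fun d => by rw [hΦ, Nat.add_sub_cancel_left]
  obtain ⟨w, hw, hw'⟩ := KK_X hρ m Φ hΦ' hκ
  rw [map_mul, MulAut.mul_apply, HH_fix hρ m hh, map_mul, MulAut.mul_apply, hw] at hfix
  have hd0 : d = 0 := by
    by_contra hd0
    obtain ⟨χ, hχ⟩ := exists_hom (G := Multiplicative ℤ)
      (fun j => if j = m then Multiplicative.ofAdd 1 else 1)
    have := congrArg χ hfix
    rw [map_mul (ρ _), map_mul (ρ _), map_inv (ρ _), tt_X hρ m d hd, map_mul χ, map_mul χ,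
      map_inv χ, hχ, hχ,
      mul_right_comm, mul_inv_cancel, one_mul, if_pos rfl, if_neg (by omega)] at this
    exact absurd this (by decide)
  subst hd0
  simp only [tt, map_one, MulAut.one_apply] at hfix
  have := centralizer_X m Φ w hfix
  rw [hw'] at this
  obtain rfl : κ = 1 := by simpa using this
  simpa [tt] using hh

/-! ### the order -/

lemma Ev_rho (hρ : ∀ i < N, ρ (s i) = sigma i) {g : G} (hg : g ∈ HH s N 0) {x : FreeGroup ℕ}
    (hx : Ev x) : Ev (ρ g x) ∧ tau (ρ g x) = tau x := by
  unfold HH at hg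
  induction hg using Subgroup.closure_induction_left with
  | one => simpa using hx
  | mul_left z hz y hy ih =>
    obtain ⟨i, -, hi, rfl⟩ := hz
    rw [map_mul, MulAut.mul_apply, hρ i hi, sigma_apply]
    have := Ev_sg (p := i + 2) (c := i + 1) (q := i) (by omega) ih.1
    exact ⟨this.1, this.2.trans ih.2⟩
  | inv_mul_cancel z hz y hy ih =>
    obtain ⟨i, -, hi, rfl⟩ := hz
    rw [map_mul, MulAut.mul_apply, map_inv, hρ i hi, sigma_inv_apply]
    have := Ev_sg (p := i) (c := i + 1) (q := i + 2) (by omega) ih.1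
    exact ⟨this.1, this.2.trans ih.2⟩

lemma HH_anti {m m' : ℕ} (h : m ≤ m') : HH s N m' ≤ HH s N m := by
  apply Subgroup.closure_mono
  rintro g ⟨i, h1, h2, rfl⟩
  exact ⟨i, h.trans h1, h2, rfl⟩

lemma Br.cone (hb : Br s N) (hρ : ∀ i < N, ρ (s i) = sigma i) (k : ℕ) : ∀ m, m + k = N →
    ∃ P : Set G, (∀ g ∈ P, g ∈ HH s N m) ∧ (1 : G) ∉ P ∧ (∀ g ∈ P, ∀ h ∈ P, g * h ∈ P) ∧
      ∀ g ∈ HH s N m, g = 1 ∨ g ∈ P ∨ g⁻¹ ∈ P := by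
  induction k with
  | zero =>
    intro m hm
    refine ⟨∅, by simp, by simp, by simp, fun g hg => Or.inl ?_⟩
    have : {g : G | ∃ i, m ≤ i ∧ i < N ∧ g = s i} = ∅ := by
      ext g
      simp only [Set.mem_ofPred_eq, Set.mem_empty_iff_false, iff_false]
      rintro ⟨i, h1, h2, -⟩
      omega
    rw [HH, this, Subgroup.closure_empty] at hg
    simpa using hg
  | succ k ih =>
    intro m hm
    obtain ⟨P, hP, hP1, hPm, hPt⟩ := ih (m + 1) (by omega)
    let c : G → FreeGroup ℕ := fun g => (X m)⁻¹ * ρ g (X m)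
    have h0 : ∀ {g}, g ∈ HH s N m → g ∈ HH s N 0 := fun h => HH_anti (Nat.zero_le _) h
    have hc : ∀ g ∈ HH s N m, Ev (c g) := fun g hg =>
      (Ev_mul (Ev_inv (Ev_X m)).1 (Ev_rho hρ (h0 hg) (Ev_X m)).1).1
    have hcm : ∀ g h, c (g * h) = c g * ρ g (c h) := by
      intro g h
      simp only [c, map_mul, MulAut.mul_apply, map_inv]
      group
    have hc1 : ∀ h ∈ HH s N (m + 1), c h = 1 := fun h hh => by
      simp only [c, HH_fix hρ m hh]; group
    have hcinv : ∀ g ∈ HH s N m, tau (c g⁻¹) = - tau (c g) := by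
      intro g hg
      have h1 := hcm g g⁻¹
      rw [mul_inv_cancel, hc1 1 (one_mem _)] at h1
      have h2 : ρ g (c g⁻¹) = (c g)⁻¹ := (inv_eq_of_mul_eq_one_right h1.symm).symm
      rw [← (Ev_rho hρ (h0 hg) (hc _ (inv_mem hg))).2, h2, (Ev_inv (hc g hg)).2]
    have hle : HH s N (m + 1) ≤ HH s N m := HH_anti (Nat.le_succ m)
    refine ⟨{g | g ∈ HH s N m ∧ 0 < tau (c g)} ∪ P, ?_, ?_, ?_, ?_⟩
    · rintro g (h | h)
      · exact h.1
      · exact hle (hP g h)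
    · rintro (h | h)
      · have := h.2
        rw [hc1 1 (one_mem _), tau_one] at this
        exact lt_irrefl _ this
      · exact hP1 h
    · rintro g (⟨hg, hg'⟩ | hg) h (⟨hh, hh'⟩ | hh)
      · left
        refine ⟨mul_mem hg hh, ?_⟩
        have h1 := Ev_rho hρ (h0 hg) (hc h hh)
        have h2 := (Ev_mul (hc g hg) h1.1).2
        rw [hcm]
        omega
      · left
        refine ⟨mul_mem hg (hle (hP h hh)), ?_⟩
        rw [hcm, hc1 h (hP h hh), map_one, mul_one]
        exact hg'
      · left
        have hg1 := hle (hP g hg)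
        refine ⟨mul_mem hg1 hh, ?_⟩
        rw [hcm, hc1 g (hP g hg), one_mul, (Ev_rho hρ (h0 hg1) (hc h hh)).2]
        exact hh'
      · right; exact hPm g hg h hh
    · intro g hg
      rcases lt_trichotomy (tau (c g)) 0 with h | h | h
      · right; right; left
        exact ⟨inv_mem hg, by rw [hcinv g hg]; omega⟩
      · have h1 := Ev_eq_one (hc g hg) h
        have h2 : ρ g (X m) = X m := by
          simp only [c] at h1
          rw [inv_mul_eq_one] at h1
          exact h1.symm
        rcases hPt g (hb.stab hρ m (by omega) hg h2) with h | h | h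
        · exact Or.inl h
        · exact Or.inr (Or.inl (Or.inr h))
        · exact Or.inr (Or.inr (Or.inr h))
      · right; left; left
        exact ⟨hg, h⟩

lemma order_of_cone (P : Set G) (h1 : (1 : G) ∉ P) (hm : ∀ g ∈ P, ∀ h ∈ P, g * h ∈ P)
    (ht : ∀ g : G, g = 1 ∨ g ∈ P ∨ g⁻¹ ∈ P) :
    ∃ _ : LinearOrder G, ∀ a b c : G, a < b → c * a < c * b := by
  classical
  let lo : LinearOrder G :=
    { le := fun a b => a = b ∨ a⁻¹ * b ∈ P
      lt := fun a b => a⁻¹ * b ∈ P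
      le_refl := fun a => Or.inl rfl
      le_trans := by
        rintro a b c (rfl | hab) (rfl | hbc)
        · exact Or.inl rfl
        · exact Or.inr hbc
        · exact Or.inr hab
        · right
          convert hm _ hab _ hbc using 1; group
      le_antisymm := by
        rintro a b (rfl | hab) (h | hba)
        · rfl
        · rfl
        · exact h.symm
        · exact absurd (by convert hm _ hab _ hba using 1; group) h1
      lt_iff_le_not_ge := by
        intro a b
        constructor
        · intro hab
          refine ⟨Or.inr hab, ?_⟩
          rintro (rfl | hba)
          · exact h1 (by simpa using hab)
          · exact h1 (by convert hm _ hab _ hba using 1; group)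
        · rintro ⟨rfl | hab, h⟩
          · exact absurd (Or.inl rfl) h
          · exact hab
      le_total := by
        intro a b
        rcases ht (a⁻¹ * b) with h | h | h
        · left; left; exact inv_mul_eq_one.1 h
        · left; right; exact h
        · right; right; simpa using h
      toDecidableLE := Classical.decRel _ }
  refine ⟨lo, fun a b c hab => ?_⟩
  change (c * a)⁻¹ * (c * b) ∈ P
  have : a⁻¹ * b ∈ P := hab
  convert this using 1; group

end

end BraidLO

/-- (Dehornoy) The braid group `Bₙ` is left-orderable: it admits a total order invariant
under left multiplication. -/
theorem braidGroup_leftOrderable (n : ℕ) (hn : 1 ≤ n) :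
    ∃ _ : LinearOrder (BraidGroup n),
      ∀ a b c : BraidGroup n, a < b → c * a < c * b := by
  let s : ℕ → BraidGroup n := fun i => if h : i < n - 1 then PresentedGroup.of ⟨i, h⟩ else 1
  have hs : ∀ i (h : i < n - 1), s i = PresentedGroup.of ⟨i, h⟩ := fun i h => dif_pos h
  have hb : BraidLO.Br s (n - 1) := by
    refine ⟨fun i j hij hj => ?_, fun i hi => ?_⟩
    · rw [hs i (by omega), hs j hj]
      have : PresentedGroup.mk (braidRels n) _ = 1 :=
        PresentedGroup.one_of_mem (Or.inl ⟨⟨i, by omega⟩, ⟨j, hj⟩, hij, rfl⟩)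
      rw [map_mul, map_inv, mul_inv_eq_one, map_mul, map_mul] at this
      exact this
    · rw [hs i (by omega), hs (i + 1) hi]
      have : PresentedGroup.mk (braidRels n) _ = 1 :=
        PresentedGroup.one_of_mem (Or.inr ⟨⟨i, by omega⟩, ⟨i + 1, hi⟩, rfl, rfl⟩)
      rw [map_mul, map_inv, mul_inv_eq_one] at this
      simp only [map_mul] at this
      exact this
  have hrel : ∀ r ∈ braidRels n,
      FreeGroup.lift (fun i : Fin (n - 1) => BraidLO.sigma i) r = 1 := by
    rintro r (⟨i, j, hij, rfl⟩ | ⟨i, j, hij, rfl⟩)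
    · rw [map_mul, map_inv, mul_inv_eq_one]
      simp only [map_mul, FreeGroup.lift_apply_of]
      exact BraidLO.sigma_comm _ _ hij
    · rw [map_mul, map_inv, mul_inv_eq_one]
      simp only [map_mul, FreeGroup.lift_apply_of, hij]
      exact BraidLO.sigma_braid _
  let ρ : BraidGroup n →* MulAut (FreeGroup ℕ) := PresentedGroup.toGroup hrel
  have hρ : ∀ i < n - 1, ρ (s i) = BraidLO.sigma i := by
    intro i hi
    rw [hs i hi]
    exact PresentedGroup.toGroup.of hrel
  obtain ⟨P, -, h1, hm, ht⟩ := hb.cone hρ (n - 1) 0 (by omega)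
  refine BraidLO.order_of_cone P h1 hm fun g => ht g ?_
  have : g ∈ Subgroup.closure (Set.range (PresentedGroup.of (rels := braidRels n))) := by
    rw [PresentedGroup.closure_range_of]; trivial
  refine Subgroup.closure_mono ?_ this
  rintro _ ⟨i, rfl⟩
  exact ⟨i, Nat.zero_le _, i.2, (hs i i.2).symm⟩
end

section
/- (Artin) The Artin representation ρ : B_n → Aut(F_n) is faithful, i.e. ρ is an injective group homomorphism. -/
/-- The index `i` of `Fin (n-1)` viewed in `Fin n` (giving the generator `xᵢ` of `Fₙ`). -/
def genIdx (n : ℕ) (i : Fin (n - 1)) : Fin n := ⟨i.1, by have := i.2; omega⟩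

/-- The index `i + 1` viewed in `Fin n` (giving the generator `xᵢ₊₁` of `Fₙ`). -/
def genIdxSucc (n : ℕ) (i : Fin (n - 1)) : Fin n := ⟨i.1 + 1, by have := i.2; omega⟩

/-- `ρ : Bₙ → Aut(Fₙ)` is the Artin representation if on each Artin generator `σᵢ` it acts by
`xᵢ ↦ xᵢ₊₁`, `xᵢ₊₁ ↦ xᵢ₊₁⁻¹ xᵢ xᵢ₊₁`, and `xⱼ ↦ xⱼ` for `j ∉ {i, i+1}`. -/
def IsArtinRep (n : ℕ) (ρ : BraidGroup n →* MulAut (FreeGroup (Fin n))) : Prop :=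
  ∀ i : Fin (n - 1),
    ρ (braidGen n i) (FreeGroup.of (genIdx n i)) = FreeGroup.of (genIdxSucc n i) ∧
    ρ (braidGen n i) (FreeGroup.of (genIdxSucc n i)) =
      (FreeGroup.of (genIdxSucc n i))⁻¹ * FreeGroup.of (genIdx n i) *
        FreeGroup.of (genIdxSucc n i) ∧
    ∀ j : Fin n, j ≠ genIdx n i → j ≠ genIdxSucc n i →
      ρ (braidGen n i) (FreeGroup.of j) = FreeGroup.of j

namespace ArtinProof

variable {G : Type*} [Group G]

/-- `s m * s (m-1) * ... * s k`. -/
def cc (s : ℕ → G) (m k : ℕ) : G := if k ≤ m then cc s m (k+1) * s k else 1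
termination_by m + 1 - k

/-- The pure braid generators involving strand `m+1`. -/
def AA (s : ℕ → G) (m k : ℕ) : G := if k < m then (s k)⁻¹ * AA s m (k+1) * s k else s m * s m
termination_by m - k

lemma cc_of_le (s : ℕ → G) {m k : ℕ} (h : k ≤ m) : cc s m k = cc s m (k+1) * s k := by
  rw [cc, if_pos h]

lemma cc_top (s : ℕ → G) (m : ℕ) : cc s m (m+1) = 1 := by
  rw [cc, if_neg (by omega)]

lemma AA_of_lt (s : ℕ → G) {m k : ℕ} (h : k < m) :
    AA s m k = (s k)⁻¹ * AA s m (k+1) * s k := by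
  rw [AA, if_pos h]

lemma AA_top (s : ℕ → G) (m : ℕ) : AA s m m = s m * s m := by
  rw [AA, if_neg (by omega)]

structure Rels (s : ℕ → G) (N : ℕ) : Prop where
  comm : ∀ i j, i + 1 < j → j < N → s i * s j = s j * s i
  braid : ∀ i, i + 1 < N → s i * s (i+1) * s i = s (i+1) * s i * s (i+1)

variable {s : ℕ → G} {N : ℕ}

lemma cc_comm (hs : Rels s N) {m : ℕ} (hm : m < N) (i : ℕ) :
    ∀ d k, d + k = m + 1 → i + 1 < k → cc s m k * s i = s i * cc s m k := by
  intro d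
  induction d with
  | zero => intro k hk _; obtain rfl : k = m + 1 := by omega
            simp [cc_top]
  | succ d ih =>
    intro k hk hik
    have h1 := ih (k+1) (by omega) (by omega)
    rw [cc_of_le s (by omega : k ≤ m), mul_assoc, ← hs.comm i k hik (by omega), ← mul_assoc, h1,
      mul_assoc]

lemma cc_shift (hs : Rels s N) {m : ℕ} (hm : m < N) (j : ℕ) (hj : j < m) :
    ∀ d k, d + k = j → cc s m k * s (j+1) = s j * cc s m k := by
  intro d
  induction d with
  | zero =>
    intro k hk
    obtain rfl : k = j := by omega
    have h1 := cc_comm hs hm k (m - k - 1) (k+2) (by omega) (by omega)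
    rw [cc_of_le s (by omega : k ≤ m), cc_of_le s (by omega : k + 1 ≤ m)]
    have h2 := hs.braid k (by omega)
    calc _ = cc s m (k+2) * (s (k+1) * s k * s (k+1)) := by group
      _ = (cc s m (k+2) * s k) * s (k+1) * s k := by rw [← h2]; group
      _ = _ := by rw [h1]; group
  | succ d ih =>
    intro k hk
    have h1 := ih (k+1) (by omega)
    rw [cc_of_le s (by omega : k ≤ m), mul_assoc, hs.comm k (j+1) (by omega) (by omega),
      ← mul_assoc, h1, mul_assoc]

lemma AA_eq (hs : Rels s N) {m : ℕ} (hm : m < N) :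
    ∀ d k, d + k = m → AA s m k = cc s m (k+1) * (s k * s k) * (cc s m (k+1))⁻¹ := by
  intro d
  induction d with
  | zero => intro k hk; obtain rfl : k = m := by omega
            simp [cc_top, AA_top]
  | succ d ih =>
    intro k hk
    have h1 := ih (k+1) (by omega)
    have h2 := cc_comm hs hm k (m - k - 1) (k+2) (by omega) (by omega)
    have h3 := hs.braid k (by omega)
    rw [AA_of_lt s (by omega), h1, cc_of_le s (by omega : k+1 ≤ m)]
    have h4 : (s k)⁻¹ * s (k+1) * s k = s (k+1) * s k * (s (k+1))⁻¹ := by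
      rw [eq_mul_inv_iff_mul_eq, mul_assoc, mul_assoc, inv_mul_eq_iff_eq_mul, ← mul_assoc, ← h3]
      group
    have h5 : cc s m (k+2) = s k * cc s m (k+2) * (s k)⁻¹ := by rw [← h2]; group
    have h6 : (s k)⁻¹ * cc s m (k+2) * s k = cc s m (k+2) := by rw [mul_assoc, h2]; group
    calc _ = ((s k)⁻¹ * cc s m (k+2) * s k) * ((s k)⁻¹ * s (k+1) * s k) *
              ((s k)⁻¹ * s (k+1) * s k) * ((s k)⁻¹ * cc s m (k+2) * s k)⁻¹ := by group
      _ = _ := by rw [h6, h4]; group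

/-- The homomorphism from the free group hitting the pure braids on strand `m+1`. -/
def AH (s : ℕ → G) (m : ℕ) : FreeGroup (Fin (m+1)) →* G :=
  FreeGroup.lift fun j => AA s m j

lemma AA_mem (m j : ℕ) (hj : j ≤ m) : AA s m j ∈ (AH s m).range :=
  ⟨FreeGroup.of ⟨j, by omega⟩, by simp [AH]⟩

lemma conj_mem (hs : Rels s N) {m : ℕ} (hm : m < N) (i j : ℕ) (hi : i < m) (hj : j ≤ m) :
    s i * AA s m j * (s i)⁻¹ ∈ (AH s m).range ∧ (s i)⁻¹ * AA s m j * s i ∈ (AH s m).range := by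
  have comm_case : s i * AA s m j = AA s m j * s i →
    s i * AA s m j * (s i)⁻¹ ∈ (AH s m).range ∧ (s i)⁻¹ * AA s m j * s i ∈ (AH s m).range := by
    intro h
    refine ⟨?_, ?_⟩
    · rw [h, mul_inv_cancel_right]; exact AA_mem m j hj
    · rw [mul_assoc, ← h, inv_mul_cancel_left]; exact AA_mem m j hj
  have step : AA s m (i+1) = s i * AA s m i * (s i)⁻¹ := by rw [AA_of_lt s hi]; group
  have key : s i * AA s m (i+1) * (s i)⁻¹ = (AA s m (i+1))⁻¹ * AA s m i * AA s m (i+1) := by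
    have h2 := cc_comm hs hm i (m - i - 1) (i+2) (by omega) (by omega)
    have h3 := hs.braid i (by omega)
    have e1 := AA_eq hs hm (m - i) i (by omega)
    rw [cc_of_le s (by omega : i+1 ≤ m)] at e1
    have e2 := AA_eq hs hm (m - i - 1) (i+1) (by omega)
    have h4 : s i * s (i+1) * (s i)⁻¹ = (s (i+1))⁻¹ * s i * s (i+1) := by
      rw [mul_inv_eq_iff_eq_mul, mul_assoc, mul_assoc, eq_inv_mul_iff_mul_eq, ← mul_assoc,
        ← mul_assoc, ← h3]
    have h6 : s i * cc s m (i+2) * (s i)⁻¹ = cc s m (i+2) := by rw [← h2]; group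
    rw [e1, e2]
    calc _ = (s i * cc s m (i+2) * (s i)⁻¹) * (s i * s (i+1) * (s i)⁻¹) *
              (s i * s (i+1) * (s i)⁻¹) * (s i * cc s m (i+2) * (s i)⁻¹)⁻¹ := by group
      _ = _ := by rw [h6, h4]; group
  rcases lt_trichotomy j i with h | h | h
  · apply comm_case
    obtain ⟨i, rfl⟩ : ∃ q, i = q + 1 := ⟨i - 1, by omega⟩
    have h1 := cc_shift hs hm (i+1) (by omega) (i - j) (j+1) (by omega)
    have h2 := hs.comm j (i+1+1) (by omega) (by omega)
    rw [AA_eq hs hm (m - j) j (by omega)]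
    have h7 : s (i+1) = cc s m (j+1) * s (i+1+1) * (cc s m (j+1))⁻¹ := by
      rw [h1]; group
    rw [h7]
    calc _ = cc s m (j+1) * (s (i+1+1) * s j * s j) * (cc s m (j+1))⁻¹ := by group
      _ = cc s m (j+1) * (s j * s j * s (i+1+1)) * (cc s m (j+1))⁻¹ := by
        rw [← h2, mul_assoc (s j), ← h2, mul_assoc (s j)]
      _ = _ := by group
  · subst h
    refine ⟨?_, ?_⟩
    · rw [← step]; exact AA_mem m _ hi
    · have : (s j)⁻¹ * AA s m j * s j = AA s m j * AA s m (j+1) * (AA s m j)⁻¹ := by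
        have h8 : AA s m j = AA s m (j+1) * (s j * AA s m (j+1) * (s j)⁻¹) *
          (AA s m (j+1))⁻¹ := by rw [key]; group
        rw [step] at h8 ⊢
        calc (s j)⁻¹ * AA s m j * s j = (s j)⁻¹ * (s j * AA s m j * (s j)⁻¹ * (s j * (s j * AA s m j * (s j)⁻¹) * (s j)⁻¹) *
          (s j * AA s m j * (s j)⁻¹)⁻¹) * s j := by rw [← h8]
          _ = _ := by group
      rw [this]
      exact mul_mem (mul_mem (AA_mem m _ hj) (AA_mem m _ hi)) (inv_mem (AA_mem m _ hj))
  · by_cases h' : j = i + 1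
    · subst h'
      refine ⟨?_, ?_⟩
      · rw [key]
        exact mul_mem (mul_mem (inv_mem (AA_mem m _ hj)) (AA_mem m _ hi.le)) (AA_mem m _ hj)
      · have : (s i)⁻¹ * AA s m (i+1) * s i = AA s m i := by rw [step]; group
        rw [this]; exact AA_mem m _ hi.le
    · apply comm_case
      have h1 := cc_comm hs hm i (m - j) (j+1) (by omega) (by omega)
      have h2 := hs.comm i j (by omega) (by omega)
      rw [AA_eq hs hm (m - j) j (by omega)]
      have h7 : s i = cc s m (j+1) * s i * (cc s m (j+1))⁻¹ := by
        rw [h1]; group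
      calc _ = (cc s m (j+1) * s i * (cc s m (j+1))⁻¹) *
          (cc s m (j+1) * (s j * s j) * (cc s m (j+1))⁻¹) := by rw [← h7]
        _ = cc s m (j+1) * (s i * s j * s j) * (cc s m (j+1))⁻¹ := by group
        _ = cc s m (j+1) * (s j * s j * s i) * (cc s m (j+1))⁻¹ := by
          rw [h2, mul_assoc (s j), h2, mul_assoc (s j)]
        _ = cc s m (j+1) * (s j * s j) * (cc s m (j+1))⁻¹ *
          (cc s m (j+1) * s i * (cc s m (j+1))⁻¹) := by group
        _ = _ := by rw [← h7]

/-- Subgroup generated by the first `m` generators. -/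
def HH (s : ℕ → G) (m : ℕ) : Subgroup G := Subgroup.closure {g | ∃ i, i < m ∧ g = s i}

lemma s_mem {i m : ℕ} (h : i < m) : s i ∈ HH s m := Subgroup.subset_closure ⟨i, h, rfl⟩

lemma range_le (g : G) (m : ℕ) (hg : ∀ j ≤ m, g * AA s m j * g⁻¹ ∈ (AH s m).range) :
    ∀ u ∈ (AH s m).range, g * u * g⁻¹ ∈ (AH s m).range := by
  rintro _ ⟨f, rfl⟩
  induction f using FreeGroup.induction_on with
  | C1 => simp
  | of j => simpa [AH] using hg j (by omega)
  | inv_of j h =>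
    have := inv_mem h
    simpa [mul_assoc] using this
  | mul a b ha hb =>
    have := mul_mem ha hb
    simpa [mul_assoc] using this

lemma norm_mem (hs : Rels s N) {m : ℕ} (hm : m < N) (h : G) (hh : h ∈ HH s m) :
    ∀ u ∈ (AH s m).range, h * u * h⁻¹ ∈ (AH s m).range := by
  induction hh using Subgroup.closure_induction'' with
  | mem x hx =>
    obtain ⟨i, hi, rfl⟩ := hx
    exact range_le _ m fun j hj => (conj_mem hs hm i j hi hj).1
  | inv_mem x hx =>
    obtain ⟨i, hi, rfl⟩ := hx
    exact range_le _ m fun j hj => by simpa using (conj_mem hs hm i j hi hj).2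
  | one => simp
  | mul x y _ _ hx hy =>
    intro u hu
    have := hx _ (hy u hu)
    simpa [mul_assoc] using this

lemma decomp (hs : Rels s N) {m : ℕ} (hm : m < N) (g : G) (hg : g ∈ HH s (m+1)) :
    ∃ u ∈ (AH s m).range, ∃ h ∈ HH s m, ∃ k ≤ m + 1, g = u * h * cc s m k := by
  have mk : ∀ u ∈ (AH s m).range, ∀ h ∈ HH s m, ∀ v ∈ (AH s m).range, ∀ k ≤ m + 1,
      ∃ u' ∈ (AH s m).range, ∃ h' ∈ HH s m, ∃ k' ≤ m + 1,
        u * h * (v * cc s m k) = u' * h' * cc s m k' := fun u hu h hh v hv k hk =>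
    ⟨u * (h * v * h⁻¹), mul_mem hu (norm_mem hs hm h hh v hv), h, hh, k, hk, by group⟩
  have mk2 : ∀ u ∈ (AH s m).range, ∀ h ∈ HH s m, ∀ v ∈ HH s m, ∀ k ≤ m + 1,
      ∃ u' ∈ (AH s m).range, ∃ h' ∈ HH s m, ∃ k' ≤ m + 1,
        u * h * (v * cc s m k) = u' * h' * cc s m k' := fun u hu h hh v hv k hk =>
    ⟨u, hu, h * v, mul_mem hh hv, k, hk, by group⟩
  have hA : ∀ k ≤ m, AA s m k * cc s m (k+1) = cc s m k * s k := by
    intro k hk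
    rw [AA_eq hs hm (m-k) k (by omega), cc_of_le s hk]; group
  induction hg using Subgroup.closure_induction_right with
  | one => exact ⟨1, one_mem _, 1, one_mem _, m+1, le_rfl, by simp [cc_top]⟩
  | mul_right x _ y hy ih =>
    obtain ⟨i, hi, rfl⟩ := hy
    obtain ⟨u, hu, h, hh, k, hk, rfl⟩ := ih
    rw [mul_assoc]
    rcases lt_trichotomy i k with hik | hik | hik
    · by_cases hk1 : k = i + 1
      · subst hk1
        rw [← cc_of_le s (by omega)]
        exact ⟨u, hu, h, hh, i, by omega, rfl⟩
      · rw [cc_comm hs hm i (m+1-k) k (by omega) (by omega)]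
        exact mk2 u hu h hh _ (s_mem (by omega)) k hk
    · subst hik
      rw [← hA i (by omega)]
      exact mk u hu h hh _ (AA_mem _ _ (by omega)) _ (by omega)
    · obtain ⟨j, rfl⟩ : ∃ j, i = j + 1 := ⟨i - 1, by omega⟩
      rw [cc_shift hs hm j (by omega) (j-k) k (by omega)]
      exact mk2 u hu h hh _ (s_mem (by omega)) k hk
  | mul_inv_cancel x _ y hy ih =>
    obtain ⟨i, hi, rfl⟩ := hy
    obtain ⟨u, hu, h, hh, k, hk, rfl⟩ := ih
    rw [mul_assoc]
    rcases lt_trichotomy i k with hik | hik | hik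
    · by_cases hk1 : k = i + 1
      · subst hk1
        have : cc s m (i+1) * (s i)⁻¹ = (AA s m i)⁻¹ * cc s m i := by
          rw [mul_inv_eq_iff_eq_mul, mul_assoc, ← hA i (by omega)]; group
        rw [this]
        exact mk u hu h hh _ (inv_mem (AA_mem _ _ (by omega))) _ (by omega)
      · have : cc s m k * (s i)⁻¹ = (s i)⁻¹ * cc s m k := by
          rw [mul_inv_eq_iff_eq_mul, mul_assoc,
            cc_comm hs hm i (m+1-k) k (by omega) (by omega)]; group
        rw [this]
        exact mk2 u hu h hh _ (inv_mem (s_mem (by omega))) k hk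
    · subst hik
      rw [cc_of_le s (by omega), mul_inv_cancel_right]
      exact ⟨u, hu, h, hh, i+1, by omega, rfl⟩
    · obtain ⟨j, rfl⟩ : ∃ j, i = j + 1 := ⟨i - 1, by omega⟩
      have : cc s m k * (s (j+1))⁻¹ = (s j)⁻¹ * cc s m k := by
        rw [mul_inv_eq_iff_eq_mul, mul_assoc,
          cc_shift hs hm j (by omega) (j-k) k (by omega)]; group
      rw [this]
      exact mk2 u hu h hh _ (inv_mem (s_mem (by omega))) k hk

/-! ### The action -/

/-- Free generators of the free group on `Fin n`, indexed by `ℕ`. -/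
def xx (n j : ℕ) : FreeGroup (Fin n) := if h : j < n then FreeGroup.of ⟨j, h⟩ else 1

lemma xx_of (n : ℕ) (j : Fin n) : FreeGroup.of j = xx n j := by simp [xx]

lemma xx_ne_one {n j : ℕ} (h : j < n) : xx n j ≠ 1 := by
  simp [xx, h]

/-- Kill the generator `p`. -/
def kill (n p : ℕ) : FreeGroup (Fin n) →* FreeGroup (Fin n) :=
  FreeGroup.lift fun j => if (j : ℕ) = p then 1 else FreeGroup.of j

lemma kill_xx (n p j : ℕ) : kill n p (xx n j) = if j = p then 1 else xx n j := by
  by_cases h : j < n <;> simp [kill, xx, h]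

lemma hom_ext' {n : ℕ} {H : Type*} [Group H] (f g : FreeGroup (Fin n) →* H)
    (h : ∀ j, j < n → f (xx n j) = g (xx n j)) : f = g := by
  ext j
  rw [xx_of]; exact h j j.2

/-- An action of the free group on `F × Bool` witnessing the centralizer of generator `p`. -/
def act (n p : ℕ) : FreeGroup (Fin n) →* Equiv.Perm (FreeGroup (Fin n) × Bool) :=
  FreeGroup.lift fun j => if (j : ℕ) = p then
    Equiv.swap (1, false) (1, true) else
    (Equiv.mulLeft (FreeGroup.of j)).prodCongr (Equiv.refl Bool)

lemma act_fst (n p : ℕ) (w : FreeGroup (Fin n)) :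
    ∀ y, (act n p w y).1 = kill n p w * y.1 := by
  induction w using FreeGroup.induction_on with
  | C1 => simp
  | of j =>
    rintro ⟨a, b⟩
    by_cases h : (j : ℕ) = p
    · simp only [act, kill, FreeGroup.lift_apply_of, h, if_true, one_mul]
      rw [Equiv.swap_apply_def]
      split_ifs <;> simp_all
    · simp [act, kill, h]
  | inv_of j h =>
    intro y
    have := h ((act n p (FreeGroup.of j)⁻¹) y)
    rw [← Equiv.Perm.mul_apply, ← map_mul, mul_inv_cancel, map_one, Equiv.Perm.one_apply] at this
    rw [this, map_inv (kill n p), inv_mul_cancel_left]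
  | mul a b ha hb =>
    intro y
    rw [map_mul, Equiv.Perm.mul_apply, ha, hb, map_mul, mul_assoc]

lemma kill_of_comm {n p : ℕ} (hp : p < n) (w : FreeGroup (Fin n))
    (h : w * xx n p = xx n p * w) : kill n p w = 1 := by
  by_contra hne
  have e : act n p (xx n p) = Equiv.swap (1, false) (1, true) := by simp [act, xx, hp]
  have h1 := congrArg (fun v => act n p v (1, false)) h
  simp only [map_mul, Equiv.Perm.mul_apply, e, Equiv.swap_apply_left] at h1
  rw [Equiv.swap_apply_of_ne_of_ne] at h1
  · have := (act n p w).injective h1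
    simp at this
  · intro h2
    have := act_fst n p w (1, false)
    rw [h2] at this
    exact hne (by simpa using this.symm)
  · intro h2
    have := act_fst n p w (1, false)
    rw [h2] at this
    exact hne (by simpa using this.symm)

structure IsRep (n : ℕ) (s : ℕ → G) (ρ : G →* MulAut (FreeGroup (Fin n))) : Prop where
  r1 : ∀ i, i + 1 < n → ρ (s i) (xx n i) = xx n (i+1)
  r2 : ∀ i, i + 1 < n → ρ (s i) (xx n (i+1)) = (xx n (i+1))⁻¹ * xx n i * xx n (i+1)
  r3 : ∀ i j, i + 1 < n → j ≠ i → j ≠ i + 1 → ρ (s i) (xx n j) = xx n j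

variable {n : ℕ} {ρ : G →* MulAut (FreeGroup (Fin n))}

lemma rho_inv {g : G} {a b : FreeGroup (Fin n)} (h : ρ g a = b) : ρ g⁻¹ b = a := by
  rw [← h, ← MulAut.mul_apply, ← map_mul, inv_mul_cancel, map_one, MulAut.one_apply]

lemma kill_comm_s (hr : IsRep n s ρ) {m i : ℕ} (hm : m + 1 < n) (hi : i < m)
    (w : FreeGroup (Fin n)) :
    kill n (m+1) (ρ (s i) w) = ρ (s i) (kill n (m+1) w) := by
  have : (kill n (m+1)).comp (ρ (s i)).toMonoidHom =
      (ρ (s i)).toMonoidHom.comp (kill n (m+1)) := by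
    apply hom_ext'
    intro j hj
    simp only [MonoidHom.comp_apply, MulEquiv.coe_toMonoidHom, kill_xx]
    by_cases h1 : j = i
    · subst h1
      rw [hr.r1 _ (by omega), kill_xx, if_neg (by omega), if_neg (by omega), hr.r1 _ (by omega)]
    by_cases h2 : j = i + 1
    · subst h2
      rw [hr.r2 _ (by omega)]
      simp only [map_mul, map_inv, kill_xx]
      rw [if_neg (by omega), if_neg (by omega), hr.r2 _ (by omega)]
    rw [hr.r3 _ _ (by omega) h1 h2, kill_xx]
    split_ifs
    · simp
    · rw [hr.r3 _ _ (by omega) h1 h2]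
  exact DFunLike.congr_fun this w

lemma kill_comm_HH (hr : IsRep n s ρ) {m : ℕ} (hm : m + 1 < n) (h : G) (hh : h ∈ HH s m) :
    (∀ w, kill n (m+1) (ρ h w) = ρ h (kill n (m+1) w)) ∧ ρ h (xx n (m+1)) = xx n (m+1) := by
  induction hh using Subgroup.closure_induction with
  | mem x hx =>
    obtain ⟨i, hi, rfl⟩ := hx
    exact ⟨kill_comm_s hr hm hi, hr.r3 _ _ (by omega) (by omega) (by omega)⟩
  | one => simp
  | mul x y _ _ hx hy =>
    exact ⟨fun w => by simp [hx.1, hy.1], by simp [hx.2, hy.2]⟩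
  | inv x _ hx =>
    refine ⟨fun w => ?_, rho_inv hx.2⟩
    have := hx.1 (ρ x⁻¹ w)
    rw [← MulAut.mul_apply, ← map_mul, mul_inv_cancel, map_one, MulAut.one_apply] at this
    rw [this]
    exact (rho_inv rfl).symm

lemma AA_act (hr : IsRep n s ρ) {m : ℕ} (hm : m + 1 < n) :
    ∀ d k, d + k = m → (∀ w, kill n (m+1) (ρ (AA s m k) w) = kill n (m+1) w) ∧
      ∃ w, ρ (AA s m k) (xx n (m+1)) = w * xx n (m+1) * w⁻¹ ∧
        kill n (m+1) w = (xx n k)⁻¹ := by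
  intro d
  induction d with
  | zero =>
    intro k hk
    obtain rfl : k = m := by omega
    rw [AA_top]
    have a1 := hr.r1 k hm
    have a2 := hr.r2 k hm
    constructor
    · have : (kill n (k+1)).comp (ρ (s k * s k)).toMonoidHom = kill n (k+1) := by
        apply hom_ext'
        intro j hj
        simp only [MonoidHom.comp_apply, MulEquiv.coe_toMonoidHom, map_mul, MulAut.mul_apply]
        by_cases h1 : j = k
        · subst h1
          rw [a1, a2]; simp [kill_xx]
        by_cases h2 : j = k + 1
        · subst h2
          rw [a2]; simp [a1, a2, kill_xx]
        rw [hr.r3 _ _ hm h1 h2, hr.r3 _ _ hm h1 h2]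
      exact fun w => DFunLike.congr_fun this w
    · refine ⟨(xx n (k+1))⁻¹ * (xx n k)⁻¹ * xx n (k+1), ?_, ?_⟩
      · simp only [map_mul, MulAut.mul_apply, a1, a2, map_inv]
        group
      · simp [kill_xx]
  | succ d ih =>
    intro k hk
    obtain ⟨h1, w, h2, h3⟩ := ih (k+1) (by omega)
    rw [AA_of_lt s (by omega)]
    have hk' : s k ∈ HH s m := s_mem (by omega)
    have b1 := kill_comm_HH hr hm _ hk'
    have b2 := kill_comm_HH hr hm _ (inv_mem hk')
    constructor
    · intro w
      rw [map_mul, map_mul, MulAut.mul_apply, MulAut.mul_apply, b2.1, h1, b1.1]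
      exact rho_inv rfl
    · refine ⟨ρ (s k)⁻¹ w, ?_, ?_⟩
      · rw [map_mul, map_mul, MulAut.mul_apply, MulAut.mul_apply, b1.2, h2, map_mul, map_mul,
          b2.2, map_inv (ρ (s k)⁻¹) w]
      · rw [b2.1, h3, map_inv (ρ (s k)⁻¹), rho_inv (hr.r1 k (by omega))]

lemma AH_act (hr : IsRep n s ρ) {m : ℕ} (hm : m + 1 < n) (f : FreeGroup (Fin (m+1))) :
    (∀ w, kill n (m+1) (ρ (AH s m f) w) = kill n (m+1) w) ∧
      ∃ w, ρ (AH s m f) (xx n (m+1)) = w * xx n (m+1) * w⁻¹ ∧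
        kill n (m+1) w = (FreeGroup.map (Fin.castLE (by omega : m + 1 ≤ n)) f)⁻¹ := by
  induction f using FreeGroup.induction_on with
  | C1 => exact ⟨by simp, 1, by simp⟩
  | of j =>
    have := AA_act hr hm (m - j) j (by omega)
    have hx : xx n j = FreeGroup.of (Fin.castLE (by omega : m + 1 ≤ n) j) := by rw [xx_of]; simp
    rw [hx] at this
    simpa [AH] using this
  | inv_of j h =>
    obtain ⟨h1, w, h2, h3⟩ := h
    have h1' : ∀ w, kill n (m+1) (ρ (AH s m (FreeGroup.of j)⁻¹) w) = kill n (m+1) w := by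
      intro w
      rw [← h1, ← MulAut.mul_apply, ← map_mul, ← map_mul, mul_inv_cancel, map_one, map_one,
        MulAut.one_apply]
    refine ⟨h1', (ρ (AH s m (FreeGroup.of j)⁻¹) w)⁻¹, ?_, ?_⟩
    · have := rho_inv h2
      rw [← map_inv (AH s m), map_mul, map_mul, map_inv (ρ _) w] at this
      rw [inv_inv, ← mul_inv_eq_iff_eq_mul, eq_comm, inv_mul_eq_iff_eq_mul, ← mul_assoc]
      exact this.symm
    · rw [map_inv, h1', h3, map_inv]
  | mul a b ha hb =>
    obtain ⟨h1, w, h2, h3⟩ := ha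
    obtain ⟨k1, v, k2, k3⟩ := hb
    refine ⟨fun w => by rw [map_mul, map_mul, MulAut.mul_apply, h1, k1],
      ρ (AH s m a) v * w, ?_, ?_⟩
    · rw [map_mul, map_mul, MulAut.mul_apply, k2, map_mul, map_mul, h2, map_inv (ρ _) v]
      group
    · rw [map_mul, h1, k3, h3, map_mul, mul_inv_rev]

lemma cc_act (hr : IsRep n s ρ) {m : ℕ} (hm : m + 1 < n) :
    ∀ d k, d + k = m + 1 → ρ (cc s m k) (xx n k) = xx n (m+1) := by
  intro d
  induction d with
  | zero => intro k hk; obtain rfl : k = m + 1 := by omega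
            simp [cc_top]
  | succ d ih =>
    intro k hk
    rw [cc_of_le s (by omega), map_mul, MulAut.mul_apply, hr.r1 _ (by omega), ih _ (by omega)]

theorem faithful (hs : Rels s (n-1)) (hr : IsRep n s ρ) :
    ∀ m, m < n → ∀ g ∈ HH s m, ρ g = 1 → g = 1 := by
  intro m
  induction m with
  | zero =>
    intro _ g hg _
    simpa [HH] using hg
  | succ m ih =>
    intro hm g hg h1
    obtain ⟨_, ⟨f, rfl⟩, h, hh, k, hk, rfl⟩ := decomp hs (by omega : m < n - 1) g hg
    obtain ⟨e1, w, e2, e3⟩ := AH_act hr hm f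
    obtain ⟨c1, c2⟩ := kill_comm_HH hr hm h hh
    have hkm : k = m + 1 := by
      by_contra hne
      have := DFunLike.congr_fun h1 (xx n k)
      rw [map_mul, map_mul, MulAut.mul_apply, MulAut.mul_apply,
        cc_act hr hm (m + 1 - k) k (by omega), c2, e2, MulAut.one_apply] at this
      have := congrArg (kill n (m+1)) this
      rw [map_mul, map_mul, kill_xx, kill_xx, if_pos rfl, if_neg hne, map_inv, mul_one,
        mul_inv_cancel] at this
      exact xx_ne_one (by omega) this.symm
    subst hkm
    rw [cc_top, mul_one] at h1 ⊢
    have hh1 : ρ h = 1 := by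
      have : (ρ h).toMonoidHom = MonoidHom.id _ := by
        apply hom_ext'
        intro j hj
        by_cases hjm : j = m + 1
        · subst hjm; exact c2
        · have := congrArg (kill n (m+1)) (DFunLike.congr_fun h1 (xx n j))
          rw [map_mul, MulAut.mul_apply, e1, MulAut.one_apply, c1, kill_xx, if_neg hjm] at this
          exact this
      ext w
      exact DFunLike.congr_fun this w
    have hh2 := ih (by omega) h hh hh1
    subst hh2
    rw [mul_one] at h1 ⊢
    rw [h1, MulAut.one_apply] at e2
    have := kill_of_comm hm w (eq_mul_inv_iff_mul_eq.mp e2).symm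
    rw [e3, inv_eq_one] at this
    have hf : f = 1 := by
      apply FreeGroup.map_injective (Fin.castLE_injective (by omega : m + 1 ≤ n))
      rw [this, map_one]
    rw [hf, map_one]

/-- Braid generators indexed by `ℕ`. -/
def ss (n i : ℕ) : BraidGroup n := if h : i < n - 1 then braidGen n ⟨i, h⟩ else 1

lemma ss_rels (n : ℕ) : Rels (ss n) (n-1) where
  comm i j hij hj := by
    have hi : i < n - 1 := by omega
    simp only [ss, hi, hj, dif_pos, braidGen]
    rw [← mul_inv_eq_one]
    exact PresentedGroup.one_of_mem (Or.inl ⟨⟨i, hi⟩, ⟨j, hj⟩, hij, rfl⟩)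
  braid i hj := by
    have hi : i < n - 1 := by omega
    simp only [ss, hi, hj, dif_pos, braidGen]
    rw [← mul_inv_eq_one]
    exact PresentedGroup.one_of_mem (Or.inr ⟨⟨i, hi⟩, ⟨i+1, hj⟩, rfl, rfl⟩)

lemma ss_rep {n : ℕ} {ρ : BraidGroup n →* MulAut (FreeGroup (Fin n))}
    (hρ : IsArtinRep n ρ) : IsRep n (ss n) ρ where
  r1 i hi := by
    have h := hρ ⟨i, by omega⟩
    rw [xx_of, xx_of] at h
    simpa [ss, (by omega : i < n - 1), genIdx, genIdxSucc] using h.1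
  r2 i hi := by
    have h := hρ ⟨i, by omega⟩
    rw [xx_of, xx_of] at h
    simpa [ss, (by omega : i < n - 1), genIdx, genIdxSucc] using h.2.1
  r3 i j hi h1 h2 := by
    by_cases hj : j < n
    · have h := (hρ ⟨i, by omega⟩).2.2 ⟨j, hj⟩ (by simpa [genIdx] using h1)
        (by simpa [genIdxSucc] using h2)
      rw [xx_of] at h
      simpa [ss, (by omega : i < n - 1)] using h
    · simp [xx, hj]

end ArtinProof

/-- (Artin) The Artin representation `ρ : Bₙ → Aut(Fₙ)` is faithful. -/
theorem artinRep_faithful (n : ℕ) (ρ : BraidGroup n →* MulAut (FreeGroup (Fin n)))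
    (hρ : IsArtinRep n ρ) : Function.Injective ρ := by
  rw [injective_iff_map_eq_one]
  intro g hg
  have htop : g ∈ ArtinProof.HH (ArtinProof.ss n) (n - 1) := by
    have h := PresentedGroup.closure_range_of (braidRels n)
    have hle : Subgroup.closure (Set.range (PresentedGroup.of (rels := braidRels n))) ≤
        ArtinProof.HH (ArtinProof.ss n) (n - 1) := by
      apply Subgroup.closure_mono
      rintro _ ⟨i, rfl⟩
      exact ⟨i, i.2, by simp [ArtinProof.ss, braidGen]⟩
    rw [h] at hle
    exact hle (Subgroup.mem_top g)
  rcases Nat.eq_zero_or_pos n with h0 | hpos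
  · subst h0
    simpa [ArtinProof.HH] using htop
  · exact ArtinProof.faithful (ArtinProof.ss_rels n) (ArtinProof.ss_rep hρ) (n - 1) (by omega)
      g htop hg
end

section
/- (Artin) An automorphism f ∈ Aut(F_n) lies in the image of the Artin representation ρ : B_n → Aut(F_n) if and only if both of the following hold: (1) for each i = 1,…,n, there exist j ∈ {1,…,n} and w ∈ F_n such that f(x_i) = w⁻¹ x_j w; and (2) f(x_1 x_2 ⋯ x_n) = x_1 x_2 ⋯ x_n. -/
namespace ArtinAux

open FreeGroup

set_option linter.unusedSectionVars false

variable {α : Type*} [DecidableEq α]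

/-- The conjugate `p⁻¹ x_j p`. -/
def cj (j : α) (p : List (α × Bool)) : FreeGroup α := (mk p)⁻¹ * of j * mk p

/-- The word `p⁻¹ x_j p` is reduced. -/
def Good (j : α) (p : List (α × Bool)) : Prop :=
  IsReduced ((j, true) :: p) ∧ IsReduced ((j, false) :: p)

/-- No cancellation of the central letters between two consecutive conjugates. -/
def Rel (s t : α × List (α × Bool)) : Prop :=
  ∃ m, mk s.2 * (mk t.2)⁻¹ = mk m ∧ IsReduced ((s.1, true) :: m ++ [(t.1, true)])

theorem mk_cons_true (j : α) (p : List (α × Bool)) : mk ((j, true) :: p) = of j * mk p := by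
  rw [of, mul_mk]; rfl

theorem mk_cons_false (j : α) (p : List (α × Bool)) : mk ((j, false) :: p) = (of j)⁻¹ * mk p := by
  rw [of, inv_mk, mul_mk]; rfl

theorem isReduced_cons_of (a : α × Bool) (p : List (α × Bool)) (hp : IsReduced p)
    (h : ∀ q, p ≠ (a.1, !a.2) :: q) : IsReduced (a :: p) := by
  cases p with
  | nil => exact IsReduced.singleton
  | cons b q =>
    rw [isReduced_cons_cons]
    refine ⟨fun e => ?_, hp⟩
    by_contra hne
    apply h q
    congr 1
    obtain ⟨a1, a2⟩ := a
    obtain ⟨b1, b2⟩ := b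
    simp only at e hne ⊢
    subst e
    cases a2 <;> cases b2 <;> simp_all

theorem good_or (j : α) (p : List (α × Bool)) :
    Good j p ∨ ∃ q, q.length < p.length ∧ cj j q = cj j p := by
  by_cases hp : IsReduced p
  · by_cases h1 : ∃ q, p = (j, false) :: q
    · obtain ⟨q, rfl⟩ := h1
      right
      refine ⟨q, by simp, ?_⟩
      simp only [cj, mk_cons_false]
      group
    by_cases h2 : ∃ q, p = (j, true) :: q
    · obtain ⟨q, rfl⟩ := h2
      right
      refine ⟨q, by simp, ?_⟩
      simp only [cj, mk_cons_true]
      group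
    left
    push Not at h1 h2
    exact ⟨isReduced_cons_of _ _ hp (by simpa using h1),
      isReduced_cons_of _ _ hp (by simpa using h2)⟩
  · right
    refine ⟨reduce p, ?_, ?_⟩
    · have h1 : (reduce p).length ≤ p.length := norm_mk_le
      rcases h1.lt_or_eq with h | h
      · exact h
      · exfalso
        apply hp
        have hs : (reduce p).Sublist p := Red.sublist reduce.red
        exact isReduced_iff_reduce_eq.2 (hs.eq_of_length h)
    · simp only [cj, reduce.self]

theorem isReduced_invRev {p : List (α × Bool)} (h : IsReduced p) : IsReduced (invRev p) := by
  rw [isReduced_iff_reduce_eq] at h ⊢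
  rw [reduce_invRev, h]

theorem common_prefix {β : Type*} [DecidableEq β] : ∀ p q : List β, ∃ c p' q', p = c ++ p' ∧
    q = c ++ q' ∧ ∀ x ∈ p'.head?, ∀ y ∈ q'.head?, x ≠ y
  | [], q => ⟨[], [], q, by simp⟩
  | p, [] => ⟨[], p, [], by simp⟩
  | a :: p, b :: q => by
    by_cases h : a = b
    · subst h
      obtain ⟨c, p', q', rfl, rfl, h⟩ := common_prefix p q
      exact ⟨a :: c, p', q', by simp, by simp, h⟩
    · exact ⟨[], a :: p, b :: q, by simp, by simp, by simpa using h⟩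

theorem common_suffix {β : Type*} [DecidableEq β] (p q : List β) : ∃ c p' q', p = p' ++ c ∧
    q = q' ++ c ∧ ∀ x ∈ p'.getLast?, ∀ y ∈ q'.getLast?, x ≠ y := by
  obtain ⟨c, p', q', hp, hq, h⟩ := common_prefix p.reverse q.reverse
  refine ⟨c.reverse, p'.reverse, q'.reverse, ?_, ?_, ?_⟩
  · rw [← List.reverse_append, ← hp, List.reverse_reverse]
  · rw [← List.reverse_append, ← hq, List.reverse_reverse]
  · simpa using h

theorem invRev_append (p q : List (α × Bool)) : invRev (p ++ q) = invRev q ++ invRev p := by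
  simp [invRev]

theorem pair_lemma (j k : α) (p q : List (α × Bool)) (hp : Good j p) (hq : Good k q) :
    Rel (j, p) (k, q) ∨
    (∃ q', q'.length < q.length ∧ cj j p * cj k q * (cj j p)⁻¹ = cj k q') ∨
    (∃ p', p'.length < p.length ∧ (cj k q)⁻¹ * cj j p * cj k q = cj j p') := by
  obtain ⟨c, p', q', rfl, rfl, h⟩ := common_suffix p q
  have hm : mk (p' ++ c) * (mk (q' ++ c))⁻¹ = mk (p' ++ invRev q') := by
    simp only [← mul_mk, ← inv_mk]; group
  have hjp : IsReduced ((j, true) :: p') := hp.1.infix ⟨[], c, by simp⟩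
  have hqk : IsReduced (invRev q' ++ [(k, true)]) := by
    have : IsReduced ((k, false) :: q') := hq.2.infix ⟨[], c, by simp⟩
    simpa [invRev] using isReduced_invRev this
  rcases List.eq_nil_or_concat p' with rfl | ⟨p'', x, rfl⟩ <;>
    rcases List.eq_nil_or_concat q' with rfl | ⟨q'', y, rfl⟩
  · left
    refine ⟨_, hm, ?_⟩
    simp
  · by_cases hy : y = (j, true)
    · subst hy
      right; left
      refine ⟨q'' ++ c, by simp, ?_⟩
      have e : mk (q'' ++ [(j, true)] ++ c) = mk q'' * of j * mk c := by
        rw [← mul_mk, ← mul_mk]; rfl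
      simp only [List.concat_eq_append, cj, e, List.nil_append, ← mul_mk]
      group
    · left
      refine ⟨_, hm, ?_⟩
      obtain ⟨y1, y2⟩ := y
      simp only [List.concat_eq_append, invRev_append, List.nil_append, List.append_assoc,
        List.cons_append] at hqk ⊢
      simp only [invRev, List.map_cons, List.map_nil, List.reverse_cons, List.reverse_nil,
        List.nil_append, List.cons_append] at hqk ⊢
      rw [isReduced_cons_cons]
      refine ⟨?_, hqk⟩
      rintro rfl
      cases y2 <;> simp_all
  · by_cases hx : x = (k, false)
    · subst hx
      right; right
      refine ⟨p'' ++ c, by simp, ?_⟩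
      have e : mk (p'' ++ [(k, false)] ++ c) = mk p'' * (of k)⁻¹ * mk c := by
        rw [← mul_mk, ← mul_mk, of, inv_mk]; rfl
      simp only [List.concat_eq_append, cj, e, List.nil_append, ← mul_mk]
      group
    · left
      refine ⟨_, hm, ?_⟩
      obtain ⟨x1, x2⟩ := x
      simp only [List.concat_eq_append] at hjp
      have h2 : IsReduced ([(x1, x2)] ++ [(k, true)]) := by
        simp only [List.cons_append, List.nil_append, isReduced_cons_cons]
        refine ⟨?_, IsReduced.singleton⟩
        rintro rfl
        cases x2 <;> simp_all
      have h3 := IsReduced.append_overlap (L₁ := (j, true) :: p'') (by simpa using hjp) h2 (by simp)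
      simpa [invRev] using h3
  · left
    refine ⟨_, hm, ?_⟩
    simp only [List.concat_eq_append] at *
    have hxy : x ≠ y := by simpa using h
    have hne : invRev (q'' ++ [y]) ≠ [] := by simp [invRev]
    have h1 : IsReduced ([x] ++ invRev (q'' ++ [y])) := by
      have h0 : IsReduced (invRev (q'' ++ [y])) := hqk.infix ⟨[], [(k, true)], by simp⟩
      obtain ⟨x1, x2⟩ := x
      obtain ⟨y1, y2⟩ := y
      simp only [invRev_append] at h0 ⊢
      simp only [invRev, List.map_cons, List.map_nil, List.reverse_cons, List.reverse_nil,
        List.nil_append, List.cons_append] at h0 ⊢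
      rw [isReduced_cons_cons]
      refine ⟨?_, h0⟩
      rintro rfl
      cases x2 <;> cases y2 <;> simp_all
    have h2 := IsReduced.append_overlap (L₁ := (j, true) :: p'') (by simpa using hjp) h1 (by simp)
    have h3 := IsReduced.append_overlap h2 hqk hne
    simpa using h3

/-- The product of the conjugates of a chain, in reduced form. -/
theorem chain_lemma : ∀ (l : List (α × List (α × Bool))) (s : α × List (α × Bool)),
    (s :: l).IsChain Rel → (∀ t ∈ s :: l, Good t.1 t.2) →
    ∃ W, IsReduced ((s.1, true) :: W) ∧ l.length ≤ W.length ∧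
      ((s :: l).map (fun t => cj t.1 t.2)).prod = (mk s.2)⁻¹ * mk ((s.1, true) :: W) ∧
      (W.length = l.length → mk s.2 = 1 → ∀ t ∈ l, mk t.2 = 1)
  | [], s, _, hg => by
    refine ⟨s.2, (hg s (by simp)).1, by simp, ?_, by simp⟩
    simp [cj, mk_cons_true, mul_assoc]
  | t :: l, s, hc, hg => by
    rw [List.isChain_cons_cons] at hc
    obtain ⟨⟨m, hm, hr⟩, hc⟩ := hc
    obtain ⟨W, h1, h2, h3, h4⟩ := chain_lemma l t hc (fun u hu => hg u (by simp [hu]))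
    refine ⟨m ++ (t.1, true) :: W, ?_, ?_, ?_, ?_⟩
    · have := IsReduced.append_overlap (L₁ := (s.1, true) :: m) (L₂ := [(t.1, true)]) (L₃ := W)
        hr h1 (by simp)
      simpa using this
    · simp; omega
    · rw [List.map_cons, List.prod_cons, h3, mk_cons_true s.1, ← mul_mk (L₁ := m), ← hm, cj]
      group
    · intro hl hs
      simp only [List.length_append, List.length_cons] at hl
      have hm0 : m = [] := List.length_eq_zero_iff.1 (by omega)
      subst hm0
      have ht : mk t.2 = 1 := by
        rw [hs, one_mul] at hm
        exact inv_eq_one.1 hm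
      intro u hu
      rcases List.mem_cons.1 hu with rfl | hu
      · exact ht
      · exact h4 (by simp at hl; omega) ht u hu

theorem isReduced_pos (l : List α) : IsReduced (l.map fun j => (j, true)) := by
  induction l with
  | nil => exact IsReduced.nil
  | cons a l ih =>
    apply isReduced_cons_of _ _ ih
    intro q h
    cases l <;> simp at h

theorem prod_of (l : List α) : (l.map of).prod = mk (l.map fun j => (j, true)) := by
  induction l with
  | nil => rfl
  | cons a l ih => rw [List.map_cons, List.prod_cons, ih, List.map_cons, mk_cons_true]

theorem chain_final (l : List (α × List (α × Bool))) (l' : List α) (hl : l.length = l'.length)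
    (hc : l.IsChain Rel) (hg : ∀ t ∈ l, Good t.1 t.2)
    (hprod : (l.map (fun t => cj t.1 t.2)).prod = (l'.map of).prod) :
    (∀ t ∈ l, mk t.2 = 1) ∧ l.map Prod.fst = l' := by
  have key : ∀ t ∈ l, mk t.2 = 1 := by
    cases l with
    | nil => simp
    | cons s l =>
      obtain ⟨W, h1, h2, h3, h4⟩ := chain_lemma l s hc hg
      have h5 : IsReduced (invRev s.2 ++ [(s.1, true)]) := by
        simpa [invRev] using isReduced_invRev (hg s (by simp)).2
      have h6 := IsReduced.append_overlap (L₃ := W) h5 h1 (by simp)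
      rw [h3, prod_of, inv_mk, mul_mk] at hprod
      have h7 := reduce.sound hprod
      rw [(isReduced_pos l').reduce_eq] at h7
      rw [show invRev s.2 ++ (s.1, true) :: W = invRev s.2 ++ [(s.1, true)] ++ W by simp,
        h6.reduce_eq] at h7
      have h8 := congrArg List.length h7
      simp at h8 hl
      have hs : s.2 = [] := List.length_eq_zero_iff.1 (by omega)
      have hs' : mk s.2 = 1 := by rw [hs]; rfl
      intro t ht
      rcases List.mem_cons.1 ht with rfl | ht
      · exact hs'
      · exact h4 (by omega) hs' t ht
  refine ⟨key, ?_⟩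
  have e : l.map (fun t => cj t.1 t.2) = (l.map Prod.fst).map of := by
    rw [List.map_map]
    apply List.map_congr_left
    intro t ht
    simp [cj, key t ht]
  rw [e, prod_of, prod_of] at hprod
  have h7 := reduce.sound hprod
  rw [(isReduced_pos _).reduce_eq, (isReduced_pos _).reduce_eq] at h7
  exact (List.map_injective_iff.2 (fun a b h => by simpa using h)) h7

end ArtinAux

namespace ArtinAux

open FreeGroup

/-- Each generator is sent to a conjugate of a generator. -/
def ConjGen {n : ℕ} (f : MulAut (FreeGroup (Fin n))) : Prop :=
  ∀ i : Fin n, ∃ (j : Fin n) (w : FreeGroup (Fin n)), f (of i) = w⁻¹ * of j * w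

theorem ConjGen.mul {n : ℕ} {f g : MulAut (FreeGroup (Fin n))} (hf : ConjGen f) (hg : ConjGen g) :
    ConjGen (f * g) := by
  intro i
  obtain ⟨j, w, h⟩ := hg i
  obtain ⟨k, v, h'⟩ := hf j
  refine ⟨k, v * f w, ?_⟩
  rw [MulAut.mul_apply, h, _root_.map_mul, _root_.map_mul, h', _root_.map_inv]
  group

theorem genIdx_ne (n : ℕ) (i : Fin (n - 1)) : genIdx n i ≠ genIdxSucc n i := by
  simp [genIdx, genIdxSucc]

theorem conjGen_gen {n : ℕ} {ρ : BraidGroup n →* MulAut (FreeGroup (Fin n))}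
    (hρ : IsArtinRep n ρ) (i : Fin (n - 1)) : ConjGen (ρ (braidGen n i)) := by
  obtain ⟨h1, h2, h3⟩ := hρ i
  intro j
  by_cases e1 : j = genIdx n i
  · subst e1; exact ⟨genIdxSucc n i, 1, by rw [h1]; simp⟩
  by_cases e2 : j = genIdxSucc n i
  · subst e2; exact ⟨_, _, h2⟩
  exact ⟨j, 1, by rw [h3 j e1 e2]; simp⟩

theorem inv_gen {n : ℕ} {ρ : BraidGroup n →* MulAut (FreeGroup (Fin n))}
    (hρ : IsArtinRep n ρ) (i : Fin (n - 1)) :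
    (ρ (braidGen n i))⁻¹ (of (genIdxSucc n i)) = of (genIdx n i) ∧
    (ρ (braidGen n i))⁻¹ (of (genIdx n i)) =
      of (genIdx n i) * of (genIdxSucc n i) * (of (genIdx n i))⁻¹ ∧
    ∀ j : Fin n, j ≠ genIdx n i → j ≠ genIdxSucc n i →
      (ρ (braidGen n i))⁻¹ (of j) = of j := by
  obtain ⟨h1, h2, h3⟩ := hρ i
  have key : ∀ x y, ρ (braidGen n i) x = y → (ρ (braidGen n i))⁻¹ y = x := by
    rintro x y rfl
    rw [← MulAut.mul_apply]; simp
  refine ⟨key _ _ h1, key _ _ ?_, fun j e1 e2 => key _ _ (h3 j e1 e2)⟩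
  rw [_root_.map_mul, _root_.map_mul, _root_.map_inv, h1, h2]
  group

theorem conjGen_inv_gen {n : ℕ} {ρ : BraidGroup n →* MulAut (FreeGroup (Fin n))}
    (hρ : IsArtinRep n ρ) (i : Fin (n - 1)) : ConjGen (ρ (braidGen n i))⁻¹ := by
  obtain ⟨h1, h2, h3⟩ := inv_gen hρ i
  intro j
  by_cases e1 : j = genIdx n i
  · subst e1; exact ⟨genIdxSucc n i, (of (genIdx n i))⁻¹, by rw [h2]; simp⟩
  by_cases e2 : j = genIdxSucc n i
  · subst e2; exact ⟨genIdx n i, 1, by rw [h1]; simp⟩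
  exact ⟨j, 1, by rw [h3 j e1 e2]; simp⟩

/-- Generators indexed by natural numbers. -/
def natGen (n k : ℕ) : FreeGroup (Fin n) := if h : k < n then of ⟨k, h⟩ else 1

theorem prod_eq_nat (n : ℕ) : ((List.finRange n).map of).prod =
    ((List.range n).map (natGen n)).prod := by
  congr 1
  apply List.ext_getElem
  · simp
  · intro k h1 h2
    have : k < n := by simpa using h1
    simp [natGen, this]

theorem gen_fixes {n : ℕ} {ρ : BraidGroup n →* MulAut (FreeGroup (Fin n))}
    (hρ : IsArtinRep n ρ) (i : Fin (n - 1)) :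
    ρ (braidGen n i) (((List.finRange n).map of).prod) = ((List.finRange n).map of).prod := by
  obtain ⟨h1, h2, h3⟩ := hρ i
  rw [prod_eq_nat]
  set s := ρ (braidGen n i)
  have hi := i.2
  have other : ∀ k, k ≠ i.1 → k ≠ i.1 + 1 → s (natGen n k) = natGen n k := by
    intro k e1 e2
    unfold natGen
    split_ifs with h
    · apply h3
      · simpa [genIdx, Fin.ext_iff] using e1
      · simpa [genIdxSucc, Fin.ext_iff] using e2
    · simp
  have e1 : natGen n i.1 = of (genIdx n i) := by
    rw [natGen, dif_pos (by omega)]; rfl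
  have e2 : natGen n (i.1 + 1) = of (genIdxSucc n i) := by
    rw [natGen, dif_pos (by omega)]; rfl
  have A : ∀ k, k ≤ i.1 → s ((List.range k).map (natGen n)).prod =
      ((List.range k).map (natGen n)).prod := by
    intro k
    induction k with
    | zero => simp
    | succ k ih =>
      intro hk
      rw [List.range_succ, List.map_append, List.prod_append, _root_.map_mul, ih (by omega)]
      simp [other k (by omega) (by omega)]
  have B : ∀ d, s ((List.range (i.1 + 2 + d)).map (natGen n)).prod =
      ((List.range (i.1 + 2 + d)).map (natGen n)).prod := by
    intro d
    induction d with
    | zero =>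
      simp only [add_zero, List.range_succ, List.map_append, List.prod_append, _root_.map_mul,
        A _ le_rfl, List.map_cons, List.map_nil, List.prod_singleton, e1, e2, h1, h2]
      group
    | succ d ih =>
      rw [← add_assoc, List.range_succ, List.map_append, List.prod_append, _root_.map_mul, ih]
      simp [other (i.1 + 2 + d) (by omega) (by omega)]
  have := B (n - (i.1 + 2))
  rwa [show i.1 + 2 + (n - (i.1 + 2)) = n by omega] at this

theorem forward {n : ℕ} {ρ : BraidGroup n →* MulAut (FreeGroup (Fin n))}
    (hρ : IsArtinRep n ρ) (β : BraidGroup n) : ConjGen (ρ β) ∧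
      ρ β (((List.finRange n).map of).prod) = ((List.finRange n).map of).prod := by
  have hβ : β ∈ Subgroup.closure (Set.range (PresentedGroup.of (rels := braidRels n))) := by
    rw [PresentedGroup.closure_range_of]; trivial
  induction hβ using Subgroup.closure_induction_left with
  | one => exact ⟨fun i => ⟨i, 1, by simp⟩, by simp⟩
  | mul_left x hx y hy ih =>
    obtain ⟨i, rfl⟩ := hx
    change ConjGen (ρ (braidGen n i * y)) ∧ ρ (braidGen n i * y) _ = _
    rw [_root_.map_mul]
    refine ⟨(conjGen_gen hρ i).mul ih.1, ?_⟩
    rw [MulAut.mul_apply, ih.2, gen_fixes hρ]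
  | inv_mul_cancel x hx y hy ih =>
    obtain ⟨i, rfl⟩ := hx
    change ConjGen (ρ ((braidGen n i)⁻¹ * y)) ∧ ρ ((braidGen n i)⁻¹ * y) _ = _
    rw [_root_.map_mul, _root_.map_inv]
    refine ⟨(conjGen_inv_gen hρ i).mul ih.1, ?_⟩
    rw [MulAut.mul_apply, ih.2]
    nth_rewrite 1 [← gen_fixes hρ i]
    rw [← MulAut.mul_apply]; simp

theorem sum_update_lt {n : ℕ} (p : Fin n → List (Fin n × Bool)) (i : Fin n)
    (q : List (Fin n × Bool)) (h : q.length < (p i).length) :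
    ∑ k, (Function.update p i q k).length < ∑ k, (p k).length := by
  apply Finset.sum_lt_sum
  · intro k _
    by_cases e : k = i
    · subst e; simpa using h.le
    · simp [e]
  · exact ⟨i, Finset.mem_univ _, by simpa using h⟩

theorem backward {n : ℕ} {ρ : BraidGroup n →* MulAut (FreeGroup (Fin n))}
    (hρ : IsArtinRep n ρ) : ∀ (S : ℕ) (f : MulAut (FreeGroup (Fin n))) (j : Fin n → Fin n)
      (p : Fin n → List (Fin n × Bool)), (∀ i, f (of i) = cj (j i) (p i)) →
      f (((List.finRange n).map of).prod) = ((List.finRange n).map of).prod →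
      ∑ k, (p k).length = S → f ∈ ρ.range := by
  intro S
  induction S using Nat.strong_induction_on with
  | _ S ih =>
  intro f j p hf hfix hS
  by_cases hgood : ∀ i, Good (j i) (p i)
  swap
  · push Not at hgood
    obtain ⟨i, hi⟩ := hgood
    obtain ⟨q, hq, hcj⟩ := (good_or (j i) (p i)).resolve_left hi
    refine ih _ (hS ▸ sum_update_lt p i q hq) f j (Function.update p i q) ?_ hfix rfl
    intro k
    by_cases e : k = i
    · subst e; simp [hcj, hf]
    · simp [e, hf]
  by_cases hrel : ∀ i : Fin (n - 1), Rel (j (genIdx n i), p (genIdx n i))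
      (j (genIdxSucc n i), p (genIdxSucc n i))
  · -- everything is reduced, so `f = 1`
    have hchain : (List.ofFn fun i => (j i, p i)).IsChain Rel := by
      rw [List.isChain_ofFn]
      intro i hi
      exact hrel ⟨i, by omega⟩
    obtain ⟨k1, k2⟩ := chain_final (List.ofFn fun i => (j i, p i)) (List.finRange n) (by simp)
      hchain (by
        intro t ht
        obtain ⟨i, rfl⟩ := (List.mem_ofFn' _ _).1 ht
        exact hgood i) (by
        rw [← hfix, map_list_prod, List.map_map, List.ofFn_eq_map, List.map_map]
        congr 1
        apply List.map_congr_left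
        intro i _
        simp [hf])
    have hj : ∀ i, j i = i := by
      intro i
      rw [List.ofFn_eq_map, List.map_map] at k2
      have h := congrArg (fun l => l[i.1]?) k2
      simpa using h
    have : f = 1 := by
      apply MulEquiv.toMonoidHom_injective
      ext i
      have h1 : mk (p i) = 1 := k1 (j i, p i) ((List.mem_ofFn' _ _).2 ⟨i, rfl⟩)
      simp [hf, cj, h1, hj]
    rw [this]
    exact one_mem _
  · push Not at hrel
    obtain ⟨i, hi⟩ := hrel
    have hne := genIdx_ne n i
    have hsum : ∀ q : Fin n → List (Fin n × Bool),
        ∑ k, (q (Equiv.swap (genIdx n i) (genIdxSucc n i) k)).length = ∑ k, (q k).length :=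
      fun q => Equiv.sum_comp (Equiv.swap (genIdx n i) (genIdxSucc n i)) (fun k => (q k).length)
    rcases (pair_lemma _ _ _ _ (hgood (genIdx n i)) (hgood (genIdxSucc n i))).resolve_left hi with
      ⟨q, hq, hc⟩ | ⟨q, hq, hc⟩
    · obtain ⟨g1, g2, g3⟩ := inv_gen hρ i
      have := ih _ (hS ▸ (hsum _).trans_lt (sum_update_lt p _ q hq)) (f * (ρ (braidGen n i))⁻¹)
        (j ∘ Equiv.swap (genIdx n i) (genIdxSucc n i)) _ ?_ ?_ rfl
      · have h2 := mul_mem this (MonoidHom.mem_range.2 ⟨braidGen n i, rfl⟩)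
        simpa using h2
      · intro k
        rw [MulAut.mul_apply]
        by_cases e1 : k = genIdx n i
        · subst e1
          rw [g2, _root_.map_mul, _root_.map_mul, _root_.map_inv, hf, hf, hc]
          simp
        by_cases e2 : k = genIdxSucc n i
        · subst e2
          rw [g1, hf]
          simp [hne]
        rw [g3 k e1 e2, hf]
        simp [Equiv.swap_apply_of_ne_of_ne e1 e2, e2]
      · rw [MulAut.mul_apply]
        have hinv : (ρ (braidGen n i))⁻¹ (((List.finRange n).map of).prod) =
            ((List.finRange n).map of).prod := by
          nth_rewrite 1 [← gen_fixes hρ i]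
          rw [← MulAut.mul_apply]; simp
        rw [hinv, hfix]
    · obtain ⟨g1, g2, g3⟩ := hρ i
      have := ih _ (hS ▸ (hsum _).trans_lt (sum_update_lt p _ q hq)) (f * ρ (braidGen n i))
        (j ∘ Equiv.swap (genIdx n i) (genIdxSucc n i)) _ ?_ ?_ rfl
      · have h2 := mul_mem this (inv_mem (MonoidHom.mem_range.2 ⟨braidGen n i, rfl⟩))
        simpa using h2
      · intro k
        rw [MulAut.mul_apply]
        by_cases e1 : k = genIdx n i
        · subst e1
          rw [g1, hf]
          simp [hne.symm]
        by_cases e2 : k = genIdxSucc n i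
        · subst e2
          rw [g2, _root_.map_mul, _root_.map_mul, _root_.map_inv, hf, hf, hc]
          simp
        rw [g3 k e1 e2, hf]
        simp [Equiv.swap_apply_of_ne_of_ne e1 e2, e1]
      · rw [MulAut.mul_apply, gen_fixes hρ, hfix]

end ArtinAux

/-- (Artin) An automorphism `f ∈ Aut(Fₙ)` lies in the image of the Artin representation iff
each `f(xᵢ)` is a conjugate of some generator `xⱼ` and `f` fixes the product `x₁x₂⋯xₙ`. -/
theorem artinRep_image_characterization (n : ℕ)
    (ρ : BraidGroup n →* MulAut (FreeGroup (Fin n))) (hρ : IsArtinRep n ρ)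
    (f : MulAut (FreeGroup (Fin n))) :
    (∃ β : BraidGroup n, ρ β = f) ↔
      ((∀ i : Fin n, ∃ (j : Fin n) (w : FreeGroup (Fin n)),
          f (FreeGroup.of i) = w⁻¹ * FreeGroup.of j * w) ∧
        f (((List.finRange n).map FreeGroup.of).prod) =
          ((List.finRange n).map FreeGroup.of).prod) := by
  constructor
  · rintro ⟨β, rfl⟩
    exact ArtinAux.forward hρ β
  · rintro ⟨h1, h2⟩
    choose j w hw using h1
    refine ArtinAux.backward hρ _ f j (fun i => (w i).toWord) (fun i => ?_) h2 rfl
    rw [ArtinAux.cj, FreeGroup.mk_toWord]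
    exact hw i
end

section
/- (Garside/Chow) For every n > 2, the center of the braid group B_n is the cyclic subgroup generated by Δ²: Z(B_n) = ⟨Δ²⟩, i.e. an element β ∈ B_n commutes with every element of B_n if and only if β = Δ^{2k} for some k ∈ ℤ. -/
/-- The generator `σᵢ` indexed by a natural number (`1` if out of range). -/
def sigmaN (n : ℕ) (i : ℕ) : BraidGroup n :=
  if h : i < n - 1 then braidGen n ⟨i, h⟩ else 1

/-- The descending run `σₖ σₖ₋₁ ⋯ σ₀` (0-indexed). -/
def descRun (n k : ℕ) : BraidGroup n :=
  (((List.range (k + 1)).reverse).map (sigmaN n)).prod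

/-- The half twist `Δ = σ₁(σ₂σ₁)(σ₃σ₂σ₁)⋯(σₙ₋₁σₙ₋₂⋯σ₁)` (written 1-indexed). -/
def halfTwist (n : ℕ) : BraidGroup n :=
  ((List.range (n - 1)).map (descRun n)).prod

/-- The braid `δ = σ₁σ₂⋯σₙ₋₁` (written 1-indexed). -/
def deltaBraid (n : ℕ) : BraidGroup n :=
  ((List.range (n - 1)).map (sigmaN n)).prod

/-- The braid `ε = σ₁δ = σ₁(σ₁σ₂⋯σₙ₋₁)` (written 1-indexed). -/
def epsBraid (n : ℕ) : BraidGroup n := sigmaN n 0 * deltaBraid n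

/-- Equality of positive braid words on infinitely many strands. -/
inductive PEq : List ℕ → List ℕ → Prop
  | refl (u) : PEq u u
  | symm {u v} : PEq u v → PEq v u
  | trans {u v w} : PEq u v → PEq v w → PEq u w
  | cons (a) {u v} : PEq u v → PEq (a :: u) (a :: v)
  | comm (i j w) : i + 1 < j → PEq (i :: j :: w) (j :: i :: w)
  | braid (i w) : PEq (i :: (i + 1) :: i :: w) ((i + 1) :: i :: (i + 1) :: w)

namespace PEq

/-- Far apart. -/
def Far (i j : ℕ) : Prop := i + 1 < j ∨ j + 1 < i
/-- Adjacent. -/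
def Adj (i j : ℕ) : Prop := i + 1 = j ∨ j + 1 = i

theorem Far.symm {i j : ℕ} (h : Far i j) : Far j i := Or.symm h
theorem Adj.symm {i j : ℕ} (h : Adj i j) : Adj j i := Or.symm h

theorem tri (i j : ℕ) : i = j ∨ Far i j ∨ Adj i j := by
  unfold Far Adj; omega

theorem far {i j : ℕ} (h : Far i j) (w) : PEq (i :: j :: w) (j :: i :: w) := by
  rcases h with h | h
  · exact comm _ _ _ h
  · exact (comm _ _ _ h).symm

theorem adj {i j : ℕ} (h : Adj i j) (w) : PEq (i :: j :: i :: w) (j :: i :: j :: w) := by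
  rcases h with rfl | rfl
  · exact braid _ _
  · exact (braid _ _).symm

theorem length_eq {u v} (h : PEq u v) : u.length = v.length := by
  induction h <;> simp_all

theorem mem_iff {u v} (h : PEq u v) : ∀ x, x ∈ u ↔ x ∈ v := by
  induction h with
  | refl => simp
  | symm _ ih => intro x; exact (ih x).symm
  | trans _ _ h1 h2 => intro x; exact (h1 x).trans (h2 x)
  | cons a _ ih => intro x; simp [ih x]
  | comm i j w h => intro x; simp only [List.mem_cons]; tauto
  | braid i w => intro x; simp only [List.mem_cons]; tauto

theorem append_right {u v} (h : PEq u v) (w) : PEq (u ++ w) (v ++ w) := by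
  induction h with
  | refl => exact refl _
  | symm _ ih => exact ih.symm
  | trans _ _ h1 h2 => exact h1.trans h2
  | cons a _ ih => exact ih.cons a
  | comm i j w h => exact comm _ _ _ h
  | braid i w => exact braid _ _

theorem append_left {u v} (h : PEq u v) (w) : PEq (w ++ u) (w ++ v) := by
  induction w with
  | nil => exact h
  | cons a w ih => exact ih.cons a

theorem reverse {u v} (h : PEq u v) : PEq u.reverse v.reverse := by
  induction h with
  | refl => exact refl _
  | symm _ ih => exact ih.symm
  | trans _ _ h1 h2 => exact h1.trans h2
  | cons a _ ih => simpa using ih.append_right [a]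
  | comm i j w h => simpa using (comm i j [] h).symm.append_left w.reverse
  | braid i w => simpa using (braid i []).append_left w.reverse

/-- The conclusion of Garside's key lemma. -/
def R (i : ℕ) (X : List ℕ) (j : ℕ) (Y : List ℕ) : Prop :=
  (i = j ∧ PEq X Y) ∨ (Far i j ∧ ∃ Z, PEq X (j :: Z) ∧ PEq Y (i :: Z)) ∨
  (Adj i j ∧ ∃ Z, PEq X (j :: i :: Z) ∧ PEq Y (i :: j :: Z))

theorem R.symm {i X j Y} (h : R i X j Y) : R j Y i X := by
  rcases h with ⟨rfl, h⟩ | ⟨h, Z, a, b⟩ | ⟨h, Z, a, b⟩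
  · exact Or.inl ⟨rfl, h.symm⟩
  · exact Or.inr (Or.inl ⟨h.symm, Z, b, a⟩)
  · exact Or.inr (Or.inr ⟨h.symm, Z, b, a⟩)

theorem R.same {i X Y} (h : R i X i Y) : PEq X Y := by
  rcases h with ⟨_, h⟩ | ⟨h, _⟩ | ⟨h, _⟩
  · exact h
  · unfold Far at h; omega
  · unfold Adj at h; omega

theorem R.far {i X j Y} (h : R i X j Y) (hf : Far i j) :
    ∃ Z, PEq X (j :: Z) ∧ PEq Y (i :: Z) := by
  rcases h with ⟨h, _⟩ | ⟨_, h⟩ | ⟨h, _⟩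
  · unfold Far at hf; omega
  · exact h
  · unfold Adj at h; unfold Far at hf; omega

theorem R.adj {i X j Y} (h : R i X j Y) (hf : Adj i j) :
    ∃ Z, PEq X (j :: i :: Z) ∧ PEq Y (i :: j :: Z) := by
  rcases h with ⟨h, _⟩ | ⟨h, _⟩ | ⟨_, h⟩
  · unfold Adj at hf; omega
  · unfold Far at h; unfold Adj at hf; omega
  · exact h

/-- The mixed case of transitivity. -/
theorem R.trans_mixed {N : ℕ}
    (K : ∀ i X j Y, X.length < N → PEq (i :: X) (j :: Y) → R i X j Y)
    {i X k W j Y} (hX : X.length = N) (hik : Far i k) (hkj : Adj k j)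
    (h1 : R i X k W) (h2 : R k W j Y) : R i X j Y := by
  obtain ⟨Z, x1, w1⟩ := h1.far hik
  obtain ⟨Z', w2, y2⟩ := h2.adj hkj
  have lZ := x1.length_eq
  have e := w1.symm.trans w2
  have le := e.length_eq
  simp only [List.length_cons] at lZ le
  have K1 := K i Z j (k :: Z') (by omega) e
  rcases tri i j with rfl | hij | hij
  · unfold Far at hik; unfold Adj at hkj; omega
  · obtain ⟨U, a, b⟩ := K1.far hij
    have K2 := K k Z' i U (by omega) b
    obtain ⟨V, c, d⟩ := K2.far hik.symm
    refine Or.inr (Or.inl ⟨hij, k :: j :: V, ?_, ?_⟩)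
    · refine x1.trans (((a.trans (d.cons j)).cons k).trans ?_)
      exact PEq.adj hkj _
    · refine y2.trans (((c.cons j).cons k).trans ?_)
      exact (((PEq.far hij.symm V).cons k)).trans (PEq.far hik.symm _)
  · obtain ⟨U, a, b⟩ := K1.adj hij
    have K2 := K k Z' i (j :: U) (by omega) b
    obtain ⟨V, c, d⟩ := K2.far hik.symm
    have la := a.length_eq
    simp only [List.length_cons] at la
    have K3 := K j U k V (by omega) d
    obtain ⟨T, f, g⟩ := K3.adj hkj.symm
    refine Or.inr (Or.inr ⟨hij, k :: j :: i :: T, ?_, ?_⟩)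
    · refine x1.trans ((a.cons k).trans ((((f.cons i).cons j).cons k).trans ?_))
      refine (((PEq.far hik (j :: T)).cons j).cons k).trans ?_
      refine (PEq.adj hkj (i :: j :: T)).trans ?_
      refine (((PEq.adj hij.symm T).cons k).cons j).trans ?_
      exact (PEq.far hik.symm _).cons j
    · refine y2.trans (((c.cons j).cons k).trans ((((g.cons i).cons j).cons k).trans ?_))
      refine ((PEq.adj hij.symm (k :: T)).cons k).trans ?_
      refine (PEq.far hik.symm _).trans ?_
      refine ((((PEq.far hik T).cons j).cons k).cons i).trans ?_
      exact (PEq.adj hkj (i :: T)).cons i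

theorem R.trans_gen {N : ℕ}
    (K : ∀ i X j Y, X.length < N → PEq (i :: X) (j :: Y) → R i X j Y)
    {i X k W j Y} (hX : X.length = N) (hY : Y.length = N)
    (h1 : R i X k W) (h2 : R k W j Y) : R i X j Y := by
  rcases tri i k with rfl | hik | hik
  · have e := h1.same
    rcases h2 with ⟨rfl, h⟩ | ⟨h, Z, a, b⟩ | ⟨h, Z, a, b⟩
    · exact Or.inl ⟨rfl, e.trans h⟩
    · exact Or.inr (Or.inl ⟨h, Z, e.trans a, b⟩)
    · exact Or.inr (Or.inr ⟨h, Z, e.trans a, b⟩)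
  all_goals
    rcases tri k j with rfl | hkj | hkj
    · have e := h2.same
      rcases h1 with ⟨rfl, h⟩ | ⟨h, Z, a, b⟩ | ⟨h, Z, a, b⟩
      · exact Or.inl ⟨rfl, h.trans e⟩
      · exact Or.inr (Or.inl ⟨h, Z, a, e.symm.trans b⟩)
      · exact Or.inr (Or.inr ⟨h, Z, a, e.symm.trans b⟩)
  · obtain ⟨Z, x1, w1⟩ := h1.far hik
    obtain ⟨Z', w2, y2⟩ := h2.far hkj
    have lZ := x1.length_eq
    simp only [List.length_cons] at lZ
    have K1 := K i Z j Z' (by omega) (w1.symm.trans w2)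
    rcases tri i j with rfl | hij | hij
    · exact Or.inl ⟨rfl, x1.trans ((K1.same.cons k).trans y2.symm)⟩
    · obtain ⟨U, a, b⟩ := K1.far hij
      refine Or.inr (Or.inl ⟨hij, k :: U, ?_, ?_⟩)
      · exact x1.trans ((a.cons k).trans (PEq.far hkj _))
      · exact y2.trans ((b.cons k).trans (PEq.far hik.symm _))
    · obtain ⟨U, a, b⟩ := K1.adj hij
      refine Or.inr (Or.inr ⟨hij, k :: U, ?_, ?_⟩)
      · exact x1.trans ((a.cons k).trans ((PEq.far hkj _).trans
          ((PEq.far hik.symm _).cons j)))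
      · exact y2.trans ((b.cons k).trans ((PEq.far hik.symm _).trans
          ((PEq.far hkj _).cons i)))
  · exact R.trans_mixed K hX hik hkj h1 h2
  · exact (R.trans_mixed K hY hkj.symm hik.symm h2.symm h1.symm).symm
  · obtain ⟨Z, x1, w1⟩ := h1.adj hik
    obtain ⟨Z', w2, y2⟩ := h2.adj hkj
    have lX := x1.length_eq
    have lY := y2.length_eq
    simp only [List.length_cons] at lX lY
    have K1 := K i (k :: Z) j (k :: Z') (by simp; omega) (w1.symm.trans w2)
    rcases tri i j with rfl | hij | hij
    · have K2 := K k Z k Z' (by omega) K1.same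
      exact Or.inl ⟨rfl, x1.trans (((K2.same.cons i).cons k).trans y2.symm)⟩
    · obtain ⟨U, a, b⟩ := K1.far hij
      have la := a.length_eq
      simp only [List.length_cons] at la
      obtain ⟨V, c, d⟩ := (K k Z j U (by omega) a).adj hkj
      obtain ⟨V', c', d'⟩ := (K k Z' i U (by omega) b).adj hik.symm
      have ld := d.length_eq
      simp only [List.length_cons] at ld
      have e1 := (K k (j :: V) k (i :: V') (by simp; omega) (d.symm.trans d')).same
      obtain ⟨T, f, g⟩ := (K j V i V' (by omega) e1).far hij.symm
      refine Or.inr (Or.inl ⟨hij, k :: j :: i :: k :: T, ?_, ?_⟩)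
      · refine x1.trans (((c.cons i).cons k).trans (((((f.cons k).cons j).cons i).cons k).trans ?_))
        refine ((PEq.far hij (k :: i :: T)).cons k).trans ?_
        refine (((PEq.adj hik T).cons j).cons k).trans ?_
        exact PEq.adj hkj _
      · refine y2.trans (((c'.cons j).cons k).trans
          (((((g.cons k).cons i).cons j).cons k).trans ?_))
        refine ((PEq.far hij.symm (k :: j :: T)).cons k).trans ?_
        refine (((PEq.adj hkj.symm T).cons i).cons k).trans ?_
        refine (PEq.adj hik.symm _).trans ?_
        exact ((PEq.far hij (k :: T)).cons k).cons i
    · unfold Adj at hik hkj hij; omega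

/-- Garside's key lemma, with a bound on the length. -/
theorem key_aux (N : ℕ) :
    ∀ i X j Y, X.length < N → PEq (i :: X) (j :: Y) → R i X j Y := by
  induction N with
  | zero => intro i X j Y h; omega
  | succ N IH =>
    have main : ∀ u v, PEq u v → u.length = N + 1 →
        ∀ i X j Y, u = i :: X → v = j :: Y → R i X j Y := by
      intro u v h
      induction h with
      | refl u =>
        rintro - i X j Y rfl h
        obtain ⟨rfl, rfl⟩ := List.cons.inj h
        exact Or.inl ⟨rfl, refl _⟩
      | symm h ih =>
        intro hl i X j Y h1 h2
        exact (ih (h.length_eq.trans hl) j Y i X h2 h1).symm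
      | @trans u v w huv hvw ih1 ih2 =>
        rintro hl i X j Y rfl rfl
        have l1 := huv.length_eq
        have l2 := hvw.length_eq
        cases v with
        | nil => simp at l1
        | cons k W =>
          simp only [List.length_cons] at hl l1 l2
          exact R.trans_gen IH (by omega) (by omega) (ih1 (by simpa using hl) i X k W rfl rfl)
            (ih2 (by simp; omega) k W j Y rfl rfl)
      | cons a h ih =>
        rintro - i X j Y h1 h2
        obtain ⟨rfl, rfl⟩ := List.cons.inj h1
        obtain ⟨rfl, rfl⟩ := List.cons.inj h2
        exact Or.inl ⟨rfl, h⟩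
      | comm a b w h =>
        rintro - i X j Y h1 h2
        obtain ⟨rfl, rfl⟩ := List.cons.inj h1
        obtain ⟨rfl, rfl⟩ := List.cons.inj h2
        exact Or.inr (Or.inl ⟨Or.inl h, w, refl _, refl _⟩)
      | braid a w =>
        rintro - i X j Y h1 h2
        obtain ⟨rfl, rfl⟩ := List.cons.inj h1
        obtain ⟨rfl, rfl⟩ := List.cons.inj h2
        exact Or.inr (Or.inr ⟨Or.inl rfl, w, refl _, refl _⟩)
    intro i X j Y hl h
    rcases Nat.lt_succ_iff_lt_or_eq.mp hl with h' | h'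
    · exact IH i X j Y h' h
    · exact main _ _ h (by simp [h']) i X j Y rfl rfl

theorem key {i X j Y} (h : PEq (i :: X) (j :: Y)) : R i X j Y :=
  key_aux _ i X j Y (Nat.lt_succ_self _) h

theorem cancel_left (w) {u v} (h : PEq (w ++ u) (w ++ v)) : PEq u v := by
  induction w with
  | nil => exact h
  | cons a w ih => exact ih (key h).same

theorem cancel_right (w) {u v} (h : PEq (u ++ w) (v ++ w)) : PEq u v := by
  have := h.reverse
  simp only [List.reverse_append] at this
  simpa using (cancel_left _ this).reverse

end PEq

/-- The congruence on words. -/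
def pcon : Con (FreeMonoid ℕ) where
  r u v := PEq (FreeMonoid.toList u) (FreeMonoid.toList v)
  iseqv := ⟨fun _ => PEq.refl _, fun h => h.symm, fun h g => h.trans g⟩
  mul' := fun {a b c d} h g => by
    rw [FreeMonoid.toList_mul, FreeMonoid.toList_mul]
    exact (h.append_right _).trans (g.append_left _)

/-- The positive braid monoid on infinitely many strands. -/
abbrev PM : Type := pcon.Quotient

namespace PM

/-- The class of a word. -/
def mk (l : List ℕ) : PM := ((FreeMonoid.ofList l : FreeMonoid ℕ) : pcon.Quotient)

theorem mk_eq {u v : List ℕ} : mk u = mk v ↔ PEq u v := by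
  unfold mk
  rw [Con.eq]
  rfl

theorem mk_surj (X : PM) : ∃ l, mk l = X := by
  induction X using Con.induction_on with
  | H x => exact ⟨FreeMonoid.toList x, rfl⟩

theorem mk_append (u v : List ℕ) : mk (u ++ v) = mk u * mk v := rfl

theorem mk_nil : mk [] = 1 := rfl

/-- Generators. -/
def s (i : ℕ) : PM := mk [i]

theorem mk_cons (i) (u : List ℕ) : mk (i :: u) = s i * mk u := rfl

theorem lcancelP {a b c : PM} (h : a * b = a * c) : b = c := by
  obtain ⟨a, rfl⟩ := mk_surj a
  obtain ⟨b, rfl⟩ := mk_surj b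
  obtain ⟨c, rfl⟩ := mk_surj c
  rw [← mk_append, ← mk_append, mk_eq] at h
  exact mk_eq.2 (PEq.cancel_left _ h)

theorem rcancelP {a b c : PM} (h : b * a = c * a) : b = c := by
  obtain ⟨a, rfl⟩ := mk_surj a
  obtain ⟨b, rfl⟩ := mk_surj b
  obtain ⟨c, rfl⟩ := mk_surj c
  rw [← mk_append, ← mk_append, mk_eq] at h
  exact mk_eq.2 (PEq.cancel_right _ h)

theorem s_far {i j : ℕ} (h : PEq.Far i j) : s i * s j = s j * s i :=
  mk_eq.2 (PEq.far h [])

theorem s_adj {i j : ℕ} (h : PEq.Adj i j) : s i * s j * s i = s j * s i * s j :=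
  mk_eq.2 (PEq.adj h [])

theorem key_far {i j : ℕ} (h : PEq.Far i j) {X Y : PM} (e : s i * X = s j * Y) :
    ∃ Z, X = s j * Z ∧ Y = s i * Z := by
  obtain ⟨X, rfl⟩ := mk_surj X
  obtain ⟨Y, rfl⟩ := mk_surj Y
  rw [← mk_cons, ← mk_cons, mk_eq] at e
  obtain ⟨Z, a, b⟩ := (PEq.key e).far h
  exact ⟨mk Z, mk_eq.2 a, mk_eq.2 b⟩

theorem key_adj {i j : ℕ} (h : PEq.Adj i j) {X Y : PM} (e : s i * X = s j * Y) :
    ∃ Z, X = s j * (s i * Z) ∧ Y = s i * (s j * Z) := by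
  obtain ⟨X, rfl⟩ := mk_surj X
  obtain ⟨Y, rfl⟩ := mk_surj Y
  rw [← mk_cons, ← mk_cons, mk_eq] at e
  obtain ⟨Z, a, b⟩ := (PEq.key e).adj h
  exact ⟨mk Z, mk_eq.2 a, mk_eq.2 b⟩

theorem s_inj {i j : ℕ} (h : s i = s j) : i = j := by
  have := (mk_eq.1 h).mem_iff i
  simpa using this

/-- Only letters below `m` occur. -/
def Lt (m : ℕ) (X : PM) : Prop := ∃ l, mk l = X ∧ ∀ x ∈ l, x < m

theorem Lt.all {m : ℕ} {l : List ℕ} (h : Lt m (mk l)) : ∀ x ∈ l, x < m := by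
  obtain ⟨l', e, h⟩ := h
  intro x hx
  exact h x (((mk_eq.1 e).mem_iff x).2 hx)

theorem Lt.mul_iff {m : ℕ} {X Y : PM} : Lt m (X * Y) ↔ Lt m X ∧ Lt m Y := by
  obtain ⟨u, rfl⟩ := mk_surj X
  obtain ⟨v, rfl⟩ := mk_surj Y
  constructor
  · intro h
    have := Lt.all (l := u ++ v) h
    exact ⟨⟨u, rfl, fun x hx => this x (by simp [hx])⟩, ⟨v, rfl, fun x hx => this x (by simp [hx])⟩⟩
  · rintro ⟨h, g⟩
    refine ⟨u ++ v, rfl, fun x hx => ?_⟩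
    rcases List.mem_append.1 hx with hx | hx
    · exact h.all x hx
    · exact g.all x hx

theorem lt_s {m i : ℕ} : Lt m (s i) ↔ i < m :=
  ⟨fun h => Lt.all (l := [i]) h i (by simp), fun h => ⟨[i], rfl, by simpa using h⟩⟩

theorem lt_one {m : ℕ} : Lt m 1 := ⟨[], rfl, by simp⟩

/-- Induction on elements with letters below `m`. -/
theorem lt_ind {m : ℕ} {p : PM → Prop} (one : p 1) (mul : ∀ i X, i < m → Lt m X → p X → p (s i * X))
    {X : PM} (h : Lt m X) : p X := by
  obtain ⟨l, rfl⟩ := mk_surj X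
  have h := h.all
  induction l with
  | nil => exact one
  | cons a l ih =>
    rw [mk_cons]
    have hl : ∀ x ∈ l, x < m := fun x hx => h x (by simp [hx])
    exact mul a (mk l) (h a (by simp)) ⟨l, rfl, hl⟩ (ih ⟨l, rfl, hl⟩ hl)

/-- `σ_{k-1} ⋯ σ_0` as a word. -/
def dl : ℕ → List ℕ
  | 0 => []
  | k + 1 => k :: dl k

/-- The half twist as a word, `D k` using the letters `0, …, k - 1`. -/
def Dl : ℕ → List ℕ
  | 0 => []
  | k + 1 => Dl k ++ dl (k + 1)

/-- `σ_{k-1} ⋯ σ_0`. -/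
def d (k : ℕ) : PM := mk (dl k)
/-- The half twist. -/
def D (k : ℕ) : PM := mk (Dl k)

theorem d_zero : d 0 = 1 := rfl
theorem D_zero : D 0 = 1 := rfl
theorem d_succ (k) : d (k + 1) = s k * d k := rfl
theorem D_succ (k) : D (k + 1) = D k * d (k + 1) := rfl

theorem lt_mono {m n : ℕ} (h : m ≤ n) {X : PM} (hX : Lt m X) : Lt n X := by
  obtain ⟨l, e, hl⟩ := hX
  exact ⟨l, e, fun x hx => (hl x hx).trans_le h⟩

theorem lt_d (k) : Lt k (d k) := by
  induction k with
  | zero => exact lt_one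
  | succ k ih =>
    rw [d_succ, Lt.mul_iff]
    exact ⟨lt_s.2 (by omega), lt_mono (by omega) ih⟩

theorem lt_D (k) : Lt k (D k) := by
  induction k with
  | zero => exact lt_one
  | succ k ih =>
    rw [D_succ, Lt.mul_iff]
    exact ⟨lt_mono (by omega) ih, lt_d _⟩

/-- A letter far from everything commutes. -/
theorem comm_of_lt {m k : ℕ} (h : m < k) {X : PM} (hX : Lt m X) : s k * X = X * s k := by
  refine lt_ind (p := fun X => s k * X = X * s k) (by simp) ?_ hX
  intro i X hi _ ih
  rw [← mul_assoc, s_far (Or.inr (by omega)), mul_assoc, ih, mul_assoc]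

/-- If a far letter divides a product it divides the second factor. -/
theorem dvd_of_lt {m k : ℕ} (h : m < k) {X : PM} (hX : Lt m X) :
    ∀ Q, s k ∣ X * Q → s k ∣ Q := by
  refine lt_ind (p := fun X => ∀ Q, s k ∣ X * Q → s k ∣ Q) (by simp) ?_ hX
  rintro i X hi _ ih Q ⟨Z, hZ⟩
  rw [mul_assoc] at hZ
  obtain ⟨U, a, b⟩ := key_far (Or.inl (by omega)) hZ
  exact ih Q ⟨U, a⟩

theorem d_dvd (k : ℕ) : ∀ Q, s k ∣ d k * Q → d (k + 1) ∣ Q := by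
  induction k with
  | zero => intro Q h; simpa [d_succ, d_zero] using h
  | succ k ih =>
    rintro Q ⟨Z, hZ⟩
    rw [d_succ k, mul_assoc] at hZ
    obtain ⟨U, a, b⟩ := key_adj (Or.inl rfl) hZ
    obtain ⟨Q1, rfl⟩ := dvd_of_lt (Nat.lt_succ_self k) (lt_d k) Q ⟨_, a⟩
    rw [← mul_assoc, ← comm_of_lt (Nat.lt_succ_self k) (lt_d k), mul_assoc] at a
    obtain ⟨Q2, rfl⟩ := ih Q1 ⟨_, lcancelP a⟩
    exact ⟨Q2, by rw [d_succ (k + 1), mul_assoc]⟩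

/-- Divisible by all generators implies divisible by the half twist. -/
theorem D_dvd (m : ℕ) (P : PM) (h : ∀ i < m, s i ∣ P) : D m ∣ P := by
  induction m with
  | zero => exact ⟨P, by simp [D_zero]⟩
  | succ k ih =>
    obtain ⟨Q, rfl⟩ := ih (fun i hi => h i (by omega))
    have h1 : s k ∣ d k * Q := by
      have := h k (by omega)
      cases k with
      | zero => simpa [D_zero, d_zero] using this
      | succ k =>
        rw [D_succ, mul_assoc] at this
        exact dvd_of_lt (Nat.lt_succ_self k) (lt_D k) _ this
    obtain ⟨T, rfl⟩ := d_dvd k Q h1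
    exact ⟨T, by rw [D_succ, mul_assoc]⟩

theorem s_d {j k : ℕ} (h : j + 1 < k) : s j * d k = d k * s (j + 1) := by
  induction k with
  | zero => omega
  | succ k ih =>
    rcases Nat.lt_succ_iff_lt_or_eq.mp h with h' | h'
    · rw [d_succ, ← mul_assoc, s_far (Or.inl h'), mul_assoc, ih h', mul_assoc]
    · subst h'
      rw [d_succ, d_succ, ← mul_assoc, ← mul_assoc, s_adj (Or.inl rfl), mul_assoc,
        comm_of_lt (Nat.lt_succ_self j) (lt_d j)]
      simp only [mul_assoc]

/-- `σ_k ⋯ σ_1`. -/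
def d1 : ℕ → PM
  | 0 => 1
  | k + 1 => s (k + 1) * d1 k

theorem d1_s (k) : d1 k * s 0 = d (k + 1) := by
  induction k with
  | zero => simp [d1, d_succ, d_zero]
  | succ k ih => rw [d1, mul_assoc, ih, d_succ (k + 1)]

theorem d_d1 {j k : ℕ} (h : j < k) : d j * d k = d k * d1 j := by
  induction j with
  | zero => simp [d1, d_zero]
  | succ j ih =>
    rw [d_succ, mul_assoc, ih (by omega), ← mul_assoc, s_d h, d1, mul_assoc]

theorem d_d (k : ℕ) : d k * d (k + 1) * s 0 = d (k + 1) * d (k + 1) := by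
  rw [d_d1 (Nat.lt_succ_self k), mul_assoc, d1_s]

/-- Conjugation by the half twist. -/
theorem s_D {i k : ℕ} (h : i < k) : s i * D k = D k * s (k - 1 - i) := by
  induction k generalizing i with
  | zero => omega
  | succ k ih =>
    rcases Nat.lt_succ_iff_lt_or_eq.mp h with h' | h'
    · rw [D_succ, ← mul_assoc, ih h', mul_assoc, s_d (by omega), ← mul_assoc]
      congr 2
      omega
    · subst h'
      have : i + 1 - 1 - i = 0 := by omega
      rw [this]
      cases i with
      | zero => simp [D_succ, D_zero, d_succ, d_zero]
      | succ k =>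
        have e : s (k + 1) * D k = D k * s (k + 1) := comm_of_lt (Nat.lt_succ_self k) (lt_D k)
        calc s (k + 1) * D (k + 1 + 1) = (s (k + 1) * D k) * (d (k + 1) * d (k + 1 + 1)) := by
              rw [D_succ, D_succ]; simp only [mul_assoc]
          _ = D k * (d (k + 1 + 1) * d (k + 1 + 1)) := by
              rw [e, d_succ (k + 1)]; simp only [mul_assoc]
          _ = _ := by
              rw [← d_d, D_succ, D_succ]; simp only [mul_assoc]

theorem s_dvd_D {i k : ℕ} (h : i < k) : s i ∣ D k := by
  induction k with
  | zero => omega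
  | succ k ih =>
    rcases Nat.lt_succ_iff_lt_or_eq.mp h with h' | h'
    · exact (ih h').trans ⟨_, D_succ k⟩
    · subst h'
      have e := s_D (Nat.lt_succ_self i)
      have : i.succ - 1 - i = 0 := by omega
      rw [this] at e
      have f : D (i + 1) = D i * d1 i * s 0 := by rw [mul_assoc, d1_s, D_succ]
      refine ⟨D i * d1 i, rcancelP (a := s 0) ?_⟩
      rw [← e, mul_assoc, ← f]

theorem comm_D2 {m : ℕ} {X : PM} (h : Lt m X) : X * D m ^ 2 = D m ^ 2 * X := by
  refine lt_ind (p := fun X => X * D m ^ 2 = D m ^ 2 * X) (by simp) ?_ h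
  intro i X hi _ ih
  have : s i * D m ^ 2 = D m ^ 2 * s i := by
    rw [pow_two, ← mul_assoc, s_D hi, mul_assoc, s_D (by omega), ← mul_assoc]
    congr 2
    omega
  rw [mul_assoc, ih, ← mul_assoc, this, mul_assoc]

theorem comm_D2k {m : ℕ} {X : PM} (h : Lt m X) (k : ℕ) :
    X * (D m ^ 2) ^ k = (D m ^ 2) ^ k * X :=
  (Commute.pow_right (comm_D2 h : Commute X (D m ^ 2)) k)

theorem D2_right {i m : ℕ} (h : i < m) : ∃ y, D m ^ 2 = y * s i := by
  obtain ⟨u, hu⟩ := s_dvd_D h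
  refine ⟨u * D m, ?_⟩
  apply lcancelP (a := s i)
  rw [comm_D2 (lt_s.2 h), ← mul_assoc, ← mul_assoc, ← hu, pow_two]

theorem exists_D2k {m : ℕ} {b : PM} (h : Lt m b) : ∃ k y, (D m ^ 2) ^ k = y * b := by
  refine lt_ind (p := fun b => ∃ k y, (D m ^ 2) ^ k = y * b) ⟨0, 1, by simp⟩ ?_ h
  rintro i b hi hb ⟨k, y, e⟩
  obtain ⟨z, hz⟩ := D2_right hi
  refine ⟨k + 1, y * z, ?_⟩
  calc (D m ^ 2) ^ (k + 1) = y * b * D m ^ 2 := by rw [pow_succ, e]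
    _ = y * (D m ^ 2 * b) := by rw [mul_assoc, comm_D2 hb]
    _ = _ := by rw [hz]; simp only [mul_assoc]

theorem exists_lt (X : PM) : ∃ m, Lt m X := by
  obtain ⟨l, rfl⟩ := mk_surj X
  refine ⟨l.sum + 1, l, rfl, fun x hx => ?_⟩
  have := List.single_le_sum (l := l) (by simp) x hx
  omega

theorem ore (a b : PM) : ∃ x y : PM, x * a = y * b := by
  obtain ⟨m, hm⟩ := exists_lt (a * b)
  rw [Lt.mul_iff] at hm
  obtain ⟨k, y, e⟩ := exists_D2k hm.2
  exact ⟨(D m ^ 2) ^ k, a * y, by rw [← comm_D2k hm.1, e, mul_assoc]⟩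

noncomputable instance : OreLocalization.OreSet (⊤ : Submonoid PM) where
  ore_right_cancel r₁ r₂ t h := ⟨1, by rw [rcancelP h]⟩
  oreNum a b := (ore a b).choose_spec.choose
  oreDenom a b := ⟨(ore a b).choose, trivial⟩
  ore_eq a b := (ore a b).choose_spec.choose_spec

/-- The group of fractions. -/
abbrev GG : Type := (OreLocalization (⊤ : Submonoid PM) PM)ˣ

/-- The embedding in the group of fractions. -/
noncomputable def toGG (X : PM) : GG := OreLocalization.numeratorUnit (⟨X, trivial⟩ : (⊤ : Submonoid PM))

theorem toGG_val (X : PM) : ((toGG X : GG) : OreLocalization (⊤ : Submonoid PM) PM) =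
    OreLocalization.numeratorHom X := rfl

theorem toGG_mul (X Y : PM) : toGG (X * Y) = toGG X * toGG Y := by
  ext
  rw [Units.val_mul, toGG_val, toGG_val, toGG_val, map_mul]

theorem toGG_one : toGG 1 = 1 := by
  ext
  rw [toGG_val, map_one, Units.val_one]

theorem toGG_inj {X Y : PM} (h : toGG X = toGG Y) : X = Y := by
  have := congrArg Units.val h
  rw [toGG_val, toGG_val, OreLocalization.numeratorHom_apply, OreLocalization.numeratorHom_apply,
    OreLocalization.oreDiv_eq_iff] at this
  obtain ⟨u, v, h1, h2⟩ := this
  simp only [OneMemClass.coe_one, mul_one] at h2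
  have h1 : (u : PM) * Y = v * X := h1
  rw [h2] at h1
  exact (lcancelP h1).symm

/-- The key divisibility step for quasi-central elements. -/
theorem quasi_step {m : ℕ} {W : PM} {π : ℕ → ℕ} (h : ∀ i < m, s i * W = W * s (π i))
    {i j : ℕ} (hi : i < m) (hj : j < m) (hij : PEq.Adj i j) (hd : s i ∣ W) : s j ∣ W := by
  obtain ⟨R, rfl⟩ := hd
  have e := h j hj
  rw [mul_assoc] at e
  obtain ⟨Z, a, b⟩ := key_adj hij.symm e
  have b' : R = s j * Z := lcancelP a
  have f := h i hi
  rw [mul_assoc] at f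
  have f := lcancelP f
  exact ⟨Z * s (π i), by rw [f, b', mul_assoc]⟩

theorem quasi_all {m : ℕ} {W : PM} {π : ℕ → ℕ} (h : ∀ i < m, s i * W = W * s (π i))
    {i : ℕ} (hi : i < m) (hd : s i ∣ W) : ∀ j < m, s j ∣ W := by
  have h0 : ∀ i < m, s i ∣ W → s 0 ∣ W := by
    intro i
    induction i with
    | zero => intro _ h; exact h
    | succ i ih =>
      intro hi hd
      exact ih (by omega) (quasi_step h hi (by omega) (Or.inr rfl) hd)
  have h0 := h0 i hi hd
  intro j
  induction j with
  | zero => intro _; exact h0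
  | succ j ih => intro hj; exact quasi_step h (by omega) hj (Or.inl rfl) (ih (by omega))

theorem quasi_central {m : ℕ} (hm : 0 < m) (N : ℕ) : ∀ (l : List ℕ) (π : ℕ → ℕ), l.length ≤ N →
    Lt m (mk l) → (∀ i < m, s i * mk l = mk l * s (π i)) → ∃ j, mk l = D m ^ j := by
  induction N with
  | zero =>
    intro l π hl _ _
    have : l = [] := by simpa using hl
    subst this
    exact ⟨0, by simp [mk_nil]⟩
  | succ N ih =>
    intro l π hl hlt h
    cases l with
    | nil => exact ⟨0, by simp [mk_nil]⟩
    | cons a l =>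
      have ha : a < m := hlt.all a (by simp)
      obtain ⟨W, hW⟩ := D_dvd m _ (quasi_all h ha ⟨mk l, rfl⟩)
      obtain ⟨w, rfl⟩ := mk_surj W
      have hlen : (a :: l).length = (Dl m ++ w).length := (mk_eq.1 hW).length_eq
      have hD : 0 < (Dl m).length := by
        cases m with
        | zero => omega
        | succ m => simp [Dl, dl]
      rw [List.length_append] at hlen
      rw [hW] at hlt h
      obtain ⟨j, hj⟩ := ih w (fun i => π (m - 1 - i)) (by omega) (Lt.mul_iff.1 hlt).2 (by
        intro i hi
        have e := h (m - 1 - i) (by omega)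
        rw [← mul_assoc, s_D (by omega), mul_assoc, mul_assoc] at e
        have : m - 1 - (m - 1 - i) = i := by omega
        rw [this] at e
        exact lcancelP e)
      exact ⟨j + 1, by rw [hW, hj, pow_succ']⟩

theorem central {m : ℕ} (hm : 1 < m) (l : List ℕ) (hlt : Lt m (mk l))
    (h : ∀ i < m, s i * mk l = mk l * s i) : ∃ j, mk l = (D m ^ 2) ^ j := by
  obtain ⟨j, hj⟩ := quasi_central (by omega) _ l id le_rfl hlt h
  rcases Nat.even_or_odd' j with ⟨k, rfl | rfl⟩
  · exact ⟨k, by rw [hj, pow_mul]⟩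
  · exfalso
    have e := h 0 (by omega)
    rw [hj, pow_succ, pow_mul, ← mul_assoc, comm_D2k (lt_s.2 (by omega)), mul_assoc,
      s_D (by omega), ← mul_assoc] at e
    have := s_inj (lcancelP e)
    omega

end PM

/-- Evaluation of a positive word in the braid group. -/
def evalB (n : ℕ) (l : List ℕ) : BraidGroup n := (l.map (sigmaN n)).prod

theorem evalB_append (n : ℕ) (u v : List ℕ) : evalB n (u ++ v) = evalB n u * evalB n v := by
  simp [evalB]

theorem evalB_cons (n : ℕ) (a) (v : List ℕ) : evalB n (a :: v) = sigmaN n a * evalB n v := by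
  simp [evalB]

theorem sigmaN_comm {n i j : ℕ} (h : i + 1 < j) (hj : j < n - 1) :
    sigmaN n i * sigmaN n j = sigmaN n j * sigmaN n i := by
  have hi : i < n - 1 := by omega
  rw [sigmaN, sigmaN, dif_pos hi, dif_pos hj]
  rw [← mul_inv_eq_one]
  exact PresentedGroup.one_of_mem (Or.inl ⟨⟨i, hi⟩, ⟨j, hj⟩, h, rfl⟩)

theorem sigmaN_braid {n i : ℕ} (hj : i + 1 < n - 1) :
    sigmaN n i * sigmaN n (i + 1) * sigmaN n i =
      sigmaN n (i + 1) * sigmaN n i * sigmaN n (i + 1) := by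
  have hi : i < n - 1 := by omega
  rw [sigmaN, sigmaN, dif_pos hi, dif_pos hj]
  rw [← mul_inv_eq_one]
  exact PresentedGroup.one_of_mem (Or.inr ⟨⟨i, hi⟩, ⟨i + 1, hj⟩, rfl, rfl⟩)

theorem evalB_eq {n : ℕ} {u v : List ℕ} (h : PEq u v) (hu : ∀ x ∈ u, x < n - 1) :
    evalB n u = evalB n v := by
  induction h with
  | refl => rfl
  | symm h ih => exact (ih (fun x hx => hu x ((h.mem_iff x).1 hx))).symm
  | trans h1 h2 ih1 ih2 => exact (ih1 hu).trans (ih2 (fun x hx => hu x ((h1.mem_iff x).2 hx)))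
  | cons a h ih =>
    rw [evalB_cons, evalB_cons, ih (fun x hx => hu x (by simp [hx]))]
  | comm i j w h =>
    simp only [evalB_cons, ← mul_assoc]
    rw [sigmaN_comm h (hu j (by simp))]
  | braid i w =>
    simp only [evalB_cons, ← mul_assoc]
    rw [sigmaN_braid (hu (i + 1) (by simp))]

/-- The map to the group of fractions. -/
noncomputable def toFrac (n : ℕ) : BraidGroup n →* PM.GG :=
  PresentedGroup.toGroup (f := fun i : Fin (n - 1) => PM.toGG (PM.s i)) (by
    rintro r (⟨i, j, h, rfl⟩ | ⟨i, j, h, rfl⟩)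
    · rw [map_mul, map_inv, mul_inv_eq_one]
      simp only [map_mul, FreeGroup.lift_apply_of, ← PM.toGG_mul]
      rw [PM.s_far (Or.inl h)]
    · rw [map_mul, map_inv, mul_inv_eq_one]
      simp only [map_mul, FreeGroup.lift_apply_of, ← PM.toGG_mul]
      rw [PM.s_adj (Or.inl h.symm)])

theorem toFrac_evalB {n : ℕ} {u : List ℕ} (hu : ∀ x ∈ u, x < n - 1) :
    toFrac n (evalB n u) = PM.toGG (PM.mk u) := by
  induction u with
  | nil => rw [PM.mk_nil, PM.toGG_one]; simp [evalB]
  | cons a u ih =>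
    rw [evalB_cons, map_mul, ih (fun x hx => hu x (by simp [hx])), PM.mk_cons, PM.toGG_mul]
    congr 1
    rw [sigmaN, dif_pos (hu a (by simp))]
    exact PresentedGroup.toGroup.of _

theorem mk_eq_of_evalB {n : ℕ} {u v : List ℕ} (hu : ∀ x ∈ u, x < n - 1)
    (hv : ∀ x ∈ v, x < n - 1) (h : evalB n u = evalB n v) : PM.mk u = PM.mk v := by
  apply PM.toGG_inj
  rw [← toFrac_evalB hu, ← toFrac_evalB hv, h]

theorem evalB_of_mk {n : ℕ} {u v : List ℕ} (hu : ∀ x ∈ u, x < n - 1)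
    (h : PM.mk u = PM.mk v) : evalB n u = evalB n v :=
  evalB_eq (PM.mk_eq.1 h) hu

theorem dl_eq (k : ℕ) : PM.dl k = (List.range k).reverse := by
  induction k with
  | zero => rfl
  | succ k ih => rw [PM.dl, ih, List.range_succ]; simp

theorem evalB_dl (n k : ℕ) : evalB n (PM.dl (k + 1)) = descRun n k := by
  rw [dl_eq]; rfl

theorem evalB_Dl (n m : ℕ) : evalB n (PM.Dl m) = ((List.range m).map (descRun n)).prod := by
  induction m with
  | zero => rfl
  | succ m ih => rw [PM.Dl, evalB_append, ih, evalB_dl, List.range_succ]; simp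

theorem halfTwist_eq (n : ℕ) : halfTwist n = evalB n (PM.Dl (n - 1)) := (evalB_Dl n _).symm

theorem Dl_lt (m : ℕ) : ∀ x ∈ PM.Dl m, x < m := (PM.lt_D m).all

/-- The word for `Δ^{2k}`. -/
def D2l (m : ℕ) : ℕ → List ℕ
  | 0 => []
  | k + 1 => D2l m k ++ (PM.Dl m ++ PM.Dl m)

theorem mk_D2l (m k : ℕ) : PM.mk (D2l m k) = (PM.D m ^ 2) ^ k := by
  induction k with
  | zero => rfl
  | succ k ih => rw [D2l, PM.mk_append, ih, PM.mk_append, pow_succ _ k, pow_two]; rfl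

theorem evalB_D2l (n k : ℕ) : evalB n (D2l (n - 1) k) = (halfTwist n ^ 2) ^ k := by
  induction k with
  | zero => simp [evalB, D2l]
  | succ k ih => rw [D2l, evalB_append, ih, evalB_append, pow_succ _ k, pow_two, halfTwist_eq]

theorem D2l_lt (m k : ℕ) : ∀ x ∈ D2l m k, x < m := by
  induction k with
  | zero => simp [D2l]
  | succ k ih =>
    intro x hx
    simp only [D2l, List.mem_append] at hx
    rcases hx with hx | hx | hx
    · exact ih x hx
    · exact Dl_lt m x hx
    · exact Dl_lt m x hx

theorem mem_closure_sigma (n : ℕ) (β : BraidGroup n) :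
    β ∈ Subgroup.closure (Set.range (braidGen n)) := by
  have : Subgroup.closure (Set.range (braidGen n)) = ⊤ :=
    PresentedGroup.closure_range_of (braidRels n)
  rw [this]; trivial

theorem evalB_single {n : ℕ} (i : Fin (n - 1)) : evalB n [(i : ℕ)] = braidGen n i := by
  simp [evalB, sigmaN]

theorem comm_full_gen (n : ℕ) (i : Fin (n - 1)) :
    braidGen n i * halfTwist n ^ 2 = halfTwist n ^ 2 * braidGen n i := by
  have e := evalB_D2l n 1
  rw [pow_one] at e
  rw [← e, ← evalB_single, ← evalB_append, ← evalB_append]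
  have hl := D2l_lt (n - 1) 1
  apply evalB_of_mk
  · intro x hx
    rcases List.mem_append.1 hx with hx | hx
    · have : x = i := by simpa using hx
      omega
    · exact hl x hx
  · rw [PM.mk_append, PM.mk_append, mk_D2l, pow_one]
    exact PM.comm_D2 (PM.lt_s.2 i.2)

theorem comm_full (n : ℕ) (β : BraidGroup n) : β * halfTwist n ^ 2 = halfTwist n ^ 2 * β := by
  induction mem_closure_sigma n β using Subgroup.closure_induction with
  | mem x hx => obtain ⟨i, rfl⟩ := hx; exact comm_full_gen n i
  | one => simp
  | mul x y _ _ hx hy => exact (Commute.mul_left hx hy : Commute _ _)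
  | inv x _ hx => exact (Commute.inv_left hx : Commute _ _)

theorem gen_inv_pos (n : ℕ) (i : Fin (n - 1)) :
    ∃ u : List ℕ, (∀ x ∈ u, x < n - 1) ∧ (braidGen n i)⁻¹ * halfTwist n ^ 2 = evalB n u := by
  obtain ⟨U, hU⟩ := PM.s_dvd_D i.2
  obtain ⟨u, rfl⟩ := PM.mk_surj U
  have hlt : PM.Lt (n - 1) (PM.mk u) := by
    have := PM.lt_D (n - 1)
    rw [hU, PM.Lt.mul_iff] at this
    exact this.2
  have e : evalB n (PM.Dl (n - 1)) = evalB n ((i : ℕ) :: u) :=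
    evalB_of_mk (Dl_lt _) hU
  refine ⟨u ++ PM.Dl (n - 1), ?_, ?_⟩
  · intro x hx
    rcases List.mem_append.1 hx with hx | hx
    · exact hlt.all x hx
    · exact Dl_lt _ x hx
  · rw [evalB_append, ← halfTwist_eq, inv_mul_eq_iff_eq_mul, ← mul_assoc, ← evalB_single,
      ← evalB_append, pow_two]
    congr 1
    rw [halfTwist_eq, e]
    rfl

theorem exists_pos (n : ℕ) (β : BraidGroup n) : ∃ (k : ℕ) (w : List ℕ), (∀ x ∈ w, x < n - 1) ∧
    β * (halfTwist n ^ 2) ^ k = evalB n w := by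
  induction mem_closure_sigma n β using Subgroup.closure_induction_left with
  | one => exact ⟨0, [], by simp, by simp [evalB]⟩
  | mul_left x hx y _ ih =>
    obtain ⟨i, rfl⟩ := hx
    obtain ⟨k, w, hw, e⟩ := ih
    refine ⟨k, (i : ℕ) :: w, ?_, ?_⟩
    · intro x hx
      rcases List.mem_cons.1 hx with rfl | hx
      · exact i.2
      · exact hw x hx
    · rw [mul_assoc, e, ← evalB_single, ← evalB_append]; rfl
  | inv_mul_cancel x hx y _ ih =>
    obtain ⟨i, rfl⟩ := hx
    obtain ⟨k, w, hw, e⟩ := ih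
    obtain ⟨u, hu, f⟩ := gen_inv_pos n i
    refine ⟨k + 1, u ++ w, ?_, ?_⟩
    · intro x hx
      rcases List.mem_append.1 hx with hx | hx
      · exact hu x hx
      · exact hw x hx
    · rw [evalB_append, ← e, ← f, pow_succ _ k, ← mul_assoc, comm_full]
      simp only [mul_assoc]
      rw [← mul_assoc (halfTwist n ^ 2), ← mul_assoc (halfTwist n ^ 2), ← comm_full n _⁻¹]
      simp only [mul_assoc]

/-- (Garside/Chow) For `n > 2`, the center of `Bₙ` is the cyclic subgroup generated by
the full twist `Δ²`. -/
theorem center_braidGroup (n : ℕ) (hn : 2 < n) (β : BraidGroup n) :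
    (∀ γ : BraidGroup n, β * γ = γ * β) ↔ ∃ k : ℤ, β = (halfTwist n ^ 2) ^ k := by
  constructor
  · intro h
    obtain ⟨k, w, hw, e⟩ := exists_pos n β
    have hc : ∀ γ, evalB n w * γ = γ * evalB n w := by
      intro γ
      rw [← e]
      have h2 : Commute γ (halfTwist n ^ 2) := comm_full n γ
      have h1 : Commute β γ := h γ
      exact (Commute.mul_left h1 (h2.pow_right k).symm)
    obtain ⟨j, hj⟩ := PM.central (m := n - 1) (by omega) w ⟨w, rfl, hw⟩ (by
      intro i hi
      have := hc (evalB n [i])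
      rw [← evalB_append, ← evalB_append] at this
      have h1 : ∀ x ∈ w ++ [i], x < n - 1 := by
        intro x hx
        rcases List.mem_append.1 hx with hx | hx
        · exact hw x hx
        · have : x = i := by simpa using hx
          omega
      exact (mk_eq_of_evalB h1 (fun x hx => h1 x (by
        simp only [List.mem_append] at hx ⊢; tauto)) this).symm)
    have f : evalB n w = (halfTwist n ^ 2) ^ j := by
      rw [← evalB_D2l]
      exact evalB_of_mk hw (hj.trans (mk_D2l _ _).symm)
    refine ⟨(j : ℤ) - k, ?_⟩
    rw [zpow_sub, zpow_natCast, zpow_natCast, ← f, ← e, mul_inv_cancel_right]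
  · rintro ⟨k, rfl⟩ γ
    have h2 : Commute γ (halfTwist n ^ 2) := comm_full n γ
    exact (h2.zpow_right k).symm
end

section
/- (Krammer, Bigelow) The braid group B_n is linear: there exists an injective group homomorphism ρ : B_n → GL_N(k), where k = ℚ(p,q) is the field of rational functions in two variables over ℚ (the fraction field of the polynomial ring ℚ[p,q]) and N = n(n−1)/2. -/
namespace LKB

/-! ### The Ore property of the positive monoid -/

section Ore
variable {n : ℕ}

/-- Generators with natural number indices. -/
def sg (n : ℕ) (i : ℕ) : BraidGroup n :=
  if h : i < n - 1 then braidGen n ⟨i, h⟩ else 1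

lemma gen_comm (i j : Fin (n - 1)) (h : (i : ℕ) + 1 < j) :
    braidGen n i * braidGen n j = braidGen n j * braidGen n i := by
  have : (PresentedGroup.mk (braidRels n))
      (FreeGroup.of i * FreeGroup.of j * (FreeGroup.of j * FreeGroup.of i)⁻¹) = 1 :=
    PresentedGroup.one_of_mem (Or.inl ⟨i, j, h, rfl⟩)
  rw [map_mul, map_inv, mul_inv_eq_one] at this
  simpa [braidGen, PresentedGroup.of] using this

lemma gen_braid (i j : Fin (n - 1)) (h : (j : ℕ) = i + 1) :
    braidGen n i * braidGen n j * braidGen n i =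
      braidGen n j * braidGen n i * braidGen n j := by
  have : (PresentedGroup.mk (braidRels n))
      (FreeGroup.of i * FreeGroup.of j * FreeGroup.of i *
              (FreeGroup.of j * FreeGroup.of i * FreeGroup.of j)⁻¹) = 1 :=
    PresentedGroup.one_of_mem (Or.inr ⟨i, j, h, rfl⟩)
  rw [map_mul, map_inv, mul_inv_eq_one] at this
  simpa [braidGen, PresentedGroup.of] using this

lemma sg_comm (i j : ℕ) (h : i + 1 < j) : sg n i * sg n j = sg n j * sg n i := by
  unfold sg
  split_ifs with h1 h2
  · exact gen_comm _ _ h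
  all_goals simp

lemma sg_braid (i : ℕ) (h : i + 1 < n - 1) :
    sg n i * sg n (i + 1) * sg n i = sg n (i + 1) * sg n i * sg n (i + 1) := by
  unfold sg
  rw [dif_pos h, dif_pos (by omega)]
  exact gen_braid _ _ rfl

/-- The element `σ_0 ⋯ σ_{m-1}`. -/
def dl (n : ℕ) : ℕ → BraidGroup n
  | 0 => 1
  | m + 1 => dl n m * sg n m

lemma dl_comm (m j : ℕ) (h : m < j) : dl n m * sg n j = sg n j * dl n m := by
  induction m with
  | zero => simp [dl]
  | succ m ih =>
    rw [dl, mul_assoc, sg_comm m j (by omega), ← mul_assoc, ih (by omega), mul_assoc]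

lemma dl_shift (m i : ℕ) (hm : m ≤ n - 1) (h : i + 1 < m) :
    dl n m * sg n i = sg n (i + 1) * dl n m := by
  induction m with
  | zero => omega
  | succ m ih =>
    rcases Nat.lt_or_ge (i + 1) m with h1 | h1
    · rw [dl, mul_assoc, ← sg_comm i m h1, ← mul_assoc, ih (by omega) h1, mul_assoc]
    · obtain rfl : m = i + 1 := by omega
      rw [dl, dl]
      calc dl n i * sg n i * sg n (i + 1) * sg n i
          = dl n i * (sg n i * sg n (i + 1) * sg n i) := by group
        _ = dl n i * sg n (i + 1) * sg n i * sg n (i + 1) := by rw [sg_braid i (by omega)]; group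
        _ = _ := by rw [dl_comm i (i + 1) (by omega)]; group

lemma dl_shift_pow (k i : ℕ) (h : i + k < n - 1) :
    dl n (n - 1) ^ k * sg n i = sg n (i + k) * dl n (n - 1) ^ k := by
  induction k with
  | zero => simp
  | succ k ih =>
    rw [pow_succ', mul_assoc, ih (by omega), ← mul_assoc,
      dl_shift (n - 1) (i + k) le_rfl (by omega), mul_assoc]
    rfl

/-- `σ_1 ⋯ σ_m` -/
def dl' (n : ℕ) : ℕ → BraidGroup n
  | 0 => 1
  | m + 1 => dl' n m * sg n (m + 1)

lemma dl_succ' (m : ℕ) : dl n (m + 1) = sg n 0 * dl' n m := by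
  induction m with
  | zero => simp [dl, dl']
  | succ m ih => rw [dl, ih, dl', mul_assoc]

lemma dl_mul_dl (m : ℕ) (h : m + 1 ≤ n - 1) :
    dl n (n - 1) * dl n m = dl' n m * dl n (n - 1) := by
  induction m with
  | zero => simp [dl, dl']
  | succ m ih =>
    rw [dl, ← mul_assoc, ih (by omega), dl', mul_assoc, dl_shift _ _ le_rfl (by omega), mul_assoc]

lemma dl_sq (m : ℕ) (hm : n = m + 2) :
    dl n (n - 1) ^ 2 * sg n m = sg n 0 * dl n (n - 1) ^ 2 := by
  have e : n - 1 = m + 1 := by omega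
  have h1 : dl n (n - 1) ^ 2 = dl' n m * dl n (n - 1) * sg n m := by
    have h : dl n (n - 1) = dl n m * sg n m := congrArg (dl n) e
    rw [← dl_mul_dl m (by omega), mul_assoc, ← h, sq]
  have h2 : sg n 0 * dl' n m = dl n (n - 1) := ((congrArg (dl n) e).trans (dl_succ' m)).symm
  conv_rhs => rw [h1]
  rw [← mul_assoc, ← mul_assoc, h2, sq]

lemma dl_central (i : ℕ) (h : i < n - 1) :
    dl n (n - 1) ^ n * sg n i = sg n i * dl n (n - 1) ^ n := by
  obtain ⟨m, hm⟩ : ∃ m, n = m + 2 := ⟨n - 2, by omega⟩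
  set d := dl n (n - 1) with hd
  have h0 : d ^ n * sg n 0 = sg n 0 * d ^ n := by
    have : d ^ n = d ^ 2 * d ^ m := by rw [← pow_add]; congr 1; omega
    rw [this, mul_assoc, dl_shift_pow m 0 (by omega), zero_add, ← mul_assoc, dl_sq m hm, mul_assoc]
  have h1 := dl_shift_pow (n := n) i 0 (by omega)
  rw [zero_add, ← hd] at h1
  have h2 : sg n i = d ^ i * sg n 0 * (d ^ i)⁻¹ := by rw [h1]; group
  rw [h2]
  have c : Commute (d ^ n) (d ^ i) := (Commute.refl d).pow_pow n i
  have c0 : Commute (d ^ n) (sg n 0) := h0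
  exact ((c.mul_right c0).mul_right c.inv_right)

/-- Positive elements. -/
def Pos (n : ℕ) : Submonoid (BraidGroup n) := Submonoid.closure (Set.range (braidGen n))

lemma sg_pos (i : ℕ) : sg n i ∈ Pos n := by
  unfold sg
  split_ifs
  · exact Submonoid.subset_closure ⟨_, rfl⟩
  · exact one_mem _

lemma dl_pos (m : ℕ) : dl n m ∈ Pos n := by
  induction m with
  | zero => exact one_mem _
  | succ m ih => exact mul_mem ih (sg_pos m)

lemma dl'_pos (m : ℕ) : dl' n m ∈ Pos n := by
  induction m with
  | zero => exact one_mem _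
  | succ m ih => exact mul_mem ih (sg_pos _)

lemma dl_div (i : ℕ) (h : i < n - 1) : ∃ p ∈ Pos n, dl n (n - 1) ^ n = sg n i * p := by
  obtain ⟨m, hm⟩ : ∃ m, n = m + 2 := ⟨n - 2, by omega⟩
  have e : n - 1 = m + 1 := by omega
  have h1 := dl_shift_pow (n := n) i 0 (by omega)
  have h2 : dl n (n - 1) = sg n 0 * dl' n m := (congrArg (dl n) e).trans (dl_succ' m)
  refine ⟨dl n (n - 1) ^ i * dl' n m * dl n (n - 1) ^ (n - i - 1),
    mul_mem (mul_mem (pow_mem (dl_pos _) _) (dl'_pos _)) (pow_mem (dl_pos _) _), ?_⟩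
  have h3 : dl n (n - 1) ^ n = dl n (n - 1) ^ i * dl n (n - 1) * dl n (n - 1) ^ (n - i - 1) := by
    rw [← pow_succ, ← pow_add]; congr 1; omega
  rw [h3]
  conv_lhs => enter [1, 2]; rw [h2]
  rw [zero_add] at h1
  rw [← mul_assoc, h1]
  group

lemma ore (g : BraidGroup n) : ∃ a ∈ Pos n, ∃ b ∈ Pos n, g * a = b := by
  suffices h : ∃ k : ℕ, g * (dl n (n - 1) ^ n) ^ k ∈ Pos n by
    obtain ⟨k, hk⟩ := h
    exact ⟨_, pow_mem (pow_mem (dl_pos _) _) k, _, hk, rfl⟩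
  have hg : g ∈ Subgroup.closure (Set.range (braidGen n)) := by
    have := PresentedGroup.closure_range_of (braidRels n)
    have h2 : Set.range (braidGen n) = Set.range (PresentedGroup.of : _ → BraidGroup n) := rfl
    rw [h2, this]; trivial
  induction hg using Subgroup.closure_induction_right with
  | one => exact ⟨0, by simp⟩
  | mul_right x hx y hy ih =>
    obtain ⟨k, hk⟩ := ih
    obtain ⟨i, rfl⟩ := hy
    have e : braidGen n i = sg n i := by simp [sg]
    have c : Commute (dl n (n - 1) ^ n) (sg n i) := dl_central i i.2
    refine ⟨k, ?_⟩
    rw [e, mul_assoc, ← (c.pow_left k).eq, ← mul_assoc]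
    exact mul_mem hk (sg_pos _)
  | mul_inv_cancel x hx y hy ih =>
    obtain ⟨k, hk⟩ := ih
    obtain ⟨i, rfl⟩ := hy
    have e : braidGen n i = sg n i := by simp [sg]
    have c : Commute (dl n (n - 1) ^ n) (sg n i) := dl_central i i.2
    obtain ⟨p, hp, h⟩ := dl_div (n := n) i i.2
    refine ⟨k + 1, ?_⟩
    have : x * (braidGen n i)⁻¹ * (dl n (n - 1) ^ n) ^ (k + 1)
        = x * (dl n (n - 1) ^ n) ^ k * p := by
      rw [pow_succ, e, mul_assoc, ← mul_assoc (sg n i)⁻¹, ← ((c.pow_left k).inv_right).eq,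
        mul_assoc _ (sg n i)⁻¹]
      conv_lhs => enter [2, 2, 2]; rw [h]
      group
    rw [this]
    exact mul_mem hk hp

end Ore

/-! ### The Lawrence–Krammer operators -/

section LK
variable {R : Type*} [CommRing R]

/-- Dual Lawrence–Krammer operator on functions of pairs of naturals. -/
def op (t q : R) (k : ℕ) (f : ℕ → ℕ → R) (i j : ℕ) : R :=
  if i = k ∧ j = k + 1 then t * q ^ 2 * f k (k + 1)
  else if j = k then (1 - q) * f i k + q * f i (k + 1)
  else if j = k + 1 then f i k + t * q * (q - 1) * f k (k + 1)
  else if i = k then t * q * (q - 1) * f k (k + 1) + f (k + 1) j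
  else if i = k + 1 then q * f k j + (1 - q) * f (k + 1) j
  else if i < k ∧ k + 1 < j then f i j + t * (q - 1) ^ 2 * f k (k + 1)
  else f i j

section
variable (t q : R) (k : ℕ) (f : ℕ → ℕ → R)

lemma op_kk : op t q k f k (k + 1) = t * q ^ 2 * f k (k + 1) := by simp [op]

lemma op_jk (i : ℕ) (_h : i < k) : op t q k f i k = (1 - q) * f i k + q * f i (k + 1) := by
  simp [op]

lemma op_jk1 (i : ℕ) (h : i < k) :
    op t q k f i (k + 1) = f i k + t * q * (q - 1) * f k (k + 1) := by
  simp [op, h.ne]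

lemma op_ik (j : ℕ) (h : k + 1 < j) :
    op t q k f k j = t * q * (q - 1) * f k (k + 1) + f (k + 1) j := by
  have h1 : j ≠ k := by omega
  simp [op, h.ne', h1]

lemma op_ik1 (j : ℕ) (h : k + 1 < j) :
    op t q k f (k + 1) j = q * f k j + (1 - q) * f (k + 1) j := by
  have h1 : j ≠ k := by omega
  simp [op, h.ne', h1]

lemma op_mid (i j : ℕ) (h : i < k) (h' : k + 1 < j) :
    op t q k f i j = f i j + t * (q - 1) ^ 2 * f k (k + 1) := by
  have h1 : j ≠ k := by omega
  have h2 : i ≠ k + 1 := by omega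
  simp [op, h.ne, h'.ne', h1, h2, h, h']

lemma op_out (i j : ℕ) (h : i < j) (h' : j < k ∨ k + 1 < i) : op t q k f i j = f i j := by
  unfold op
  rw [if_neg (by omega), if_neg (by omega), if_neg (by omega), if_neg (by omega),
    if_neg (by omega), if_neg (by omega)]

end

lemma op_braid (t q : R) (k : ℕ) (f : ℕ → ℕ → R) (i j : ℕ) (h : i < j) :
    op t q k (op t q (k + 1) (op t q k f)) i j =
      op t q (k + 1) (op t q k (op t q (k + 1) f)) i j := by
  have hi : i < k ∨ i = k ∨ i = k + 1 ∨ i = k + 2 ∨ k + 2 < i := by omega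
  have hj : j < k ∨ j = k ∨ j = k + 1 ∨ j = k + 2 ∨ k + 2 < j := by omega
  rcases hi with hi | rfl | rfl | rfl | hi <;> rcases hj with hj | hj | hj | hj | hj <;>
    first
    | (exfalso; omega)
    | (try subst hj
       simp (disch := omega) only [op_kk, op_jk, op_jk1, op_ik, op_ik1, op_mid, op_out]
       try ring)

lemma op_comm (t q : R) (k l : ℕ) (hkl : k + 1 < l) (f : ℕ → ℕ → R) (i j : ℕ) (_h : i < j) :
    op t q k (op t q l f) i j = op t q l (op t q k f) i j := by
  have hi : i < k ∨ i = k ∨ i = k + 1 ∨ (k + 1 < i ∧ i < l) ∨ i = l ∨ i = l + 1 ∨ l + 1 < i := by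
    omega
  have hj : j < k ∨ j = k ∨ j = k + 1 ∨ (k + 1 < j ∧ j < l) ∨ j = l ∨ j = l + 1 ∨ l + 1 < j := by
    omega
  rcases hi with hi | hi | hi | hi | hi | hi | hi <;>
    rcases hj with hj | hj | hj | hj | hj | hj | hj <;>
    first
    | (exfalso; omega)
    | (try subst hi
       try subst hj
       simp (disch := omega) only [op_kk, op_jk, op_jk1, op_ik, op_ik1, op_mid, op_out]
       try ring)
end LK

/-! ### The finite-dimensional representation -/

/-- Index set: pairs `i < j < n`. -/
abbrev Idx (n : ℕ) : Type := Σ j : Fin n, Fin (j : ℕ)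

lemma card_Idx (n : ℕ) : Fintype.card (Idx n) = n * (n - 1) / 2 := by
  rw [Fintype.card_sigma]
  simp only [Fintype.card_fin]
  rw [Fin.sum_univ_eq_sum_range (fun i => i) n, Finset.sum_range_id]

section Rep
variable {R : Type*} [CommRing R] {n : ℕ}

/-- Extension by zero. -/
def ext0 (f : Idx n → R) (i j : ℕ) : R :=
  if h : ∃ h : j < n, i < j then f ⟨⟨j, h.1⟩, ⟨i, h.2⟩⟩ else 0

lemma ext0_apply (f : Idx n → R) (i j : ℕ) (h : j < n) (h' : i < j) :
    ext0 f i j = f ⟨⟨j, h⟩, ⟨i, h'⟩⟩ := by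
  rw [ext0, dif_pos ⟨h, h'⟩]

lemma ext0_add (f g : Idx n → R) : ext0 (f + g) = ext0 f + ext0 g := by
  funext i j
  simp only [ext0, Pi.add_apply]
  split_ifs <;> simp

lemma ext0_smul (c : R) (f : Idx n → R) : ext0 (c • f) = c • ext0 f := by
  funext i j
  simp only [ext0, Pi.smul_apply]
  split_ifs <;> simp

/-- The operator on the finite free module. -/
def opI (t q : R) (k : ℕ) : (Idx n → R) →ₗ[R] (Idx n → R) where
  toFun f x := op t q k (ext0 f) x.2 x.1
  map_add' f g := by
    funext x
    simp only [ext0_add, op, Pi.add_apply]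
    split_ifs <;> ring
  map_smul' c f := by
    funext x
    simp only [ext0_smul, op, Pi.smul_apply, smul_eq_mul, RingHom.id_apply]
    split_ifs <;> ring

lemma op_congr (t q : R) (k : ℕ) (hk : k + 1 < n) (f g : ℕ → ℕ → R)
    (h : ∀ i j, i < j → j < n → f i j = g i j) (i j : ℕ) (hij : i < j) (hj : j < n) :
    op t q k f i j = op t q k g i j := by
  have h0 := h k (k + 1) (by omega) hk
  have hi : i < k ∨ i = k ∨ i = k + 1 ∨ k + 1 < i := by omega
  have hj' : j < k ∨ j = k ∨ j = k + 1 ∨ k + 1 < j := by omega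
  rcases hi with hi | hi | hi | hi <;> rcases hj' with hj' | hj' | hj' | hj' <;>
    first
    | (exfalso; omega)
    | (try subst hi
       try subst hj'
       simp (disch := omega) only [op_kk, op_jk, op_jk1, op_ik, op_ik1, op_mid, op_out, h])

lemma ext0_opI (t q : R) (k : ℕ) (f : Idx n → R) (i j : ℕ) (hij : i < j) (hj : j < n) :
    ext0 (opI t q k f) i j = op t q k (ext0 f) i j := by
  rw [ext0_apply _ _ _ hj hij]
  rfl

lemma opI_ext {f g : Idx n → R} (h : ∀ i j, i < j → j < n → ext0 f i j = ext0 g i j) :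
    f = g := by
  funext ⟨⟨j, hj⟩, ⟨i, hi⟩⟩
  have := h i j hi hj
  rwa [ext0_apply _ _ _ hj hi, ext0_apply _ _ _ hj hi] at this

lemma opI_braid (t q : R) (k : ℕ) (hk : k + 2 < n) (f : Idx n → R) :
    opI t q k (opI t q (k + 1) (opI t q k f)) =
      opI t q (k + 1) (opI t q k (opI t q (k + 1) f)) := by
  apply opI_ext
  intro i j hij hj
  have key : ∀ a b c : ℕ, a + 1 < n → b + 1 < n → c + 1 < n →
      ext0 (opI t q a (opI t q b (opI t q c f))) i j
        = op t q a (op t q b (op t q c (ext0 f))) i j := by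
    intro a b c ha hb hc
    rw [ext0_opI _ _ _ _ _ _ hij hj]
    refine op_congr t q a ha _ _ ?_ i j hij hj
    intro i j hij hj
    rw [ext0_opI _ _ _ _ _ _ hij hj]
    refine op_congr t q b hb _ _ ?_ i j hij hj
    intro i j hij hj
    rw [ext0_opI _ _ _ _ _ _ hij hj]
  rw [key _ _ _ (by omega) (by omega) (by omega), key _ _ _ (by omega) (by omega) (by omega),
    op_braid _ _ _ _ _ _ hij]

lemma opI_comm (t q : R) (k l : ℕ) (hkl : k + 1 < l) (hl : l + 1 < n) (f : Idx n → R) :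
    opI t q k (opI t q l f) = opI t q l (opI t q k f) := by
  apply opI_ext
  intro i j hij hj
  have key : ∀ a b : ℕ, a + 1 < n → b + 1 < n →
      ext0 (opI t q a (opI t q b f)) i j = op t q a (op t q b (ext0 f)) i j := by
    intro a b ha hb
    rw [ext0_opI _ _ _ _ _ _ hij hj]
    refine op_congr t q a ha _ _ ?_ i j hij hj
    intro i j hij hj
    rw [ext0_opI _ _ _ _ _ _ hij hj]
  rw [key _ _ (by omega) (by omega), key _ _ (by omega) (by omega), op_comm _ _ _ _ hkl _ _ _ hij]

lemma opI_map {S : Type*} [CommRing S] (φ : R →+* S) (t q : R) (k : ℕ) (f : Idx n → R) :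
    (fun x => φ (opI t q k f x)) = opI (φ t) (φ q) k (fun x => φ (f x)) := by
  have h : ∀ i j, ext0 (fun x => φ (f x)) i j = φ (ext0 f i j) := by
    intro i j
    simp only [ext0]
    split_ifs <;> simp
  funext x
  simp only [opI, LinearMap.coe_mk, AddHom.coe_mk, op, h]
  split_ifs <;> simp

/-- The operator of a word (head of the list is applied first). -/
def opW (t q : R) : List (Fin (n - 1)) → (Idx n → R) →ₗ[R] (Idx n → R)
  | [] => LinearMap.id
  | s :: w => (opW t q w).comp (opI t q s)

lemma opW_map {S : Type*} [CommRing S] (φ : R →+* S) (t q : R) (w : List (Fin (n - 1)))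
    (f : Idx n → R) :
    (fun x => φ (opW t q w f x)) = opW (φ t) (φ q) w (fun x => φ (f x)) := by
  induction w generalizing f with
  | nil => rfl
  | cons s w ih =>
    simp only [opW, LinearMap.comp_apply]
    rw [ih, opI_map]

end Rep

section Inj
variable {K : Type*} [Field K] {n : ℕ}

lemma opI_isUnit (t q : K) (ht : t ≠ 0) (hq : q ≠ 0) (k : ℕ) (hk : k + 1 < n) :
    IsUnit (opI (n := n) t q k) := by
  rw [LinearMap.isUnit_iff_ker_eq_bot, LinearMap.ker_eq_bot']
  intro f hf
  have h : ∀ i j, i < j → j < n → op t q k (ext0 f) i j = 0 := by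
    intro i j hij hj
    rw [← ext0_opI _ _ _ _ _ _ hij hj, hf, ext0_apply _ _ _ hj hij]; rfl
  apply opI_ext
  intro i j hij hj
  have e0 : ext0 (0 : Idx n → K) i j = 0 := by rw [ext0_apply _ _ _ hj hij]; rfl
  rw [e0]
  have h0 : ext0 f k (k + 1) = 0 := by
    have := h k (k + 1) (by omega) hk
    rw [op_kk] at this
    simpa [ht, hq] using this
  have hi : i < k ∨ i = k ∨ i = k + 1 ∨ k + 1 < i := by omega
  have hj' : j < k ∨ j = k ∨ j = k + 1 ∨ k + 1 < j := by omega
  rcases hi with hi | hi | hi | hi <;> rcases hj' with hj' | hj' | hj' | hj' <;>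
    first
    | (exfalso; omega)
    | skip
  · simpa (disch := omega) [op_out] using h i j hij hj
  · subst hj'
    have h1 := h i (j + 1) (by omega) hk
    rw [op_jk1 _ _ _ _ _ hi, h0] at h1
    simpa using h1
  · subst hj'
    have h1 := h i (k + 1) (by omega) hk
    rw [op_jk1 _ _ _ _ _ hi, h0] at h1
    have h2 := h i k (by omega) (by omega)
    rw [op_jk _ _ _ _ _ hi] at h2
    have h3 : ext0 f i k = 0 := by simpa using h1
    simpa [h3, hq] using h2
  · have h1 := h i j hij hj
    rw [op_mid _ _ _ _ _ _ hi hj', h0] at h1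
    simpa using h1
  · subst hi hj'; exact h0
  · subst hi
    have h1 := h i j (by omega) hj
    rw [op_ik _ _ _ _ _ hj', h0] at h1
    have h2 := h (i + 1) j (by omega) (by omega)
    rw [op_ik1 _ _ _ _ _ hj'] at h2
    have h3 : ext0 f (i + 1) j = 0 := by simpa using h1
    simpa [h3, hq] using h2
  · subst hi
    have h1 := h k j (by omega) hj
    rw [op_ik _ _ _ _ _ hj', h0] at h1
    simpa using h1
  · simpa (disch := omega) [op_out] using h i j hij hj

end Inj

/-! ### The specialisation `t = 0`, `q = 1/2` -/

section Spec
variable {n : ℕ}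

/-- Indicator function of a pair. -/
def dlt (n : ℕ) (a b : ℕ) : Idx n → ℚ :=
  fun x => if (x.2 : ℕ) = a ∧ (x.1 : ℕ) = b then 1 else 0

lemma ext0_dlt (a b i j : ℕ) (h : a < b) (h' : b < n) :
    ext0 (dlt n a b) i j = if i = a ∧ j = b then 1 else 0 := by
  unfold ext0 dlt
  by_cases h1 : i = a ∧ j = b
  · obtain ⟨rfl, rfl⟩ := h1
    simp [h, h']
  · simp [h1]

/-- Specialised operators. -/
abbrev T0 (n k : ℕ) : (Idx n → ℚ) →ₗ[ℚ] (Idx n → ℚ) := opI 0 (1 / 2) k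

lemma T0_self (s : ℕ) (hs : s + 1 < n) : T0 n s (dlt n s (s + 1)) = 0 := by
  funext ⟨⟨j, hj⟩, ⟨i, hi⟩⟩
  simp only at hi
  simp (disch := omega) only [opI, LinearMap.coe_mk, AddHom.coe_mk, op, ext0_dlt, Pi.zero_apply]
  try simp only [true_and, and_true]
  split_ifs <;> first | (exfalso; omega) | norm_num

lemma T0_far (s k : ℕ) (hs : s + 1 < n) (h : s + 1 < k ∨ k + 1 < s) :
    T0 n k (dlt n s (s + 1)) = dlt n s (s + 1) := by
  funext ⟨⟨j, hj⟩, ⟨i, hi⟩⟩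
  simp only at hi
  simp (disch := omega) only [opI, LinearMap.coe_mk, AddHom.coe_mk, op, ext0_dlt]
  simp only [dlt]
  try simp only [true_and, and_true]
  split_ifs <;> first | (exfalso; omega) | norm_num

lemma T0_up (s : ℕ) (hs : s + 2 < n) :
    T0 n (s + 1) (dlt n s (s + 1)) = (1 / 2 : ℚ) • dlt n s (s + 1) + dlt n s (s + 2) := by
  funext ⟨⟨j, hj⟩, ⟨i, hi⟩⟩
  simp only at hi
  simp (disch := omega) only [opI, LinearMap.coe_mk, AddHom.coe_mk, op, ext0_dlt]
  simp only [dlt, Pi.add_apply, Pi.smul_apply, smul_eq_mul]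
  try simp only [true_and, and_true]
  split_ifs <;> first | (exfalso; omega) | norm_num

lemma T0_down (s : ℕ) (hs : s + 2 < n) :
    T0 n s (dlt n (s + 1) (s + 2)) = (1 / 2 : ℚ) • dlt n (s + 1) (s + 2) + dlt n s (s + 2) := by
  funext ⟨⟨j, hj⟩, ⟨i, hi⟩⟩
  simp only at hi
  simp (disch := omega) only [opI, LinearMap.coe_mk, AddHom.coe_mk, op, ext0_dlt]
  simp only [dlt, Pi.add_apply, Pi.smul_apply, smul_eq_mul]
  try simp only [true_and, and_true]
  split_ifs <;> first | (exfalso; omega) | norm_num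

lemma T0_mid (s : ℕ) (hs : s + 2 < n) :
    T0 n s (dlt n s (s + 2)) = (1 / 2 : ℚ) • dlt n (s + 1) (s + 2) := by
  funext ⟨⟨j, hj⟩, ⟨i, hi⟩⟩
  simp only at hi
  simp (disch := omega) only [opI, LinearMap.coe_mk, AddHom.coe_mk, op, ext0_dlt]
  simp only [dlt, Pi.smul_apply, smul_eq_mul]
  try simp only [true_and, and_true]
  split_ifs <;> first | (exfalso; omega) | norm_num

lemma T0_mid' (s : ℕ) (hs : s + 2 < n) :
    T0 n (s + 1) (dlt n s (s + 2)) = (1 / 2 : ℚ) • dlt n s (s + 1) := by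
  funext ⟨⟨j, hj⟩, ⟨i, hi⟩⟩
  simp only at hi
  simp (disch := omega) only [opI, LinearMap.coe_mk, AddHom.coe_mk, op, ext0_dlt]
  simp only [dlt, Pi.smul_apply, smul_eq_mul]
  try simp only [true_and, and_true]
  split_ifs <;> first | (exfalso; omega) | norm_num

lemma T0_nonneg (k : ℕ) (f : Idx n → ℚ) (hf : 0 ≤ f) : 0 ≤ T0 n k f := by
  have h : ∀ i j, 0 ≤ ext0 f i j := by
    intro i j
    unfold ext0
    split_ifs
    · exact hf _
    · exact le_rfl
  intro x
  simp only [opI, LinearMap.coe_mk, AddHom.coe_mk, op, Pi.zero_apply]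
  split_ifs <;> norm_num <;> linarith [h x.2 x.1, h x.2 k, h x.2 (k + 1), h k x.1, h (k + 1) x.1]

/-- Specialised operator of a word. -/
abbrev W0 (n : ℕ) (w : List (Fin (n - 1))) : (Idx n → ℚ) →ₗ[ℚ] (Idx n → ℚ) := opW 0 (1 / 2) w

lemma W0_nonneg (w : List (Fin (n - 1))) (f : Idx n → ℚ) (hf : 0 ≤ f) : 0 ≤ W0 n w f := by
  induction w generalizing f with
  | nil => exact hf
  | cons s w ih => exact ih _ (T0_nonneg _ _ hf)

lemma dlt_nonneg (a b : ℕ) : 0 ≤ dlt n a b := by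
  intro x
  simp only [dlt, Pi.zero_apply]
  split_ifs <;> norm_num

lemma dlt_ne (s : ℕ) (hs : s + 1 < n) : dlt n s (s + 1) ≠ 0 := by
  intro h
  have := congrFun h ⟨⟨s + 1, hs⟩, ⟨s, by simp⟩⟩
  simp [dlt] at this

/-- The two vectors appearing when adjacent generators interact. -/
lemma T0_adj (s k : ℕ) (hs : s + 1 < n) (hk : k + 1 < n) (h : s = k + 1 ∨ k = s + 1) :
    ∃ e : Idx n → ℚ, 0 ≤ e ∧
      T0 n k (dlt n s (s + 1)) = (1 / 2 : ℚ) • dlt n s (s + 1) + e ∧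
      T0 n s e = (1 / 2 : ℚ) • dlt n k (k + 1) := by
  rcases h with rfl | rfl
  · exact ⟨dlt n k (k + 2), dlt_nonneg _ _, T0_down k (by omega), T0_mid' k (by omega)⟩
  · exact ⟨dlt n s (s + 2), dlt_nonneg _ _, T0_up s (by omega), T0_mid s (by omega)⟩

end Spec

/-! ### The representation and its faithfulness -/

section Main

/-- The field of rational functions. -/
abbrev KK : Type := FractionRing (MvPolynomial (Fin 2) ℚ)

/-- The polynomial ring. -/
abbrev PP : Type := MvPolynomial (Fin 2) ℚ

/-- The first variable. -/
noncomputable def tt : KK := algebraMap PP KK (MvPolynomial.X 0)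

/-- The second variable. -/
noncomputable def qq : KK := algebraMap PP KK (MvPolynomial.X 1)

lemma alg_inj : Function.Injective (algebraMap PP KK) := IsFractionRing.injective PP KK

lemma tt_ne : tt ≠ 0 := by
  unfold tt
  rw [Ne, map_eq_zero_iff _ alg_inj]
  exact MvPolynomial.X_ne_zero 0

lemma qq_ne : qq ≠ 0 := by
  unfold qq
  rw [Ne, map_eq_zero_iff _ alg_inj]
  exact MvPolynomial.X_ne_zero 1

variable {n : ℕ}

/-- Generator images. -/
noncomputable def genU (n : ℕ) (k : Fin (n - 1)) : (Module.End KK (Idx n → KK))ˣ :=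
  (opI_isUnit tt qq tt_ne qq_ne k (by omega)).unit

lemma genU_val (k : Fin (n - 1)) :
    ((genU n k : (Module.End KK (Idx n → KK))ˣ) : Module.End KK (Idx n → KK)) = opI tt qq k := rfl

lemma genU_rels : ∀ r ∈ braidRels n, FreeGroup.lift (genU n) r = 1 := by
  rintro r (⟨i, j, h, rfl⟩ | ⟨i, j, h, rfl⟩)
  · rw [map_mul, map_inv, mul_inv_eq_one]
    simp only [map_mul, FreeGroup.lift_apply_of]
    apply Units.ext
    apply LinearMap.ext
    intro f
    exact opI_comm tt qq i j h (by omega) f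
  · rw [map_mul, map_inv, mul_inv_eq_one]
    simp only [map_mul, FreeGroup.lift_apply_of]
    apply Units.ext
    apply LinearMap.ext
    intro f
    simp only [Units.val_mul, genU_val, h, Module.End.mul_apply]
    exact opI_braid tt qq i (by omega) f

/-- The Lawrence–Krammer representation (dual form). -/
noncomputable def rep (n : ℕ) : BraidGroup n →* (Module.End KK (Idx n → KK))ˣ :=
  PresentedGroup.toGroup genU_rels

lemma rep_gen (k : Fin (n - 1)) : rep n (braidGen n k) = genU n k := by
  simp [rep, braidGen]

/-- Positive words; the head of the list is the last letter. -/
def wd (n : ℕ) : List (Fin (n - 1)) → BraidGroup n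
  | [] => 1
  | s :: w => wd n w * braidGen n s

lemma wd_append (v w : List (Fin (n - 1))) : wd n (v ++ w) = wd n w * wd n v := by
  induction v with
  | nil => simp [wd]
  | cons s v ih => rw [List.cons_append, wd, ih, wd, mul_assoc]

lemma pos_wd (g : BraidGroup n) (hg : g ∈ Pos n) : ∃ w, wd n w = g := by
  induction hg using Submonoid.closure_induction with
  | mem x hx =>
    obtain ⟨i, rfl⟩ := hx
    exact ⟨[i], by simp [wd]⟩
  | one => exact ⟨[], rfl⟩
  | mul x y _ _ hx hy =>
    obtain ⟨v, rfl⟩ := hx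
    obtain ⟨w, rfl⟩ := hy
    exact ⟨w ++ v, wd_append _ _⟩

/-- Exponent sum. -/
def len (n : ℕ) : BraidGroup n →* Multiplicative ℤ :=
  PresentedGroup.toGroup (f := fun _ => Multiplicative.ofAdd 1) (by
    rintro r (⟨i, j, h, rfl⟩ | ⟨i, j, h, rfl⟩) <;> simp)

lemma len_wd (w : List (Fin (n - 1))) : len n (wd n w) = Multiplicative.ofAdd (w.length : ℤ) := by
  induction w with
  | nil => simp [wd]
  | cons s w ih =>
    rw [wd, map_mul, ih]
    simp [len, braidGen, ofAdd_add]

lemma length_eq {v w : List (Fin (n - 1))} (h : wd n v = wd n w) : v.length = w.length := by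
  have := congrArg (len n) h
  rw [len_wd, len_wd] at this
  exact_mod_cast Multiplicative.ofAdd.injective this

lemma rep_wd (w : List (Fin (n - 1))) (f : Idx n → KK) :
    (rep n (wd n w)).val f = opW tt qq w f := by
  induction w generalizing f with
  | nil => simp [wd, opW]
  | cons s w ih =>
    rw [wd, map_mul, Units.val_mul, Module.End.mul_apply, rep_gen, genU_val, ih]
    rfl

lemma W0_eq_of_rep {v w : List (Fin (n - 1))} (h : rep n (wd n v) = rep n (wd n w))
    (f : Idx n → ℚ) : W0 n v f = W0 n w f := by
  let F : Idx n → PP := fun x => MvPolynomial.C (f x)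
  have h1 : opW (MvPolynomial.X 0 : PP) (MvPolynomial.X 1) v F
      = opW (MvPolynomial.X 0 : PP) (MvPolynomial.X 1) w F := by
    funext x
    apply alg_inj
    have a := congrFun (opW_map (algebraMap PP KK) (MvPolynomial.X 0) (MvPolynomial.X 1) v F) x
    have b := congrFun (opW_map (algebraMap PP KK) (MvPolynomial.X 0) (MvPolynomial.X 1) w F) x
    rw [a, b]
    have c := rep_wd v (fun x => algebraMap PP KK (F x))
    rw [h, rep_wd] at c
    exact (congrFun c x).symm
  let ψ : PP →+* ℚ := MvPolynomial.eval ![0, 1 / 2]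
  have a := opW_map ψ (MvPolynomial.X 0) (MvPolynomial.X 1) v F
  have b := opW_map ψ (MvPolynomial.X 0) (MvPolynomial.X 1) w F
  rw [h1, b] at a
  have e0 : ψ (MvPolynomial.X 0) = 0 := by simp [ψ]
  have e1 : ψ (MvPolynomial.X 1) = 1 / 2 := by simp [ψ]
  have e2 : (fun x => ψ (F x)) = f := by funext x; simp [ψ, F]
  rw [e0, e1, e2] at a
  exact a.symm

lemma W0_eq {v w : List (Fin (n - 1))} (h : wd n v = wd n w) (f : Idx n → ℚ) :
    W0 n v f = W0 n w f := W0_eq_of_rep (by rw [h]) f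

lemma gen_comm' (i j : Fin (n - 1)) (h : (i : ℕ) + 1 < j ∨ (j : ℕ) + 1 < i) :
    braidGen n i * braidGen n j = braidGen n j * braidGen n i := by
  rcases h with h | h
  · exact gen_comm i j h
  · exact (gen_comm j i h).symm

lemma gen_braid' (i j : Fin (n - 1)) (h : (i : ℕ) = j + 1 ∨ (j : ℕ) = i + 1) :
    braidGen n i * braidGen n j * braidGen n i =
      braidGen n j * braidGen n i * braidGen n j := by
  rcases h with h | h
  · exact (gen_braid j i h).symm
  · exact gen_braid i j h

/-- The specialised operator detects right divisibility by a generator. -/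
lemma detect (m : ℕ) : ∀ (w : List (Fin (n - 1))), w.length = m → ∀ s : Fin (n - 1),
    W0 n w (dlt n s (s + 1)) = 0 → ∃ v, wd n (s :: v) = wd n w := by
  induction m using Nat.strong_induction_on with
  | _ m IH =>
  intro w hw s h0
  have hs : (s : ℕ) + 1 < n := by omega
  match w, hw, h0 with
  | [], _, h0 => exact absurd h0 (dlt_ne _ hs)
  | t :: v, hw, h0 =>
    have ht : (t : ℕ) + 1 < n := by omega
    have hv : v.length < m := by simp at hw; omega
    have h0' : W0 n v (T0 n t (dlt n s (s + 1))) = 0 := h0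
    have hcase : s = t ∨ ((s : ℕ) + 1 < t ∨ (t : ℕ) + 1 < s) ∨
        ((s : ℕ) = t + 1 ∨ (t : ℕ) = s + 1) := by
      rw [Fin.ext_iff]; omega
    rcases hcase with rfl | hc | hc
    · exact ⟨v, rfl⟩
    · rw [T0_far s t hs hc] at h0'
      obtain ⟨u, hu⟩ := IH _ hv v rfl s h0'
      refine ⟨t :: u, ?_⟩
      simp only [wd] at hu ⊢
      rw [← hu, mul_assoc, mul_assoc, gen_comm' s t hc]
    · obtain ⟨e, he, h1, h2⟩ := T0_adj s t hs ht hc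
      rw [h1, map_add, map_smul] at h0'
      have p1 : 0 ≤ W0 n v (dlt n s (s + 1)) := W0_nonneg _ _ (dlt_nonneg _ _)
      have p2 : 0 ≤ W0 n v e := W0_nonneg _ _ he
      have z1 : W0 n v (dlt n s (s + 1)) = 0 := by
        funext x
        have a := congrFun h0' x
        have b := p1 x
        have c := p2 x
        simp only [Pi.add_apply, Pi.smul_apply, Pi.zero_apply, smul_eq_mul] at a b c ⊢
        linarith
      have z2 : W0 n v e = 0 := by
        rw [z1] at h0'
        simpa using h0'
      obtain ⟨u, hu⟩ := IH _ hv v rfl s z1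
      have hlen := length_eq hu
      rw [← W0_eq hu] at z2
      have z3 : W0 n u (T0 n s e) = 0 := z2
      rw [h2, map_smul] at z3
      have z4 : W0 n u (dlt n t (t + 1)) = 0 := by simpa using z3
      obtain ⟨u', hu'⟩ := IH u.length (by simp at hlen; omega) u rfl t z4
      refine ⟨t :: s :: u', ?_⟩
      simp only [wd] at hu hu' ⊢
      rw [← hu, ← hu', mul_assoc, mul_assoc, mul_assoc, mul_assoc, ← mul_assoc (braidGen n s),
        gen_braid' s t hc, mul_assoc]

lemma rep_wd_inj (v w : List (Fin (n - 1))) (h : rep n (wd n v) = rep n (wd n w)) :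
    wd n v = wd n w := by
  induction v generalizing w with
  | nil =>
    match w with
    | [] => rfl
    | s :: w =>
      exfalso
      have h1 := W0_eq_of_rep h (dlt n s (s + 1))
      have h2 : W0 n (s :: w) (dlt n s (s + 1)) = W0 n w (T0 n s (dlt n s (s + 1))) := rfl
      rw [h2, T0_self s (by omega), map_zero] at h1
      exact dlt_ne s (by omega) h1
  | cons s v ih =>
    have h1 := W0_eq_of_rep h (dlt n s (s + 1))
    have h2 : W0 n (s :: v) (dlt n s (s + 1)) = W0 n v (T0 n s (dlt n s (s + 1))) := rfl
    rw [h2, T0_self s (by omega), map_zero] at h1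
    obtain ⟨u, hu⟩ := detect _ w rfl s h1.symm
    rw [← hu] at h ⊢
    simp only [wd, map_mul, mul_left_inj] at h ⊢
    exact ih u h

lemma rep_injective (n : ℕ) : Function.Injective (rep n) := by
  rw [injective_iff_map_eq_one]
  intro g hg
  obtain ⟨a, ha, b, hb, h⟩ := ore g
  obtain ⟨v, rfl⟩ := pos_wd a ha
  obtain ⟨w, rfl⟩ := pos_wd b hb
  have h1 : rep n (wd n v) = rep n (wd n w) := by rw [← h, map_mul, hg, one_mul]
  rw [rep_wd_inj v w h1] at h
  simpa using h

end Main

end LKB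

/-- (Krammer, Bigelow) The braid group `Bₙ` is linear: it embeds in `GL_N(ℚ(p,q))`
with `N = n(n-1)/2`. -/
theorem braidGroup_linear (n : ℕ) :
    ∃ ρ : BraidGroup n →*
        Matrix.GeneralLinearGroup (Fin (n * (n - 1) / 2))
          (FractionRing (MvPolynomial (Fin 2) ℚ)),
      Function.Injective ρ := by
  have e : LKB.Idx n ≃ Fin (n * (n - 1) / 2) :=
    Fintype.equivFinOfCardEq (LKB.card_Idx n)
  let E : Module.End LKB.KK (LKB.Idx n → LKB.KK) ≃*
      Matrix (Fin (n * (n - 1) / 2)) (Fin (n * (n - 1) / 2)) LKB.KK :=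
    (LinearMap.toMatrixAlgEquiv'.trans
      (Matrix.reindexAlgEquiv LKB.KK LKB.KK e)).toMulEquiv
  exact ⟨(Units.mapEquiv E).toMonoidHom.comp (LKB.rep n),
    (Units.mapEquiv E).injective.comp (LKB.rep_injective n)⟩
end
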